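/- arXiv:2206.01511 — 5 statements merged into one kernel-verified Lean document; each statement's English description precedes it below -/
import Mathlib

section
/- If G is a finite outerplanar graph, then χ_{vi,2}(G) ≤ Δ(G) + 3. -/
open SimpleGraph

variable {V : Type*}

/-- `(v, e)` is an incidence of `G`: `e` is an edge of `G` and `v ∈ e`. -/
def SimpleGraph.IsIncidence (G : SimpleGraph V) (v : V) (e : Sym2 V) : Prop :=
  e ∈ G.edgeSet ∧ v ∈ e

/-- A vi-simultaneous proper `k`-coloring of `G`, given by a coloring `cV` of the vertices
and a coloring `cI` of the incidences (the value of `cI v e` matters only when `(v, e)` is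
an incidence of `G`). -/
structure SimpleGraph.IsViColoring (G : SimpleGraph V) (k : ℕ)
    (cV : V → Fin k) (cI : V → Sym2 V → Fin k) : Prop where
  /-- adjacent vertices receive distinct colors -/
  adj_ne : ∀ ⦃u v⦄, G.Adj u v → cV u ≠ cV v
  /-- a vertex `u` and an incidence `(w, f)` with `u ∈ f` receive distinct colors -/
  vertex_inc_ne : ∀ ⦃u w f⦄, G.IsIncidence w f → u ∈ f → cV u ≠ cI w f
  /-- two distinct incidences `(v, e)` and `(w, f)` receive distinct colors whenever
  `v = w`, or `e = f`, or the edge `{v, w}` equals `e` or `f` -/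
  inc_ne : ∀ ⦃v e w f⦄, G.IsIncidence v e → G.IsIncidence w f → (v, e) ≠ (w, f) →
    (v = w ∨ e = f ∨ s(v, w) = e ∨ s(v, w) = f) → cI v e ≠ cI w f

/-- The set of colors appearing on the second incidences
`I_2(u) = {(v, {u, v}) : v adjacent to u}` of a vertex `u`. -/
def SimpleGraph.secondIncColors (G : SimpleGraph V) {k : ℕ}
    (cI : V → Sym2 V → Fin k) (u : V) : Set (Fin k) :=
  {a | ∃ v, G.Adj u v ∧ cI v s(u, v) = a}

/-- The vi-simultaneous chromatic number `χ_vi(G)`. -/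
noncomputable def SimpleGraph.chiVi (G : SimpleGraph V) : ℕ :=
  sInf {k | ∃ cV cI, G.IsViColoring k cV cI}

/-- `χ_{vi,s}(G)`: the least `k` admitting a vi-simultaneous `(k, s)`-coloring, i.e. a
vi-simultaneous proper `k`-coloring using at most `s` colors on `I_2(v)` for each vertex `v`. -/
noncomputable def SimpleGraph.chiViS (G : SimpleGraph V) (s : ℕ) : ℕ :=
  sInf {k | ∃ cV cI, G.IsViColoring k cV cI ∧
    ∀ u, (G.secondIncColors cI u).ncard ≤ s}

/-- `G` is outerplanar: there is a linear ordering of the vertices such that no two edges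
`{a, b}` and `{c, d}` satisfy `a < c < b < d`. -/
def SimpleGraph.Outerplanar (G : SimpleGraph V) : Prop :=
  ∃ r : LinearOrder V, ∀ a b c d : V, G.Adj a b → G.Adj c d →
    ¬(r.lt a c ∧ r.lt c b ∧ r.lt b d)

/-- The maximum degree `Δ(G)` of a finite graph. -/
noncomputable def SimpleGraph.maxDeg (G : SimpleGraph V) [Fintype V] : ℕ :=
  Finset.univ.sup fun v => (G.neighborSet v).ncard

/-- `G` is 2-connected: it has at least 3 vertices, is connected, and deleting any single
vertex leaves it connected. -/
def SimpleGraph.TwoConnected (G : SimpleGraph V) [Fintype V] : Prop :=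
  3 ≤ Fintype.card V ∧ G.Connected ∧
    ∀ v : V, (((⊤ : G.Subgraph).deleteVerts {v}).coe).Connected

namespace ViOuterplanar

section Choice

theorem exists_perm_extending {n : ℕ} (hn : 4 ≤ n) {a b c d : Fin n} (hab : a ≠ b) (hac : a ≠ c)
    (had : a ≠ d) (hbc : b ≠ c) (hbd : b ≠ d) (hcd : c ≠ d) :
    ∃ σ : Equiv.Perm (Fin n), σ ⟨0, by omega⟩ = a ∧ σ ⟨1, by omega⟩ = b ∧
      σ ⟨2, by omega⟩ = c ∧ σ ⟨3, by omega⟩ = d := by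
  obtain ⟨g, hg⟩ := Finset.exists_equiv_extend_of_card_eq (α := Fin n) (t := Finset.univ)
    (by simp) (s := {i | i.1 < 4})
    (f := fun i => if i.1 = 0 then a else if i.1 = 1 then b else if i.1 = 2 then c else d)
    (Finset.subset_univ _) (by
      intro i hi j hj hij
      simp only [Finset.coe_filter, Finset.mem_univ, true_and, Set.mem_ofPred_eq] at hi hj
      grind)
  refine ⟨g.trans (Equiv.subtypeUnivEquiv (by simp)), ?_, ?_, ?_, ?_⟩
  · simpa using hg ⟨0, by omega⟩ (by simp)
  · simpa using hg ⟨1, by omega⟩ (by simp)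
  · simpa using hg ⟨2, by omega⟩ (by simp)
  · simpa using hg ⟨3, by omega⟩ (by simp)

theorem exists_not_mem_list {k : ℕ} (l : List (Fin k)) (hl : l.length < k) : ∃ a, a ∉ l := by
  by_contra! h
  have := (List.toFinset_card_le l).trans_lt hl
  rw [show l.toFinset = Finset.univ by ext; simp [h]] at this
  simp at this

set_option synthInstance.maxSize 20000 in
set_option synthInstance.maxHeartbeats 4000000 in
set_option maxRecDepth 10000 in
theorem fill_five_normalized : ∀ d b q₁ q₂ : Fin 5,
    d ≠ b → q₁ ≠ d → q₁ ≠ b → q₂ ≠ d → q₂ ≠ b → q₁ ≠ q₂ →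
    ∃ p, (p = 2 ∨ p = 3) ∧ ∃ q, (q = q₁ ∨ q = q₂) ∧
    ∃ c₁, c₁ ≠ 0 ∧ c₁ ≠ 1 ∧ c₁ ≠ p ∧ ∃ r₁, r₁ ≠ 1 ∧ r₁ ≠ p ∧ r₁ ≠ c₁ ∧
    ∃ s₁, s₁ ≠ p ∧ s₁ ≠ c₁ ∧ s₁ ≠ r₁ ∧ ∃ c₂, c₂ ≠ c₁ ∧ c₂ ≠ r₁ ∧ c₂ ≠ s₁ ∧
    ∃ r₂, r₂ ≠ r₁ ∧ r₂ ≠ s₁ ∧ r₂ ≠ c₂ ∧ r₂ ≠ q ∧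
    ∃ s₂, s₂ ≠ s₁ ∧ s₂ ≠ c₂ ∧ s₂ ≠ r₂ ∧ s₂ ≠ q ∧ s₂ ≠ b ∧
    ∃ c₃, c₃ ≠ c₂ ∧ c₃ ≠ r₂ ∧ c₃ ≠ s₂ ∧ c₃ ≠ q ∧ c₃ ≠ b ∧ c₃ ≠ d := by
  decide +kernel

/-- With five colors, the colors along a path `x, v₁, v₂, v₃, y` can be completed between
`x` (vertex color `c`, outgoing color `a`, allowed incoming colors `S`) and
`y` (vertex color `d`, outgoing color `b`, allowed incoming colors `T`). -/
theorem fill_five {c a d b : Fin 5} {S T : Finset (Fin 5)} (hS : S.card = 2) (hT : T.card = 2)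
    (hcS : c ∉ S) (haS : a ∉ S) (hac : a ≠ c) (hdT : d ∉ T) (hbT : b ∉ T) (hbd : b ≠ d) :
    ∃ p q c₁ r₁ s₁ c₂ r₂ s₂ c₃ : Fin 5, p ∈ S ∧ q ∈ T ∧
      (c₁ ≠ c ∧ c₁ ≠ a ∧ c₁ ≠ p) ∧ (r₁ ≠ a ∧ r₁ ≠ p ∧ r₁ ≠ c₁) ∧
      (s₁ ≠ p ∧ s₁ ≠ c₁ ∧ s₁ ≠ r₁) ∧ (c₂ ≠ c₁ ∧ c₂ ≠ r₁ ∧ c₂ ≠ s₁) ∧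
      (r₂ ≠ r₁ ∧ r₂ ≠ s₁ ∧ r₂ ≠ c₂ ∧ r₂ ≠ q) ∧
      (s₂ ≠ s₁ ∧ s₂ ≠ c₂ ∧ s₂ ≠ r₂ ∧ s₂ ≠ q ∧ s₂ ≠ b) ∧
      (c₃ ≠ c₂ ∧ c₃ ≠ r₂ ∧ c₃ ≠ s₂ ∧ c₃ ≠ q ∧ c₃ ≠ b ∧ c₃ ≠ d) := by
  obtain ⟨p₁, p₂, hp, rfl⟩ := Finset.card_eq_two.1 hS
  obtain ⟨q₁, q₂, hq, rfl⟩ := Finset.card_eq_two.1 hT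
  simp only [Finset.mem_insert, Finset.mem_singleton, not_or] at hcS haS hdT hbT
  obtain ⟨σ, h0, h1, h2, h3⟩ := exists_perm_extending (by norm_num) hac.symm hcS.1 hcS.2
    haS.1 haS.2 hp
  obtain ⟨d, rfl⟩ := σ.surjective d
  obtain ⟨b, rfl⟩ := σ.surjective b
  obtain ⟨q₁, rfl⟩ := σ.surjective q₁
  obtain ⟨q₂, rfl⟩ := σ.surjective q₂
  subst h0 h1 h2 h3
  simp only [σ.injective.eq_iff, ne_eq] at hdT hbT hbd hq
  obtain ⟨p, hp, q, hq, c₁, h1, h2, h3, r₁, h4, h5, h6, s₁, h7, h8, h9, c₂, h10, h11, h12,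
    r₂, h13, h14, h15, h16, s₂, h17, h18, h19, h20, h21, c₃, h22, h23, h24, h25, h26, h27⟩ :=
    fill_five_normalized d b q₁ q₂ (Ne.symm hbd) (Ne.symm hdT.1) (Ne.symm hbT.1)
      (Ne.symm hdT.2) (Ne.symm hbT.2) hq
  refine ⟨σ p, σ q, σ c₁, σ r₁, σ s₁, σ c₂, σ r₂, σ s₂, σ c₃, ?_⟩
  simp only [σ.injective.eq_iff, ne_eq, Finset.mem_insert, Finset.mem_singleton]
  exact ⟨hp, hq, ⟨h1, h2, h3⟩, ⟨h4, h5, h6⟩, ⟨h7, h8, h9⟩, ⟨h10, h11, h12⟩,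
    ⟨h13, h14, h15, h16⟩, ⟨h17, h18, h19, h20, h21⟩, h22, h23, h24, h25, h26, h27⟩

set_option synthInstance.maxSize 20000 in
set_option synthInstance.maxHeartbeats 4000000 in
set_option maxRecDepth 10000 in
theorem fill_six_normalized : ∀ d b q₁ q₂ : Fin 6,
    d ≠ b → q₁ ≠ d → q₁ ≠ b → q₂ ≠ d → q₂ ≠ b → q₁ ≠ q₂ →
    ∃ p, (p = 2 ∨ p = 3) ∧ ∃ q, (q = q₁ ∨ q = q₂) ∧
    ∃ e, e ≠ p ∧ e ≠ q ∧ e ≠ b ∧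
    ∃ t, t ≠ p ∧ t ≠ q ∧ t ≠ e ∧ t ≠ 0 ∧ t ≠ 1 ∧ t ≠ b ∧
    ∃ u, u ≠ t ∧ u ≠ e ∧ u ≠ p ∧ u ≠ 1 ∧
    ∃ g, g ≠ p ∧ g ≠ e ∧ g ≠ u ∧ g ≠ t ∧ g ≠ 1 ∧ g ≠ q ∧
    ∃ w, w ≠ q ∧ w ≠ e ∧ w ≠ t ∧ w ≠ b ∧ w ≠ g ∧ w ≠ d := by
  decide +kernel

/-- With six colors, the colors around a triangle `v, x, y`, where `v` has degree two while `x`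
and `y` have one further neighbor each, can be completed. The further neighbor of `x` has vertex
color `c`, outgoing color `a` and allowed incoming colors `S`; the further neighbor of `y` has
vertex color `d`, outgoing color `b` and allowed incoming colors `T`. -/
theorem fill_six {c a d b : Fin 6} {S T : Finset (Fin 6)} (hS : S.card = 2) (hT : T.card = 2)
    (hcS : c ∉ S) (haS : a ∉ S) (hac : a ≠ c) (hdT : d ∉ T) (hbT : b ∉ T) (hbd : b ≠ d) :
    ∃ p q e t u g w : Fin 6, p ∈ S ∧ q ∈ T ∧
      (e ≠ p ∧ e ≠ q ∧ e ≠ b) ∧ (t ≠ p ∧ t ≠ q ∧ t ≠ e ∧ t ≠ c ∧ t ≠ a ∧ t ≠ b) ∧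
      (u ≠ t ∧ u ≠ e ∧ u ≠ p ∧ u ≠ a) ∧
      (g ≠ p ∧ g ≠ e ∧ g ≠ u ∧ g ≠ t ∧ g ≠ a ∧ g ≠ q) ∧
      (w ≠ q ∧ w ≠ e ∧ w ≠ t ∧ w ≠ b ∧ w ≠ g ∧ w ≠ d) := by
  obtain ⟨p₁, p₂, hp, rfl⟩ := Finset.card_eq_two.1 hS
  obtain ⟨q₁, q₂, hq, rfl⟩ := Finset.card_eq_two.1 hT
  simp only [Finset.mem_insert, Finset.mem_singleton, not_or] at hcS haS hdT hbT
  obtain ⟨σ, h0, h1, h2, h3⟩ := exists_perm_extending (by norm_num) hac.symm hcS.1 hcS.2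
    haS.1 haS.2 hp
  obtain ⟨d, rfl⟩ := σ.surjective d
  obtain ⟨b, rfl⟩ := σ.surjective b
  obtain ⟨q₁, rfl⟩ := σ.surjective q₁
  obtain ⟨q₂, rfl⟩ := σ.surjective q₂
  subst h0 h1 h2 h3
  simp only [σ.injective.eq_iff, ne_eq] at hdT hbT hbd hq
  obtain ⟨p, hp, q, hq, e, h1, h2, h3, t, h4, h5, h6, h7, h8, h9, u, h10, h11, h12, h13,
    g, h14, h15, h16, h17, h18, h19, w, h20, h21, h22, h23, h24, h25⟩ :=
    fill_six_normalized d b q₁ q₂ (Ne.symm hbd) (Ne.symm hdT.1) (Ne.symm hbT.1)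
      (Ne.symm hdT.2) (Ne.symm hbT.2) hq
  refine ⟨σ p, σ q, σ e, σ t, σ u, σ g, σ w, ?_⟩
  simp only [σ.injective.eq_iff, ne_eq, Finset.mem_insert, Finset.mem_singleton]
  exact ⟨hp, hq, ⟨h1, h2, h3⟩, ⟨h4, h5, h6, h7, h8, h9⟩, ⟨h10, h11, h12, h13⟩,
    ⟨h14, h15, h16, h17, h18, h19⟩, h20, h21, h22, h23, h24, h25⟩

end Choice

section Ear

variable [LinearOrder V] {G : SimpleGraph V}

theorem exists_next (hG : ∀ a b c d : V, G.Adj a b → G.Adj c d → ¬(a < c ∧ c < b ∧ b < d))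
    (hleaf : ∀ v x, ¬ ∀ u, G.Adj v u ↔ u = x) {a b : V} (hab : G.Adj a b)
    (hmin : ∀ v u c w, G.Adj v u → a ≤ v → u ≤ b → (a < v ∨ u < b) →
      v < c → c < u → ¬ G.Adj c w)
    {p v : V} (hap : a ≤ p) (hpv : p < v) (hvb : v < b) (hp : ∃ w, G.Adj p w)
    (hv : ∃ w, G.Adj v w) (hno : ∀ c w, p < c → c < v → ¬ G.Adj c w) :
    ∃ w, v < w ∧ w ≤ b ∧ (∀ u, G.Adj v u ↔ u = p ∨ u = w) ∧
      ∀ c u, v < c → c < w → ¬ G.Adj c u := by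
  obtain ⟨p', hp⟩ := hp
  have hav : a < v := hap.trans_lt hpv
  have lower (u) (h : G.Adj v u) : a ≤ u := by
    by_contra! hu
    exact hG u v a b h.symm hab ⟨hu, hav, hvb⟩
  have upper (u) (h : G.Adj v u) : u ≤ b := by
    by_contra! hu
    exact hG a b v u hab h ⟨hav, hvb, hu⟩
  have below (u) (h : G.Adj v u) (huv : u < v) : u = p := by
    rcases lt_trichotomy u p with hu | hu | hu
    · exact absurd hp (hmin u v p p' h.symm (lower u h) hvb.le (.inr hvb) hu hpv)
    · exact hu
    · exact absurd h.symm (hno u v hu huv)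
  have above (u w) (hu : G.Adj v u) (hw : G.Adj v w) (hvu : v < u) (huw : u < w) : False :=
    hmin v w u v hw hav.le (upper w hw) (.inl hav) hvu huw hu.symm
  have above' (u w) (hu : G.Adj v u) (hw : G.Adj v w) (hvu : v < u) (hvw : v < w) : u = w := by
    rcases lt_trichotomy u w with h | h | h
    · exact (above u w hu hw hvu h).elim
    · exact h
    · exact (above w u hw hu hvw h).elim
  obtain ⟨w₁, h₁⟩ := hv
  obtain ⟨w₂, h₂, hne⟩ : ∃ w₂, G.Adj v w₂ ∧ w₂ ≠ w₁ := by
    by_contra! h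
    exact hleaf v w₁ fun u => ⟨h u, fun h => h ▸ h₁⟩
  have key : ∃ w, v < w ∧ G.Adj v w ∧ G.Adj v p := by
    rcases lt_or_gt_of_ne h₁.ne with h | h <;> rcases lt_or_gt_of_ne h₂.ne with h' | h'
    · exact absurd (above' _ _ h₂ h₁ h' h) hne
    · exact ⟨w₁, h, h₁, below _ h₂ h' ▸ h₂⟩
    · exact ⟨w₂, h', h₂, below _ h₁ h ▸ h₁⟩
    · exact absurd ((below _ h₂ h').trans (below _ h₁ h).symm) hne
  obtain ⟨w, hvw, hw, hvp⟩ := key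
  refine ⟨w, hvw, upper w hw, fun u => ⟨fun hu => ?_, ?_⟩, fun c u hvc hcw => ?_⟩
  · rcases lt_or_gt_of_ne hu.ne with h | h
    · exact .inr (above' _ _ hu hw h hvw)
    · exact .inl (below u hu h)
  · rintro (rfl | rfl) <;> assumption
  · exact hmin v w c u hw hav.le (upper w hw) (.inl hav) hvc hcw

/-- In an outerplanar graph with an edge, there is a vertex of degree one, or a triangle with a
vertex of degree two, or a four-cycle with two adjacent vertices of degree two, or a path with
three consecutive inner vertices of degree two. -/
theorem exists_reducible [Finite V]
    (hG : ∀ a b c d : V, G.Adj a b → G.Adj c d → ¬(a < c ∧ c < b ∧ b < d)) (hne : G ≠ ⊥) :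
    (∃ v x, ∀ u, G.Adj v u ↔ u = x) ∨
    (∃ v x y, G.Adj x y ∧ ∀ u, G.Adj v u ↔ u = x ∨ u = y) ∨
    (∃ x v₁ v₂ y, x ≠ v₂ ∧ v₁ ≠ y ∧ G.Adj x y ∧ (∀ u, G.Adj v₁ u ↔ u = x ∨ u = v₂) ∧
      ∀ u, G.Adj v₂ u ↔ u = v₁ ∨ u = y) ∨
    ∃ x v₁ v₂ v₃ y, x ≠ y ∧ x ≠ v₂ ∧ x ≠ v₃ ∧ v₁ ≠ v₃ ∧ v₁ ≠ y ∧ v₂ ≠ y ∧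
      (∀ u, G.Adj v₁ u ↔ u = x ∨ u = v₂) ∧ (∀ u, G.Adj v₂ u ↔ u = v₁ ∨ u = v₃) ∧
      ∀ u, G.Adj v₃ u ↔ u = v₂ ∨ u = y := by
  refine or_iff_not_imp_left.2 fun hleaf => ?_
  push Not at hleaf
  replace hleaf (v x : V) : ¬ ∀ u, G.Adj v u ↔ u = x := fun h => by
    obtain ⟨u, hu⟩ := hleaf v x
    have := h u
    tauto
  let P : Set (V × V) := {e | G.Adj e.1 e.2 ∧ ∃ c w, e.1 < c ∧ c < e.2 ∧ G.Adj c w}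
  have hP : P.Nonempty := by
    obtain ⟨u, v, huv⟩ := SimpleGraph.ne_bot_iff_exists_adj.1 hne
    obtain ⟨m, ⟨w₁, h₁⟩, hm⟩ := (Set.toFinite {m : V | ∃ w, G.Adj m w}).exists_minimal ⟨u, v, huv⟩
    obtain ⟨w₂, h₂, hne⟩ : ∃ w₂, G.Adj m w₂ ∧ w₂ ≠ w₁ := by
      by_contra! h
      exact hleaf m w₁ fun u => ⟨h u, fun h => h ▸ h₁⟩
    have least (w) (h : G.Adj m w) : m < w := by
      rcases lt_or_gt_of_ne h.ne with h' | h'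
      · exact h'
      · exact absurd (hm ⟨m, h.symm⟩ h'.le) (not_le.2 h')
    rcases lt_or_gt_of_ne hne with h | h
    · exact ⟨(m, w₁), h₁, w₂, m, least _ h₂, h, h₂.symm⟩
    · exact ⟨(m, w₂), h₂, w₁, m, least _ h₁, h, h₁.symm⟩
  obtain ⟨⟨a, b⟩, ⟨hab, c₀, w₀, hac, hcb, hc⟩, hmin⟩ :=
    Set.exists_min_image P (fun e => (Set.Icc e.1 e.2).ncard) (Set.toFinite P) hP
  dsimp only at hab hac hcb
  replace hmin (v u c w : V) (hvu : G.Adj v u) (hav : a ≤ v) (hub : u ≤ b)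
      (hlt : a < v ∨ u < b) (hvc : v < c) (hcu : c < u) : ¬ G.Adj c w := fun hcw => by
    refine absurd (hmin (v, u) ⟨hvu, c, w, hvc, hcu, hcw⟩) (not_le.2 ?_)
    refine Set.ncard_lt_ncard ?_ (Set.toFinite _)
    refine (Set.Icc_subset_Icc hav hub).ssubset_of_not_subset fun h => ?_
    have ha := h (Set.left_mem_Icc.2 (hac.trans hcb).le)
    have hb := h (Set.right_mem_Icc.2 (hac.trans hcb).le)
    rcases hlt with hlt | hlt
    · exact absurd ha.1 (not_le.2 hlt)
    · exact absurd hb.2 (not_le.2 hlt)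
  obtain ⟨v₁, ⟨hav₁, hv₁b, hv₁⟩, hleast⟩ :=
    (Set.toFinite {c : V | a < c ∧ c < b ∧ ∃ w, G.Adj c w}).exists_minimal ⟨c₀, hac, hcb, w₀, hc⟩
  have hno (c w : V) (hac : a < c) (hcv : c < v₁) : ¬ G.Adj c w := fun h =>
    absurd (hleast ⟨hac, hcv.trans hv₁b, w, h⟩ hcv.le) (not_le.2 hcv)
  obtain ⟨v₂, h₁₂, h₂b, hN₁, hno⟩ := exists_next hG hleaf hab hmin le_rfl hav₁ hv₁b ⟨b, hab⟩ hv₁ hno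
  rcases h₂b.eq_or_lt with rfl | h₂b
  · exact .inl ⟨v₁, a, v₂, hab, hN₁⟩
  obtain ⟨v₃, h₂₃, h₃b, hN₂, hno⟩ := exists_next hG hleaf hab hmin hav₁.le h₁₂ h₂b hv₁
    ⟨v₁, ((hN₁ v₂).2 (.inr rfl)).symm⟩ hno
  rcases h₃b.eq_or_lt with rfl | h₃b
  · exact .inr (.inl ⟨a, v₁, v₂, v₃, (hav₁.trans h₁₂).ne, (h₁₂.trans h₂₃).ne, hab, hN₁, hN₂⟩)
  obtain ⟨v₄, h₃₄, -, hN₃, -⟩ := exists_next hG hleaf hab hmin (hav₁.trans h₁₂).le h₂₃ h₃b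
    ⟨v₁, (hN₂ v₁).2 (.inl rfl)⟩ ⟨v₂, ((hN₂ v₃).2 (.inr rfl)).symm⟩ hno
  exact .inr (.inr ⟨a, v₁, v₂, v₃, v₄, (hav₁.trans (h₁₂.trans (h₂₃.trans h₃₄))).ne,
    (hav₁.trans h₁₂).ne, (hav₁.trans (h₁₂.trans h₂₃)).ne, (h₁₂.trans h₂₃).ne,
    (h₁₂.trans (h₂₃.trans h₃₄)).ne, (h₂₃.trans h₃₄).ne, hN₁, hN₂, hN₃⟩)

end Ear

section Coloring

/-- A coloring of the vertices and incidences of `G` in a form convenient for extension: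
`c v` is the color of the vertex `v`, `f v u` is the color of the incidence `(v, {v, u})`, and
`S v` is a set of at most two colors containing those of all second incidences of `v`. -/
structure IsArcColoring (G : SimpleGraph V) {k : ℕ} (c : V → Fin k) (S : V → Finset (Fin k))
    (f : V → V → Fin k) : Prop where
  color_ne : ∀ ⦃u v⦄, G.Adj u v → c u ≠ c v
  color_notMem : ∀ v, c v ∉ S v
  card_le : ∀ v, (S v).card ≤ 2
  arc_mem : ∀ ⦃u v⦄, G.Adj u v → f u v ∈ S v
  arc_notMem : ∀ ⦃u v⦄, G.Adj u v → f u v ∉ S u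
  arc_ne_color : ∀ ⦃u v⦄, G.Adj u v → f u v ≠ c u
  arc_ne_arc : ∀ ⦃u v w⦄, G.Adj u v → G.Adj u w → v ≠ w → f u v ≠ f u w

/-- `G` has an arc coloring with `k` colors. -/
def ArcColorable (G : SimpleGraph V) (k : ℕ) : Prop :=
  ∃ (c : V → Fin k) (S : V → Finset (Fin k)) (f : V → V → Fin k), IsArcColoring G c S f

/-- The graph obtained from `G` by deleting all edges that meet `W`. -/
def isolate (G : SimpleGraph V) (W : Set V) : SimpleGraph V where
  Adj u v := G.Adj u v ∧ u ∉ W ∧ v ∉ W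
  symm := ⟨fun _ _ h => ⟨h.1.symm, h.2.2, h.2.1⟩⟩
  loopless := ⟨fun _ h => h.1.ne rfl⟩

variable {G H : SimpleGraph V} {k : ℕ} {c : V → Fin k} {S : V → Finset (Fin k)}
  {f : V → V → Fin k}

theorem isolate_le (G : SimpleGraph V) (W : Set V) : isolate G W ≤ G := fun _ _ h => h.1

theorem isolate_adj {W : Set V} {u v : V} :
    (isolate G W).Adj u v ↔ G.Adj u v ∧ u ∉ W ∧ v ∉ W := Iff.rfl

theorem isolate_lt {W : Set V} {u v : V} (h : G.Adj u v) (hu : u ∈ W) : isolate G W < G :=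
  (isolate_le G W).lt_of_not_ge fun hle => (hle h).2.1 hu

theorem ncard_neighborSet_mono [Finite V] (h : H ≤ G) (v : V) :
    (H.neighborSet v).ncard ≤ (G.neighborSet v).ncard :=
  Set.ncard_le_ncard (fun _ hu => h hu) (Set.toFinite _)

theorem ncard_neighborSet_isolate_add_one [Finite V] {W : Set V} {x w : V} (hw : w ∈ W)
    (h : G.Adj x w) : ((isolate G W).neighborSet x).ncard + 1 ≤ (G.neighborSet x).ncard :=
  Set.ncard_lt_ncard (Set.ssubset_iff_of_subset (fun _ hu => hu.1) |>.2
    ⟨w, h, fun h => h.2.2 hw⟩) (Set.toFinite _)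

theorem ncard_neighborSet_isolate_add_two [Finite V] {W : Set V} {x w w' : V} (hw : w ∈ W)
    (hw' : w' ∈ W) (h : G.Adj x w) (h' : G.Adj x w') (hne : w ≠ w') :
    ((isolate G W).neighborSet x).ncard + 2 ≤ (G.neighborSet x).ncard := by
  have h₁ : w ∉ (isolate G W).neighborSet x := fun h => h.2.2 hw
  have h₂ : w' ∉ insert w ((isolate G W).neighborSet x) := by
    rintro (h | h)
    · exact hne h.symm
    · exact h.2.2 hw'
  rw [show 2 = 1 + 1 from rfl, ← add_assoc, ← Set.ncard_insert_of_notMem h₁ (Set.toFinite _),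
    ← Set.ncard_insert_of_notMem h₂ (Set.toFinite _)]
  refine Set.ncard_le_ncard ?_ (Set.toFinite _)
  rintro u (rfl | rfl | h)
  exacts [h', h, h.1]

/-- A color that can be used for a new incidence at `x`. -/
def IsFree (H : SimpleGraph V) (c : V → Fin k) (S : V → Finset (Fin k)) (f : V → V → Fin k)
    (x : V) (a : Fin k) : Prop :=
  a ∉ S x ∧ a ≠ c x ∧ ∀ u, H.Adj x u → f x u ≠ a

theorem exists_isFree [Finite V] {x : V} (X : Finset (Fin k))
    (hk : (H.neighborSet x).ncard + 1 + (S x).card + X.card < k) :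
    ∃ a ∉ X, IsFree H c S f x a := by
  classical
  have := Fintype.ofFinite V
  have hcard : ((H.neighborSet x).toFinset.image (f x) ∪ {c x} ∪ S x ∪ X).card < k := by
    refine lt_of_le_of_lt ?_ hk
    refine (Finset.card_union_le _ _).trans (Nat.add_le_add_right ?_ _)
    refine (Finset.card_union_le _ _).trans (Nat.add_le_add_right ?_ _)
    refine (Finset.card_union_le _ _).trans (Nat.add_le_add_right ?_ _)
    rw [Set.ncard_eq_toFinset_card']
    exact Finset.card_image_le
  obtain ⟨a, ha⟩ : ∃ a, a ∉ (H.neighborSet x).toFinset.image (f x) ∪ {c x} ∪ S x ∪ X := by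
    by_contra! h
    rw [Finset.eq_univ_of_forall h] at hcard
    simp at hcard
  simp only [Finset.mem_union, Finset.mem_image, Set.mem_toFinset, SimpleGraph.mem_neighborSet,
    Finset.mem_singleton, not_or, not_exists, not_and] at ha
  exact ⟨a, ha.2, ha.1.2, ha.1.1.2, ha.1.1.1⟩

/-- The sets of an arc coloring can be enlarged to have exactly two elements. -/
theorem ArcColorable.exists_card_eq_two [Finite V] (h : ArcColorable H k)
    (hk : ∀ v, (H.neighborSet v).ncard + 3 ≤ k) :
    ∃ (c : V → Fin k) (S : V → Finset (Fin k)) (f : V → V → Fin k),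
      IsArcColoring H c S f ∧ ∀ v, (S v).card = 2 := by
  classical
  have := Fintype.ofFinite V
  obtain ⟨c, S, f, h⟩ := h
  have key (v : V) : ∃ T, S v ⊆ T ∧ T.card = 2 ∧
      T ⊆ (insert (c v) ((H.neighborSet v).toFinset.image (f v)))ᶜ := by
    have hsub : S v ⊆ (insert (c v) ((H.neighborSet v).toFinset.image (f v)))ᶜ := by
      intro a ha
      simp only [Finset.compl_insert, Finset.mem_erase, Finset.mem_compl, Finset.mem_image,
        Set.mem_toFinset, SimpleGraph.mem_neighborSet, not_exists, not_and]
      exact ⟨fun e => h.color_notMem v (e ▸ ha), fun u hu e => h.arc_notMem hu (e ▸ ha)⟩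
    obtain ⟨T, h₁, h₂, h₃⟩ := Finset.exists_subsuperset_card_eq hsub (h.card_le v) (by
      have h₁ := Finset.card_insert_le (c v) ((H.neighborSet v).toFinset.image (f v))
      have h₂ := Finset.card_image_le (s := (H.neighborSet v).toFinset) (f := f v)
      have h₃ := hk v
      rw [Set.ncard_eq_toFinset_card'] at h₃
      rw [Finset.card_compl, Fintype.card_fin]
      omega)
    exact ⟨T, h₁, h₃, h₂⟩
  choose T hST hT hTc using key
  simp only [Finset.subset_iff, Finset.compl_insert, Finset.mem_erase, Finset.mem_compl,
    Finset.mem_image, Set.mem_toFinset, SimpleGraph.mem_neighborSet, not_exists, not_and] at hTc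
  exact ⟨c, T, f, ⟨h.color_ne, fun v hv => (hTc v hv).1 rfl, fun v => (hT v).le,
    fun u v huv => hST v (h.arc_mem huv), fun u v huv hm => (hTc u hm).2 v huv rfl,
    h.arc_ne_color, h.arc_ne_arc⟩, hT⟩

/-- An arc coloring of `isolate G W` modified at `W` is an arc coloring of `G` as soon as the
conditions at `W` hold. -/
theorem IsArcColoring.extend {W : Set V} (h : IsArcColoring (isolate G W) c S f)
    {c' : V → Fin k} {S' : V → Finset (Fin k)} {f' : V → V → Fin k}
    (hc : ∀ u ∉ W, c' u = c u) (hS : ∀ u ∉ W, S' u = S u)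
    (hf : ∀ u ∉ W, ∀ w ∉ W, f' u w = f u w)
    (hW : ∀ w ∈ W, c' w ∉ S' w ∧ (S' w).card ≤ 2)
    (hadj : ∀ w ∈ W, ∀ u, G.Adj w u → c' w ≠ c' u ∧ f' w u ∈ S' u ∧ f' u w ∈ S' w ∧
      f' w u ∉ S' w ∧ f' u w ∉ S' u ∧ f' w u ≠ c' w ∧ f' u w ≠ c' u)
    (hout : ∀ w ∈ W, ∀ u u', G.Adj w u → G.Adj w u' → u ≠ u' → f' w u ≠ f' w u')
    (hin : ∀ x ∉ W, ∀ w ∈ W, G.Adj x w → ∀ u, G.Adj x u → u ≠ w → f' x u ≠ f' x w) :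
    IsArcColoring G c' S' f' where
  color_ne u v huv := by
    by_cases hu : u ∈ W
    · exact (hadj u hu v huv).1
    by_cases hv : v ∈ W
    · exact (hadj v hv u huv.symm).1.symm
    rw [hc u hu, hc v hv]
    exact h.color_ne ⟨huv, hu, hv⟩
  color_notMem v := by
    by_cases hv : v ∈ W
    · exact (hW v hv).1
    rw [hc v hv, hS v hv]
    exact h.color_notMem v
  card_le v := by
    by_cases hv : v ∈ W
    · exact (hW v hv).2
    rw [hS v hv]
    exact h.card_le v
  arc_mem u v huv := by
    by_cases hu : u ∈ W
    · exact (hadj u hu v huv).2.1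
    by_cases hv : v ∈ W
    · exact (hadj v hv u huv.symm).2.2.1
    rw [hf u hu v hv, hS v hv]
    exact h.arc_mem ⟨huv, hu, hv⟩
  arc_notMem u v huv := by
    by_cases hu : u ∈ W
    · exact (hadj u hu v huv).2.2.2.1
    by_cases hv : v ∈ W
    · exact (hadj v hv u huv.symm).2.2.2.2.1
    rw [hf u hu v hv, hS u hu]
    exact h.arc_notMem ⟨huv, hu, hv⟩
  arc_ne_color u v huv := by
    by_cases hu : u ∈ W
    · exact (hadj u hu v huv).2.2.2.2.2.1
    by_cases hv : v ∈ W
    · exact (hadj v hv u huv.symm).2.2.2.2.2.2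
    rw [hf u hu v hv, hc u hu]
    exact h.arc_ne_color ⟨huv, hu, hv⟩
  arc_ne_arc u v w huv huw hvw := by
    by_cases hu : u ∈ W
    · exact hout u hu v w huv huw hvw
    by_cases hv : v ∈ W
    · exact (hin u hu v hv huv w huw hvw.symm).symm
    by_cases hw : w ∈ W
    · exact hin u hu w hw huw v huv hvw
    rw [hf u hu v hv, hf u hu w hw]
    exact h.arc_ne_arc ⟨huv, hu, hv⟩ ⟨huw, hu, hw⟩ hvw

end Coloring

section Extension

variable {G : SimpleGraph V} {k : ℕ}

theorem arcColorable_of_isolated_triangle {v x y : V} (hv : ∀ u, G.Adj v u ↔ u = x ∨ u = y)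
    (hx : ∀ u, G.Adj x u ↔ u = v ∨ u = y) (hy : ∀ u, G.Adj y u ↔ u = v ∨ u = x)
    (h : ArcColorable (isolate G {v, x, y}) 5) : ArcColorable G 5 := by
  classical
  have hv' (u) : G.Adj u v ↔ u = x ∨ u = y := by rw [G.adj_comm, hv]
  have hx' (u) : G.Adj u x ↔ u = v ∨ u = y := by rw [G.adj_comm, hx]
  have hy' (u) : G.Adj u y ↔ u = v ∨ u = x := by rw [G.adj_comm, hy]
  have hnvx := ((hv x).2 (.inl rfl)).ne
  have hnvy := ((hv y).2 (.inr rfl)).ne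
  have hnxy := ((hx y).2 (.inr rfl)).ne
  obtain ⟨c, S, f, h⟩ := h
  refine ⟨Function.update (Function.update (Function.update c v 0) x 3) y 2,
    Function.update (Function.update (Function.update S v {2, 3}) x {1}) y {0, 4},
    fun m n => if n = x ∧ (m = v ∨ m = y) then 1 else if m = x ∧ n = v then 2 else
      if m = x ∧ n = y then 0 else if m = y ∧ n = v then 3 else if m = v ∧ n = y then 4 else f m n,
    h.extend ?_ ?_ ?_ ?_ ?_ ?_ ?_⟩
  all_goals clear h
  all_goals simp only [Set.mem_insert_iff, Set.mem_singleton_iff,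
    Function.update_apply] at *
  all_goals grind (splits := 40) [Finset.card_le_two]

theorem arcColorable_of_isolated_square {v x y z : V} (hvy : v ≠ y) (hxz : x ≠ z)
    (hv : ∀ u, G.Adj v u ↔ u = x ∨ u = z) (hx : ∀ u, G.Adj x u ↔ u = v ∨ u = y)
    (hy : ∀ u, G.Adj y u ↔ u = x ∨ u = z) (hz : ∀ u, G.Adj z u ↔ u = v ∨ u = y)
    (h : ArcColorable (isolate G {v, x, y, z}) 5) : ArcColorable G 5 := by
  classical
  have hv' (u) : G.Adj u v ↔ u = x ∨ u = z := by rw [G.adj_comm, hv]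
  have hx' (u) : G.Adj u x ↔ u = v ∨ u = y := by rw [G.adj_comm, hx]
  have hy' (u) : G.Adj u y ↔ u = x ∨ u = z := by rw [G.adj_comm, hy]
  have hz' (u) : G.Adj u z ↔ u = v ∨ u = y := by rw [G.adj_comm, hz]
  have hnvx := ((hv x).2 (.inl rfl)).ne
  have hnvz := ((hv z).2 (.inr rfl)).ne
  have hnxy := ((hx y).2 (.inr rfl)).ne
  have hnyz := ((hy z).2 (.inr rfl)).ne
  obtain ⟨c, S, f, h⟩ := h
  refine ⟨Function.update (Function.update (Function.update (Function.update c v 0) x 3) y 2) z 1,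
    Function.update (Function.update (Function.update (Function.update S v {2}) x {1}) y {0}) z {3},
    fun m n => if n = v ∧ (m = x ∨ m = z) then 2 else if n = x ∧ (m = v ∨ m = y) then 1 else
      if n = y ∧ (m = x ∨ m = z) then 0 else if n = z ∧ (m = v ∨ m = y) then 3 else f m n,
    h.extend ?_ ?_ ?_ ?_ ?_ ?_ ?_⟩
  all_goals clear h
  all_goals simp only [Set.mem_insert_iff, Set.mem_singleton_iff,
    Function.update_apply] at *
  all_goals grind (splits := 40) [Finset.card_le_two]

variable [Finite V]

theorem ArcColorable.exists_isFree {W : Set V} (h : ArcColorable (isolate G W) k)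
    (hk : ∀ v, (G.neighborSet v).ncard + 3 ≤ k) :
    ∃ (c : V → Fin k) (S : V → Finset (Fin k)) (f : V → V → Fin k),
      IsArcColoring (isolate G W) c S f ∧ (∀ v, (S v).card = 2) ∧
      (∀ x, ∀ w ∈ W, G.Adj x w → ∃ a, IsFree (isolate G W) c S f x a) ∧
      ∀ x, ∀ w ∈ W, ∀ w' ∈ W, G.Adj x w → G.Adj x w' → w ≠ w' → ∃ a b, a ≠ b ∧
        IsFree (isolate G W) c S f x a ∧ IsFree (isolate G W) c S f x b := by
  obtain ⟨c, S, f, h, hS⟩ := h.exists_card_eq_two fun u =>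
    (Nat.add_le_add_right (ncard_neighborSet_mono (isolate_le G W) u) 3).trans (hk u)
  refine ⟨c, S, f, h, hS, fun x w hw hxw => ?_, fun x w hw w' hw' hxw hxw' hne => ?_⟩
  · have h₁ := ncard_neighborSet_isolate_add_one hw hxw
    have h₂ := hk x
    obtain ⟨a, -, ha⟩ := ViOuterplanar.exists_isFree (c := c) (f := f) (S := S)
      (H := isolate G W) (x := x) ∅ (by
        rw [hS, Finset.card_empty]
        omega)
    exact ⟨a, ha⟩
  · have h₁ := ncard_neighborSet_isolate_add_two hw hw' hxw hxw' hne
    have h₂ := hk x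
    obtain ⟨a, -, ha⟩ := ViOuterplanar.exists_isFree (c := c) (f := f) (S := S)
      (H := isolate G W) (x := x) ∅ (by
        rw [hS, Finset.card_empty]
        omega)
    obtain ⟨b, hba, hb⟩ := ViOuterplanar.exists_isFree (c := c) (f := f) (S := S)
      (H := isolate G W) (x := x) {a} (by
        rw [hS, Finset.card_singleton]
        omega)
    exact ⟨a, b, fun e => hba (by simp [e]), ha, hb⟩

theorem arcColorable_of_leaf (hk : ∀ v, (G.neighborSet v).ncard + 3 ≤ k) {v x : V}
    (hv : ∀ u, G.Adj v u ↔ u = x) (h : ArcColorable (isolate G {v}) k) : ArcColorable G k := by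
  classical
  have hvx : G.Adj v x := (hv x).2 rfl
  have hne := hvx.ne
  have hv' (u) : G.Adj u v ↔ u = x := by rw [G.adj_comm, hv]
  have hx := ncard_neighborSet_isolate_add_one (W := {v}) rfl hvx.symm
  obtain ⟨c, S, f, h, hS, hfree, -⟩ := h.exists_isFree hk
  obtain ⟨a, ha, hac, haf⟩ := hfree x v rfl hvx.symm
  obtain ⟨p, hp⟩ : (S x).Nonempty := Finset.card_pos.1 (by rw [hS]; omega)
  obtain ⟨b, hb⟩ := exists_not_mem_list [c x, a, p] (by have := hk x; simp; omega)
  simp only [List.mem_cons, List.not_mem_nil, or_false, not_or] at hb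
  have hcx := h.color_notMem x
  refine ⟨Function.update c v b, Function.update S v {a},
    fun u w => if u = x ∧ w = v then a else if u = v ∧ w = x then p else f u w,
    h.extend ?_ ?_ ?_ ?_ ?_ ?_ ?_⟩
  all_goals clear hfree hk h hS
  all_goals simp only [Set.mem_singleton_iff, isolate_adj, Function.update_apply] at *
  all_goals grind

/-- A vertex of degree two in a triangle can be colored last if there are seven colors. -/
theorem arcColorable_of_triangle (hk : ∀ v, (G.neighborSet v).ncard + 3 ≤ k) (hk7 : 7 ≤ k)
    {v x y : V} (hxy : G.Adj x y) (hv : ∀ u, G.Adj v u ↔ u = x ∨ u = y)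
    (h : ArcColorable (isolate G {v}) k) : ArcColorable G k := by
  classical
  have hvx : G.Adj v x := (hv x).2 (.inl rfl)
  have hvy : G.Adj v y := (hv y).2 (.inr rfl)
  have hv' (u) : G.Adj u v ↔ u = x ∨ u = y := by rw [G.adj_comm, hv]
  have hnx := hvx.ne
  have hny := hvy.ne
  have hnxy := hxy.ne
  obtain ⟨c, S, f, h, hS, hfree, -⟩ := h.exists_isFree hk
  obtain ⟨a, ha, hac, haf⟩ := hfree x v rfl hvx.symm
  obtain ⟨b, hb, hbc, hbf⟩ := hfree y v rfl hvy.symm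
  have hH : (isolate G {v}).Adj x y := ⟨hxy, hnx.symm, hny.symm⟩
  obtain ⟨p, q, hp, hq, hpq, hpb, hqa⟩ :
      ∃ p q, p ∈ S x ∧ q ∈ S y ∧ p ≠ q ∧ p ≠ b ∧ q ≠ a :=
    ⟨f y x, f x y, h.arc_mem hH.symm, h.arc_mem hH, fun e => h.arc_notMem hH (e ▸
      h.arc_mem hH.symm), hbf x hH.symm, haf y hH⟩
  obtain ⟨d, hd⟩ := exists_not_mem_list [c x, c y, a, b, p, q] (by simp; omega)
  simp only [List.mem_cons, List.not_mem_nil, or_false, not_or] at hd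
  have hcx := h.color_notMem x
  have hcy := h.color_notMem y
  refine ⟨Function.update c v d, Function.update S v {a, b},
    fun u w => if u = x ∧ w = v then a else if u = y ∧ w = v then b else
      if u = v ∧ w = x then p else if u = v ∧ w = y then q else f u w,
    h.extend ?_ ?_ ?_ ?_ ?_ ?_ ?_⟩
  all_goals clear hfree hk h hS
  all_goals simp only [Set.mem_singleton_iff, isolate_adj, Function.update_apply] at *
  all_goals grind [Finset.card_le_two]

/-- Two adjacent vertices of degree two can be colored last if there are six colors. -/
theorem arcColorable_of_path_two (hk : ∀ v, (G.neighborSet v).ncard + 3 ≤ k) (hk6 : 6 ≤ k)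
    {x v w y : V} (hxy : x ≠ y) (hxw : x ≠ w) (hvy : v ≠ y) (hv : ∀ u, G.Adj v u ↔ u = x ∨ u = w)
    (hw : ∀ u, G.Adj w u ↔ u = v ∨ u = y)
    (h : ArcColorable (isolate G {v, w}) k) : ArcColorable G k := by
  classical
  have hvx : G.Adj v x := (hv x).2 (.inl rfl)
  have hvw : G.Adj v w := (hv w).2 (.inr rfl)
  have hwy : G.Adj w y := (hw y).2 (.inr rfl)
  have hv' (u) : G.Adj u v ↔ u = x ∨ u = w := by rw [G.adj_comm, hv]
  have hw' (u) : G.Adj u w ↔ u = v ∨ u = y := by rw [G.adj_comm, hw]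
  have hnx := hvx.ne
  have hnw := hvw.ne
  have hny := hwy.ne
  obtain ⟨c, S, f, h, hS, hfree, -⟩ := h.exists_isFree hk
  obtain ⟨a, ha, hac, haf⟩ := hfree x v (.inl rfl) hvx.symm
  obtain ⟨b, hb, hbc, hbf⟩ := hfree y w (.inr rfl) hwy.symm
  obtain ⟨p, hp⟩ : (S x).Nonempty := Finset.card_pos.1 (by rw [hS]; omega)
  obtain ⟨q, hq, hqc⟩ : ∃ q ∈ S y, q ≠ c x :=
    Finset.exists_mem_ne (by rw [hS]; omega) (c x)
  obtain ⟨s, hs⟩ := exists_not_mem_list [p, c x, q, b] (by simp; omega)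
  obtain ⟨e, he⟩ := exists_not_mem_list [c y, b, q, s, c x] (by simp; omega)
  obtain ⟨d, hd⟩ := exists_not_mem_list [c x, a, p, s, e] (by simp; omega)
  simp only [List.mem_cons, List.not_mem_nil, or_false, not_or] at hs he hd
  have hcx := h.color_notMem x
  have hcy := h.color_notMem y
  refine ⟨Function.update (Function.update c v d) w e,
    Function.update (Function.update S v {a, s}) w {b, c x},
    fun u u' => if u = x ∧ u' = v then a else if u = y ∧ u' = w then b else
      if u = v ∧ u' = x then p else if u = w ∧ u' = y then q else
      if u = v ∧ u' = w then c x else if u = w ∧ u' = v then s else f u u',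
    h.extend ?_ ?_ ?_ ?_ ?_ ?_ ?_⟩
  all_goals clear hfree hk h hS
  all_goals simp only [Set.mem_insert_iff, Set.mem_singleton_iff, isolate_adj,
    Function.update_apply] at *
  all_goals grind (splits := 25) [Finset.card_le_two]

/-- Two adjacent vertices of degree two in a triangle can be colored last if there are six
colors. -/
theorem arcColorable_of_pendant_triangle (hk : ∀ v, (G.neighborSet v).ncard + 3 ≤ k)
    (hk6 : 6 ≤ k) {v x y : V} (hv : ∀ u, G.Adj v u ↔ u = x ∨ u = y)
    (hx : ∀ u, G.Adj x u ↔ u = v ∨ u = y)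
    (h : ArcColorable (isolate G {v, x}) k) : ArcColorable G k := by
  classical
  have hvx : G.Adj v x := (hv x).2 (.inl rfl)
  have hvy : G.Adj v y := (hv y).2 (.inr rfl)
  have hxy : G.Adj x y := (hx y).2 (.inr rfl)
  have hv' (u) : G.Adj u v ↔ u = x ∨ u = y := by rw [G.adj_comm, hv]
  have hx' (u) : G.Adj u x ↔ u = v ∨ u = y := by rw [G.adj_comm, hx]
  have hnvx := hvx.ne
  have hnvy := hvy.ne
  have hnxy := hxy.ne
  obtain ⟨c, S, f, h, hS, -, hfree⟩ := h.exists_isFree hk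
  obtain ⟨a, b, hab, ⟨ha, hac, haf⟩, ⟨hb, hbc, hbf⟩⟩ :=
    hfree y v (.inl rfl) x (.inr rfl) hvy.symm hxy.symm hnvx
  obtain ⟨p, hp⟩ : (S y).Nonempty := Finset.card_pos.1 (by rw [hS]; omega)
  obtain ⟨d, hd⟩ := exists_not_mem_list [p, a, b, c y] (by simp; omega)
  obtain ⟨e, he⟩ := exists_not_mem_list [p, a, b, c y, d] (by simp; omega)
  simp only [List.mem_cons, List.not_mem_nil, or_false, not_or] at hd he
  have hcy := h.color_notMem y
  refine ⟨Function.update (Function.update c v d) x e,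
    Function.update (Function.update S v {a}) x {b},
    fun u w => if u = y ∧ w = v then a else if u = y ∧ w = x then b else
      if w = y ∧ (u = v ∨ u = x) then p else if u = v ∧ w = x then b else
      if u = x ∧ w = v then a else f u w,
    h.extend ?_ ?_ ?_ ?_ ?_ ?_ ?_⟩
  all_goals clear hfree hk h hS
  all_goals simp only [Set.mem_insert_iff, Set.mem_singleton_iff, isolate_adj,
    Function.update_apply] at *
  all_goals grind (splits := 25) [Finset.card_le_two]

/-- A triangle with a vertex of degree two and two vertices of degree three can be colored last
if there are six colors. -/
theorem arcColorable_of_triangle_six (hk : ∀ v, (G.neighborSet v).ncard + 3 ≤ 6)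
    {v x y x' y' : V} (hvx' : v ≠ x') (hvy' : v ≠ y') (hyx' : y ≠ x') (hxy' : x ≠ y')
    (hv : ∀ u, G.Adj v u ↔ u = x ∨ u = y)
    (hx : ∀ u, G.Adj x u ↔ u = v ∨ u = y ∨ u = x') (hy : ∀ u, G.Adj y u ↔ u = v ∨ u = x ∨ u = y')
    (h : ArcColorable (isolate G {v, x, y}) 6) : ArcColorable G 6 := by
  classical
  have hvx : G.Adj v x := (hv x).2 (.inl rfl)
  have hvy : G.Adj v y := (hv y).2 (.inr rfl)
  have hxy : G.Adj x y := (hx y).2 (.inr (.inl rfl))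
  have hxx' : G.Adj x x' := (hx x').2 (.inr (.inr rfl))
  have hyy' : G.Adj y y' := (hy y').2 (.inr (.inr rfl))
  have hv' (u) : G.Adj u v ↔ u = x ∨ u = y := by rw [G.adj_comm, hv]
  have hx' (u) : G.Adj u x ↔ u = v ∨ u = y ∨ u = x' := by rw [G.adj_comm, hx]
  have hy' (u) : G.Adj u y ↔ u = v ∨ u = x ∨ u = y' := by rw [G.adj_comm, hy]
  have hnvx := hvx.ne
  have hnvy := hvy.ne
  have hnxy := hxy.ne
  have hnxx' := hxx'.ne
  have hnyy' := hyy'.ne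
  obtain ⟨c, S, f, h, hS, hfree, hfree₂⟩ := h.exists_isFree hk
  obtain ⟨a, b, ⟨ha, hac, haf⟩, ⟨hb, hbc, hbf⟩, hab⟩ : ∃ a b,
      IsFree (isolate G {v, x, y}) c S f x' a ∧ IsFree (isolate G {v, x, y}) c S f y' b ∧
      (x' = y' → a ≠ b) := by
    by_cases he : x' = y'
    · subst he
      obtain ⟨a, b, hab, ha, hb⟩ := hfree₂ x' x (by simp) y (by simp) hxx'.symm hyy'.symm hnxy
      exact ⟨a, b, ha, hb, fun _ => hab⟩
    · obtain ⟨a, ha⟩ := hfree x' x (by simp) hxx'.symm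
      obtain ⟨b, hb⟩ := hfree y' y (by simp) hyy'.symm
      exact ⟨a, b, ha, hb, fun h => absurd h he⟩
  obtain ⟨p, q, e, t, u, g, w, hp, hq, he, ht, hu, hg, hw⟩ := fill_six (hS x') (hS y')
    (h.color_notMem x') ha hac (h.color_notMem y') hb hbc
  obtain ⟨z, hz⟩ := exists_not_mem_list [e, g, u, t, w] (by simp)
  refine ⟨Function.update (Function.update (Function.update c x t) y w) v z,
    Function.update (Function.update (Function.update S v {u, t}) x {a, e}) y {b, g},
    fun m n => if m = x' ∧ n = x then a else if m = y' ∧ n = y then b else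
      if m = x ∧ n = x' then p else if m = y ∧ n = y' then q else
      if (m = y ∨ m = v) ∧ n = x then e else if (m = x ∨ m = v) ∧ n = y then g else
      if m = y ∧ n = v then t else if m = x ∧ n = v then u else f m n,
    h.extend ?_ ?_ ?_ ?_ ?_ ?_ ?_⟩
  all_goals clear hfree hfree₂ hk h hS
  all_goals simp only [Set.mem_insert_iff, Set.mem_singleton_iff, isolate_adj,
    Function.update_apply, List.mem_cons, List.not_mem_nil, or_false, not_or] at *
  all_goals grind (splits := 40) [Finset.card_le_two]

/-- Three consecutive vertices of degree two can be colored last if there are five colors. -/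
theorem arcColorable_of_path_three (hk : ∀ v, (G.neighborSet v).ncard + 3 ≤ 5) {x u v w y : V}
    (hxy : x ≠ y) (hxv : x ≠ v) (hxw : x ≠ w) (huw : u ≠ w) (huy : u ≠ y) (hvy : v ≠ y)
    (hu : ∀ t, G.Adj u t ↔ t = x ∨ t = v) (hv : ∀ t, G.Adj v t ↔ t = u ∨ t = w)
    (hw : ∀ t, G.Adj w t ↔ t = v ∨ t = y)
    (h : ArcColorable (isolate G {u, v, w}) 5) : ArcColorable G 5 := by
  classical
  have hu' (t) : G.Adj t u ↔ t = x ∨ t = v := by rw [G.adj_comm, hu]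
  have hv' (t) : G.Adj t v ↔ t = u ∨ t = w := by rw [G.adj_comm, hv]
  have hw' (t) : G.Adj t w ↔ t = v ∨ t = y := by rw [G.adj_comm, hw]
  have hux := (hu x).2 (.inl rfl)
  have hwy := (hw y).2 (.inr rfl)
  have hnux := hux.ne
  have hnwy := hwy.ne
  have hnuv := ((hu v).2 (.inr rfl)).ne
  have hnvw := ((hv w).2 (.inr rfl)).ne
  obtain ⟨c, S, f, h, hS, hfree, -⟩ := h.exists_isFree hk
  obtain ⟨a, ha, hac, haf⟩ := hfree x u (by simp) hux.symm
  obtain ⟨b, hb, hbc, hbf⟩ := hfree y w (by simp) hwy.symm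
  obtain ⟨p, q, c₁, r₁, s₁, c₂, r₂, s₂, c₃, hp, hq, hc₁, hr₁, hs₁, hc₂, hr₂, hs₂, hc₃⟩ :=
    fill_five (hS x) (hS y) (h.color_notMem x) ha hac (h.color_notMem y) hb hbc
  refine ⟨Function.update (Function.update (Function.update c u c₁) v c₂) w c₃,
    Function.update (Function.update (Function.update S u {a, s₁}) v {r₁, s₂}) w {r₂, b},
    fun m n => if m = x ∧ n = u then a else if m = u ∧ n = x then p else
      if m = u ∧ n = v then r₁ else if m = v ∧ n = u then s₁ else if m = v ∧ n = w then r₂ else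
      if m = w ∧ n = v then s₂ else if m = w ∧ n = y then q else if m = y ∧ n = w then b else f m n,
    h.extend ?_ ?_ ?_ ?_ ?_ ?_ ?_⟩
  all_goals clear hfree hk h hS
  all_goals simp only [Set.mem_insert_iff, Set.mem_singleton_iff, isolate_adj,
    Function.update_apply] at *
  all_goals grind (splits := 40) [Finset.card_le_two]

end Extension

section Main

variable {G : SimpleGraph V} {k : ℕ}

theorem adj_iff_of_ncard_le_two [Finite V] {x a b : V} (hx : (G.neighborSet x).ncard ≤ 2)
    (ha : G.Adj x a) (hb : G.Adj x b) (hab : a ≠ b) (u : V) : G.Adj x u ↔ u = a ∨ u = b := by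
  have h : {a, b} = G.neighborSet x := Set.eq_of_subset_of_ncard_le (by grind [mem_neighborSet])
    (by rwa [Set.ncard_pair hab]) (Set.toFinite _)
  rw [← SimpleGraph.mem_neighborSet, ← h, Set.mem_insert_iff, Set.mem_singleton_iff]

theorem adj_iff_of_ncard_le_three [Finite V] {x a b : V} (hx : (G.neighborSet x).ncard ≤ 3)
    (ha : G.Adj x a) (hb : G.Adj x b) (hab : a ≠ b) :
    (∀ u, G.Adj x u ↔ u = a ∨ u = b) ∨
      ∃ c, c ≠ a ∧ c ≠ b ∧ ∀ u, G.Adj x u ↔ u = a ∨ u = b ∨ u = c := by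
  refine or_iff_not_imp_left.2 fun hne => ?_
  obtain ⟨c, hc, hca, hcb⟩ : ∃ c, G.Adj x c ∧ c ≠ a ∧ c ≠ b := by
    by_contra! h
    exact hne fun u => ⟨fun hu => or_iff_not_imp_left.2 (h u hu), by
      rintro (rfl | rfl) <;> assumption⟩
  refine ⟨c, hca, hcb, fun u => ?_⟩
  have h : {a, b, c} = G.neighborSet x := Set.eq_of_subset_of_ncard_le
    (by grind [mem_neighborSet])
    (by rwa [Set.ncard_eq_three.2 ⟨a, b, c, hab, hca.symm, hcb.symm, rfl⟩]) (Set.toFinite _)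
  rw [← SimpleGraph.mem_neighborSet, ← h]
  rfl

theorem two_le_ncard_neighborSet [Finite V] {x a b : V} (ha : G.Adj x a) (hb : G.Adj x b)
    (hab : a ≠ b) : 2 ≤ (G.neighborSet x).ncard := by
  rw [← Set.ncard_pair hab]
  exact Set.ncard_le_ncard (by grind [mem_neighborSet]) (Set.toFinite _)

theorem arcColorable_of_noncrossing [LinearOrder V] [Finite V]
    (hG : ∀ a b c d : V, G.Adj a b → G.Adj c d → ¬(a < c ∧ c < b ∧ b < d)) (hk3 : 3 ≤ k)
    (hk : ∀ v, (G.neighborSet v).ncard + 3 ≤ k) : ArcColorable G k := by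
  induction G using WellFoundedLT.induction with
  | ind G ih =>
    have step {W : Set V} {u v : V} (huv : G.Adj u v) (hu : u ∈ W) :
        ArcColorable (isolate G W) k :=
      ih _ (isolate_lt huv hu) (fun a b c d hab hcd => hG a b c d hab.1 hcd.1) fun v =>
        (Nat.add_le_add_right (ncard_neighborSet_mono (isolate_le G W) v) 3).trans (hk v)
    by_cases hbot : G = ⊥
    · subst hbot
      exact ⟨fun _ => ⟨0, by omega⟩, fun _ => ∅, fun _ _ => ⟨0, by omega⟩, by
        constructor <;> simp⟩
    obtain ⟨v, x, hv⟩ | ⟨v, x, y, hxy, hv⟩ | ⟨x, v, w, y, hxw, hvy, hxy, hv, hw⟩ |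
        ⟨x, u, v, w, y, hxy, hxv, hxw, huw, huy, hvy, hu, hv, hw⟩ := exists_reducible hG hbot
    · exact arcColorable_of_leaf hk hv (step ((hv x).2 rfl) rfl)
    · have hvx : G.Adj v x := (hv x).2 (.inl rfl)
      have hvy : G.Adj v y := (hv y).2 (.inr rfl)
      have h₂ := two_le_ncard_neighborSet hvx hvy hxy.ne
      have hkv := hk v
      have hkx := hk x
      have hky := hk y
      obtain rfl | rfl | hk7 : k = 5 ∨ k = 6 ∨ 7 ≤ k := by omega
      · exact arcColorable_of_isolated_triangle hv
          (adj_iff_of_ncard_le_two (by omega) hvx.symm hxy hvy.ne)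
          (adj_iff_of_ncard_le_two (by omega) hvy.symm hxy.symm hvx.ne) (step hvx (by simp))
      · obtain hx | ⟨x', hx'v, hx'y, hx⟩ :=
          adj_iff_of_ncard_le_three (by omega) hvx.symm hxy hvy.ne
        · exact arcColorable_of_pendant_triangle hk le_rfl hv hx (step hvx (by simp))
        obtain hy | ⟨y', hy'v, hy'x, hy⟩ :=
          adj_iff_of_ncard_le_three (by omega) hvy.symm hxy.symm hvx.ne
        · exact arcColorable_of_pendant_triangle hk le_rfl (fun u => (hv u).trans or_comm) hy
            (step hvx (by simp))
        exact arcColorable_of_triangle_six hk hx'v.symm hy'v.symm hx'y.symm hy'x.symm hv hx hy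
          (step hvx (by simp))
      · exact arcColorable_of_triangle hk hk7 hxy hv (step hvx rfl)
    · have hvx : G.Adj v x := (hv x).2 (.inl rfl)
      have hvw : G.Adj v w := (hv w).2 (.inr rfl)
      have hwy : G.Adj w y := (hw y).2 (.inr rfl)
      have h₂ := two_le_ncard_neighborSet hvx hvw hxw
      have hkv := hk v
      have hkx := hk x
      have hky := hk y
      obtain rfl | hk6 : k = 5 ∨ 6 ≤ k := by omega
      · exact arcColorable_of_isolated_square hvy hxw hv
          (adj_iff_of_ncard_le_two (by omega) hvx.symm hxy hvy)
          (adj_iff_of_ncard_le_two (by omega) hxy.symm hwy.symm hxw) hw (step hvx (by simp))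
      · exact arcColorable_of_path_two hk hk6 hxy.ne hxw hvy hv hw (step hvx (by simp))
    · have hux : G.Adj u x := (hu x).2 (.inl rfl)
      have h₂ := two_le_ncard_neighborSet hux ((hu v).2 (.inr rfl)) hxv
      have hku := hk u
      obtain rfl | hk6 : k = 5 ∨ 6 ≤ k := by omega
      · exact arcColorable_of_path_three hk hxy hxv hxw huw huy hvy hu hv hw
          (step hux (by simp))
      · exact arcColorable_of_path_two hk hk6 hxw hxv huw hu hv (step hux (by simp))

/-- An arc coloring gives a vi-simultaneous coloring with at most two colors on every set of second
incidences. -/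
theorem ArcColorable.exists_isViColoring (h : ArcColorable G k) :
    ∃ cV cI, G.IsViColoring k cV cI ∧ ∀ u, (G.secondIncColors cI u).ncard ≤ 2 := by
  classical
  obtain ⟨c, S, f, h⟩ := h
  obtain ⟨g, hg⟩ : ∃ g : V → Sym2 V → Fin k, ∀ v u, g v s(v, u) = f v u := by
    refine ⟨fun v e => if hv : v ∈ e then f v (Sym2.Mem.other hv) else c v, fun v u => ?_⟩
    have hv := Sym2.mem_mk_left v u
    exact (dif_pos hv).trans (congrArg (f v) (Sym2.congr_right.1 (Sym2.other_spec hv)))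
  have hg' (v u) : g v s(u, v) = f v u := by rw [Sym2.eq_swap, hg]
  have hinc {v e} (he : G.IsIncidence v e) : ∃ u, G.Adj v u ∧ e = s(v, u) := by
    obtain ⟨u, rfl⟩ := he.2
    exact ⟨u, he.1, rfl⟩
  refine ⟨c, g, ⟨h.color_ne, ?_, ?_⟩, fun u => ?_⟩
  · intro u w e hwe hu
    obtain ⟨x, hwx, rfl⟩ := hinc hwe
    rw [hg]
    rcases Sym2.mem_iff.1 hu with rfl | rfl
    · exact (h.arc_ne_color hwx).symm
    · exact fun e => h.color_notMem u (e ▸ h.arc_mem hwx)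
  · intro v e w e' hve hwe hne hvw
    obtain ⟨x, hvx, rfl⟩ := hinc hve
    obtain ⟨y, hwy, rfl⟩ := hinc hwe
    rw [hg, hg]
    have key {a b d} (hab : G.Adj a b) (hbd : G.Adj b d) : f a b ≠ f b d := fun e =>
      h.arc_notMem hbd (e ▸ h.arc_mem hab)
    by_cases hvw' : v = w
    · subst hvw'
      exact h.arc_ne_arc hvx hwy fun e => hne (by rw [e])
    · rcases hvw with hvw | hvw | hvw | hvw
      · exact absurd hvw hvw'
      · rcases Sym2.eq_iff.1 hvw with ⟨h, -⟩ | ⟨rfl, rfl⟩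
        · exact absurd h hvw'
        · exact key hvx hwy
      · obtain rfl := Sym2.congr_right.1 hvw
        exact key hvx hwy
      · rw [Sym2.eq_swap] at hvw
        obtain rfl := Sym2.congr_right.1 hvw
        exact (key hwy hvx).symm
  · refine le_trans ?_ (h.card_le u)
    rw [← Set.ncard_coe_finset]
    refine Set.ncard_le_ncard ?_ (Finset.finite_toSet _)
    rintro a ⟨v, huv, rfl⟩
    rw [hg']
    exact h.arc_mem huv.symm

end Main

end ViOuterplanar

/-- If `G` is a finite outerplanar graph, then `χ_{vi,2}(G) ≤ Δ(G) + 3`. -/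
theorem chiViS_le_of_outerplanar [Fintype V] (G : SimpleGraph V) (hG : G.Outerplanar) :
    G.chiViS 2 ≤ G.maxDeg + 3 := by
  obtain ⟨r, hr⟩ := hG
  let := r
  exact Nat.sInf_le (ViOuterplanar.arcColorable_of_noncrossing hr (Nat.le_add_left 3 _)
    fun v => Nat.add_le_add_right
      (Finset.le_sup (f := fun v => (G.neighborSet v).ncard) (Finset.mem_univ v))
      3).exists_isViColoring
end

section
/- If G is a finite outerplanar graph with Δ(G) ≥ 4 and girth g(G) ≥ 4, then χ_{vi,1}(G) ≤ Δ(G) + 3. -/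
open SimpleGraph

variable {V : Type*}

/-- The data equivalent to a vi-simultaneous `(k, 1)`-coloring: `c u` is the color of the vertex
`u`, and `f u` is the common color of all second incidences of `u`. -/
structure SimpleGraph.IsSecondColoring (G : SimpleGraph V) {k : ℕ} (f c : V → Fin k) : Prop where
  vertex_ne : ∀ ⦃u v⦄, G.Adj u v → c u ≠ c v
  second_ne : ∀ ⦃u v⦄, G.Adj u v → f u ≠ f v
  mixed_ne : ∀ ⦃u v⦄, G.Adj u v → c u ≠ f v
  self_ne : ∀ u, c u ≠ f u
  second_ne_of_common : ∀ ⦃u v w⦄, G.Adj u v → G.Adj v w → u ≠ w → f u ≠ f w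

theorem SimpleGraph.IsSecondColoring.chiViS_one_le {G : SimpleGraph V} {k : ℕ}
    {f c : V → Fin k} (h : G.IsSecondColoring f c) : G.chiViS 1 ≤ k := by
  classical
  let cI : V → Sym2 V → Fin k := fun v e =>
    if hv : v ∈ e then f (Sym2.Mem.other hv) else f v
  have hcI : ∀ v w, cI v s(v, w) = f w := fun v w => by
    have hv : v ∈ s(v, w) := Sym2.mem_mk_left v w
    have ho : Sym2.Mem.other hv = w := Sym2.congr_right.1 (Sym2.other_spec hv)
    simp only [cI, dif_pos hv, ho]
  have hinc : ∀ v e, G.IsIncidence v e → ∃ w, e = s(v, w) ∧ G.Adj v w := by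
    rintro v e ⟨he, w, rfl⟩
    exact ⟨w, rfl, he⟩
  refine Nat.sInf_le ⟨c, cI, ⟨h.vertex_ne, ?_, ?_⟩, fun u => ?_⟩
  · intro u w e hw hu
    obtain ⟨x, rfl, hx⟩ := hinc w e hw
    rw [hcI]
    rcases Sym2.mem_iff.1 hu with rfl | rfl
    · exact h.mixed_ne hx
    · exact h.self_ne _
  · intro v e w e' hv hw hne hcase
    obtain ⟨x, rfl, hx⟩ := hinc v e hv
    obtain ⟨y, rfl, hy⟩ := hinc w e' hw
    rw [hcI, hcI]
    rcases hcase with rfl | he | he | he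
    · exact h.second_ne_of_common hx.symm hy fun hxy => hne (by rw [hxy])
    · rcases Sym2.eq_iff.1 he with ⟨rfl, rfl⟩ | ⟨rfl, rfl⟩
      · exact absurd rfl hne
      · exact h.second_ne hy
    · obtain rfl := Sym2.congr_right.1 he
      exact h.second_ne hy
    · rw [Sym2.eq_swap] at he
      obtain rfl := Sym2.congr_right.1 he
      exact h.second_ne hx.symm
  · refine (Set.ncard_le_ncard (t := {f u}) ?_).trans (Set.ncard_singleton _).le
    rintro _ ⟨v, -, rfl⟩
    rw [Sym2.eq_swap, hcI]
    rfl

theorem Fin.exists_notMem_of_ncard_add_card_lt {k : ℕ} (f : V → Fin k) {S : Set V}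
    (hS : S.Finite) (L : Finset (Fin k)) (h : S.ncard + L.card < k) :
    ∃ a, a ∉ L ∧ ∀ s ∈ S, a ≠ f s := by
  classical
  by_contra! hcon
  have huniv : (Set.univ : Set (Fin k)) ⊆ f '' S ∪ L := fun a _ => by
    by_cases ha : a ∈ L
    · exact Or.inr ha
    · obtain ⟨s, hs, rfl⟩ := hcon a ha
      exact Or.inl ⟨s, hs, rfl⟩
  have h1 := Set.ncard_le_ncard huniv
  have h2 := Set.ncard_union_le (f '' S) (L : Set (Fin k))
  have h3 := Set.ncard_image_le (f := f) hS
  rw [Set.ncard_univ, Nat.card_fin] at h1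
  rw [Set.ncard_coe_finset] at h2
  omega

/-- The graph obtained from `G` by deleting all edges at `u` and at `v`. -/
def SimpleGraph.isolatePair (G : SimpleGraph V) (u v : V) : SimpleGraph V where
  Adj a b := G.Adj a b ∧ a ≠ u ∧ a ≠ v ∧ b ≠ u ∧ b ≠ v
  symm := ⟨fun _ _ h => ⟨h.1.symm, h.2.2.2.1, h.2.2.2.2, h.2.1, h.2.2.1⟩⟩
  loopless := ⟨fun _ h => h.1.ne rfl⟩

theorem SimpleGraph.isolatePair_lt {G : SimpleGraph V} {u x : V} (v : V) (h : G.Adj u x) :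
    G.isolatePair u v < G :=
  lt_of_le_not_ge (fun _ _ h => h.1) fun hle => (hle h).2.1 rfl

theorem SimpleGraph.IsSecondColoring.extend_leaf [Finite V] {G : SimpleGraph V} {k D : ℕ}
    (hk : D + 3 ≤ k) (hD : ∀ v, (G.neighborSet v).ncard ≤ D) {u x : V}
    (hu : ∀ w, G.Adj u w ↔ w = x) {f c : V → Fin k}
    (h : (G.isolatePair u u).IsSecondColoring f c) :
    ∃ f' c' : V → Fin k, G.IsSecondColoring f' c' := by
  classical
  have hux : G.Adj u x := (hu x).2 rfl
  have hD1 : 1 ≤ D := le_trans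
    ((Set.ncard_pos (Set.toFinite _)).2 ⟨x, hux⟩) (hD u)
  have hcard : (G.neighborSet x \ {u}).ncard ≤ D - 1 := by
    rw [Set.ncard_sdiff_singleton_of_mem (show u ∈ G.neighborSet x from hux.symm)]
    exact Nat.sub_le_sub_right (hD x) 1
  obtain ⟨α, hαL, hα⟩ := Fin.exists_notMem_of_ncard_add_card_lt f (Set.toFinite
    (G.neighborSet x \ {u})) {f x, c x} (by
      have := Finset.card_le_two (a := f x) (b := c x); omega)
  obtain ⟨γ, hγL, -⟩ := Fin.exists_notMem_of_ncard_add_card_lt f (Set.finite_empty)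
    {f x, c x, α} (by
      have := Finset.card_le_three (a := f x) (b := c x) (c := α)
      rw [Set.ncard_empty]; omega)
  simp only [Finset.mem_insert, Finset.mem_singleton, not_or] at hαL hγL
  have hα' : ∀ w, G.Adj x w → w ≠ u → α ≠ f w := fun w h1 h2 => hα w ⟨h1, h2⟩
  obtain ⟨h1, h2, h3, h4, h5⟩ := h
  simp only [isolatePair] at h1 h2 h3 h5
  have hne := hux.ne
  clear hD hcard hα
  refine ⟨fun w => if w = u then α else f w, fun w => if w = u then γ else c w,
    ⟨?_, ?_, ?_, ?_, ?_⟩⟩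
  · intro p q hpq
    have := hpq.symm
    have := hpq.ne
    grind
  · intro p q hpq
    have := hpq.symm
    have := hpq.ne
    grind
  · intro p q hpq
    have := hpq.symm
    have := hpq.ne
    grind
  · grind
  · intro p q r hpq hqr hpr
    have := hpq.symm
    have := hqr.symm
    have := hpq.ne
    have := hqr.ne
    have hpr' := @h5 p q r
    rcases eq_or_ne q u with rfl | hqu
    · exact absurd (((hu p).1 hpq.symm).trans ((hu r).1 hqr).symm) hpr
    clear h1 h2 h3 h4 h5 hαL hγL
    grind

theorem SimpleGraph.IsSecondColoring.extend_pair {G : SimpleGraph V} {k : ℕ} (hk : 6 ≤ k)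
    {x u v y : V}
    (hu : ∀ w, G.Adj u w ↔ w = x ∨ w = v) (hv : ∀ w, G.Adj v w ↔ w = u ∨ w = y)
    {f c : V → Fin k} (h : (G.isolatePair u v).IsSecondColoring f c) {α β : Fin k}
    (hα : ∀ w, G.Adj x w → w ≠ u → α ≠ f w) (hαx : α ≠ f x) (hαc : α ≠ c x) (hαy : α ≠ f y)
    (hβ : ∀ w, G.Adj y w → w ≠ v → β ≠ f w) (hβy : β ≠ f y) (hβc : β ≠ c y) (hβx : β ≠ f x)
    (hαβ : α ≠ β) :
    ∃ f' c' : V → Fin k, G.IsSecondColoring f' c' := by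
  classical
  obtain ⟨γ, hγL, -⟩ := Fin.exists_notMem_of_ncard_add_card_lt f (Set.finite_empty)
    {f x, c x, α, β} (by
      have := Finset.card_le_four (a := f x) (b := c x) (c := α) (d := β)
      rw [Set.ncard_empty]; omega)
  obtain ⟨δ, hδL, -⟩ := Fin.exists_notMem_of_ncard_add_card_lt f (Set.finite_empty)
    {f y, c y, α, β, γ} (by
      have := Finset.card_le_five (a := f y) (b := c y) (c := α) (d := β) (e := γ)
      rw [Set.ncard_empty]; omega)
  simp only [Finset.mem_insert, Finset.mem_singleton, not_or] at hγL hδL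
  obtain ⟨h1, h2, h3, h4, h5⟩ := h
  simp only [isolatePair] at h1 h2 h3 h5
  have hux := ((hu x).2 (Or.inl rfl)).ne
  have hvy := ((hv y).2 (Or.inr rfl)).ne
  refine ⟨fun w => if w = u then α else if w = v then β else f w,
    fun w => if w = u then γ else if w = v then δ else c w, ⟨?_, ?_, ?_, ?_, ?_⟩⟩
  · intro p q hpq
    have := hpq.symm
    have := hpq.ne
    grind
  · intro p q hpq
    have := hpq.symm
    have := hpq.ne
    grind
  · intro p q hpq
    have := hpq.symm
    have := hpq.ne
    grind
  · grind
  · intro p q r hpq hqr hpr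
    have := hpq.symm
    have := hqr.symm
    have := hpq.ne
    have := hqr.ne
    have hpr' := @h5 p q r
    clear h1 h2 h3 h4 h5 hγL hδL
    by_cases hqu : q = u <;> by_cases hqv : q = v <;> grind

theorem SimpleGraph.exists_reducible_of_noncrossing [LinearOrder V] [Finite V]
    {G : SimpleGraph V}
    (hG : ∀ a b c d : V, G.Adj a b → G.Adj c d → ¬(a < c ∧ c < b ∧ b < d))
    (htri : ∀ a b c, G.Adj a b → G.Adj b c → ¬G.Adj a c) (hne : ∃ a b, G.Adj a b) :
    (∃ u x, ∀ w, G.Adj u w ↔ w = x) ∨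
    ∃ x u v y, x ≠ v ∧ y ≠ u ∧ (∀ w, G.Adj u w ↔ w = x ∨ w = v) ∧
      (∀ w, G.Adj v w ↔ w = u ∨ w = y) ∧
      (G.Adj x y ∨ ∃ z, ∀ w, G.Adj y w ↔ w = v ∨ w = z) := by
  classical
  by_cases hleaf : ∃ u x, ∀ w, G.Adj u w ↔ w = x
  · exact Or.inl hleaf
  right
  have htwo : ∀ u x, G.Adj u x → ∃ w, G.Adj u w ∧ w ≠ x := fun u x hux => by
    by_contra! hcon
    exact hleaf ⟨u, x, fun w => ⟨hcon w, fun h => h ▸ hux⟩⟩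
  let long : Set (V × V) :=
    {e | G.Adj e.1 e.2 ∧ ∃ w z, G.Adj w z ∧ e.1 < w ∧ w < e.2}
  have hlong : long.Nonempty := by
    obtain ⟨m, ⟨p, hmp⟩, hmin⟩ := Set.exists_min_image {m | ∃ p, G.Adj m p} id
      (Set.toFinite _) hne
    obtain ⟨q, hmq, hqp⟩ := htwo m p hmp
    have hp : m < p := lt_of_le_of_ne (hmin p ⟨m, hmp.symm⟩) hmp.ne
    have hq : m < q := lt_of_le_of_ne (hmin q ⟨m, hmq.symm⟩) hmq.ne
    rcases lt_or_gt_of_ne hqp with hlt | hlt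
    · exact ⟨(m, p), hmp, q, m, hmq.symm, hq, hlt⟩
    · exact ⟨(m, q), hmq, p, m, hmp.symm, hp, hlt⟩
  obtain ⟨⟨a, b⟩, ⟨hab, w₀, z₀, hwz, haw, hwb⟩, hmin⟩ := Set.exists_min_image long
    (fun e => (Set.Ioo e.1 e.2).ncard) (Set.toFinite _) hlong
  dsimp only at hab haw hwb hmin
  have hshort : ∀ p q r s, G.Adj p q → G.Adj r s → a ≤ p → q ≤ b → p < r → r < q →
      p = a ∧ q = b := by
    intro p q r s hpq hrs hap hqb hpr hrq
    have hle := hmin (p, q) ⟨hpq, r, s, hrs, hpr, hrq⟩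
    by_contra hcon
    refine absurd (Set.ncard_lt_ncard (s := Set.Ioo p q) (t := Set.Ioo a b)
      ⟨Set.Ioo_subset_Ioo hap hqb, fun hsub => ?_⟩) (not_lt.2 hle)
    rcases hap.lt_or_eq with hlt | rfl
    · exact lt_irrefl _ (hsub ⟨hlt, hpr.trans (hrq.trans_le hqb)⟩).1
    · rcases hqb.lt_or_eq with hlt | rfl
      · exact lt_irrefl _ (hsub ⟨hpr.trans hrq, hlt⟩).2
      · exact hcon ⟨rfl, rfl⟩
  have hinner : ∀ w z, G.Adj w z → a < w → w < b →
      ∃ p q, a ≤ p ∧ p < w ∧ w < q ∧ q ≤ b ∧ ∀ t, G.Adj w t ↔ t = p ∨ t = q := by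
    intro w z hwz haw hwb
    have hrange : ∀ t, G.Adj w t → a ≤ t ∧ t ≤ b := fun t ht =>
      ⟨not_lt.1 fun hlt => hG t w a b ht.symm hab ⟨hlt, haw, hwb⟩,
        not_lt.1 fun hlt => hG a b w t hab ht ⟨haw, hwb, hlt⟩⟩
    have hup : ∀ s t, G.Adj w s → G.Adj w t → w < s → ¬s < t := fun s t hs ht h1 h2 =>
      haw.ne' (hshort w t s w ht hs.symm haw.le (hrange t ht).2 h1 h2).1
    have hdown : ∀ s t, G.Adj w s → G.Adj w t → s < w → ¬t < s := fun s t hs ht h1 h2 =>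
      hwb.ne (hshort t w s w ht.symm hs.symm (hrange t ht).1 hwb.le h2 h1).2
    obtain ⟨z', hwz', hzz⟩ := htwo w z hwz
    have key : ∀ p q, G.Adj w p → G.Adj w q → p < w → w < q →
        ∃ p q, a ≤ p ∧ p < w ∧ w < q ∧ q ≤ b ∧ ∀ t, G.Adj w t ↔ t = p ∨ t = q := by
      refine fun p q hp hq hpw hwq => ⟨p, q, (hrange p hp).1, hpw, hwq, (hrange q hq).2,
        fun t => ⟨fun ht => ?_, ?_⟩⟩
      · rcases lt_or_gt_of_ne ht.ne with hlt | hlt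
        · exact Or.inr (le_antisymm (not_lt.1 (hup q t hq ht hwq)) (not_lt.1 (hup t q ht hq hlt)))
        · exact Or.inl (le_antisymm (not_lt.1 (hdown t p ht hp hlt))
            (not_lt.1 (hdown p t hp ht hpw)))
      · rintro (rfl | rfl) <;> assumption
    rcases lt_or_gt_of_ne hwz.ne with h1 | h1 <;> rcases lt_or_gt_of_ne hwz'.ne with h2 | h2
    · exact absurd (le_antisymm (not_lt.1 (hup z z' hwz hwz' h1))
        (not_lt.1 (hup z' z hwz' hwz h2))) hzz
    · exact key z' z hwz' hwz h2 h1
    · exact key z z' hwz hwz' h1 h2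
    · exact absurd (le_antisymm (not_lt.1 (hdown z' z hwz' hwz h2))
        (not_lt.1 (hdown z z' hwz hwz' h1))) hzz
  have hpair : ∃ u v, G.Adj u v ∧ a < u ∧ u < v ∧ v < b := by
    obtain ⟨p, q, hap, hpw, hwq, hqb, hN⟩ := hinner w₀ z₀ hwz haw hwb
    have hp := (hN p).2 (Or.inl rfl)
    have hq := (hN q).2 (Or.inr rfl)
    rcases hap.lt_or_eq with hlt | rfl
    · exact ⟨p, w₀, hp.symm, hlt, hpw, hwb⟩
    · rcases hqb.lt_or_eq with hlt | rfl
      · exact ⟨w₀, q, hq, haw, hwq, hlt⟩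
      · exact absurd hab (htri _ _ _ hp.symm hq)
  obtain ⟨u, v, huv, hau, hlt, hvb⟩ := hpair
  obtain ⟨x, v', hax, hxu, huv', hvb', hNu⟩ := hinner u v huv hau (hlt.trans hvb)
  obtain ⟨u', y, hau', huv'', hvy, hyb, hNv⟩ := hinner v u huv.symm (hau.trans hlt) hvb
  obtain rfl : v = v' := ((hNu v).1 huv).resolve_left (hxu.trans hlt).ne'
  obtain rfl : u = u' := ((hNv u).1 huv.symm).resolve_right (hlt.trans hvy).ne
  rcases hax.lt_or_eq with hax | rfl
  · obtain ⟨p, q, -, -, hxq, -, hNx⟩ := hinner x u ((hNu x).2 (Or.inl rfl)).symm hax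
      (hxu.trans (hlt.trans hvb))
    have hux := (hNx u).1 ((hNu x).2 (Or.inl rfl)).symm
    refine ⟨y, v, u, x, (hlt.trans hvy).ne', (hxu.trans hlt).ne,
      fun w => (hNv w).trans or_comm, fun w => (hNu w).trans or_comm, Or.inr ?_⟩
    rcases hux with rfl | rfl
    · exact ⟨q, hNx⟩
    · exact ⟨p, fun w => (hNx w).trans or_comm⟩
  refine ⟨a, u, v, y, (hxu.trans hlt).ne, (hlt.trans hvy).ne', hNu, hNv, ?_⟩
  rcases hyb.lt_or_eq with hyb | rfl
  · obtain ⟨p, q, -, -, -, -, hNy⟩ := hinner y v ((hNv y).2 (Or.inr rfl)).symm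
      (hau.trans (hlt.trans hvy)) hyb
    right
    rcases (hNy v).1 ((hNv y).2 (Or.inr rfl)).symm with rfl | rfl
    · exact ⟨q, hNy⟩
    · exact ⟨p, fun w => (hNy w).trans or_comm⟩
  · exact Or.inl hab

theorem SimpleGraph.exists_isSecondColoring_of_noncrossing [LinearOrder V] [Finite V]
    {k D : ℕ} (hD3 : 3 ≤ D) (hk : D + 3 ≤ k) (G : SimpleGraph V)
    (hG : ∀ a b c d : V, G.Adj a b → G.Adj c d → ¬(a < c ∧ c < b ∧ b < d))
    (htri : ∀ a b c, G.Adj a b → G.Adj b c → ¬G.Adj a c)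
    (hD : ∀ v, (G.neighborSet v).ncard ≤ D) :
    ∃ f c : V → Fin k, G.IsSecondColoring f c := by
  classical
  induction G using WellFoundedLT.induction with
  | ind G ih =>
  have hcol : ∀ H < G, ∃ f c : V → Fin k, H.IsSecondColoring f c := fun H hH =>
    ih H hH (fun a b c d h1 h2 => hG a b c d (hH.le h1) (hH.le h2))
      (fun a b c h1 h2 h3 => htri a b c (hH.le h1) (hH.le h2) (hH.le h3))
      (fun v => (Set.ncard_le_ncard (fun _ h => hH.le h) (Set.toFinite _)).trans (hD v))
  by_cases hne : ∃ a b, G.Adj a b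
  swap
  · push Not at hne
    exact ⟨fun _ => ⟨0, by omega⟩, fun _ => ⟨1, by omega⟩, fun u v h => absurd h (hne u v),
      fun u v h => absurd h (hne u v), fun u v h => absurd h (hne u v), fun _ => by simp,
      fun u v _ h => absurd h (hne u v)⟩
  have hcard : ∀ s t, G.Adj s t → (G.neighborSet s \ {t}).ncard ≤ D - 1 := fun s t hst => by
    rw [Set.ncard_sdiff_singleton_of_mem (show t ∈ G.neighborSet s from hst)]
    exact Nat.sub_le_sub_right (hD s) 1
  rcases exists_reducible_of_noncrossing hG htri hne with
    ⟨u, x, hu⟩ | ⟨x, u, v, y, hxv, hyu, hu, hv, hcase⟩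
  · obtain ⟨f, c, h⟩ := hcol _ (isolatePair_lt u ((hu x).2 rfl))
    exact h.extend_leaf hk hD hu
  obtain ⟨f, c, h⟩ := hcol _ (isolatePair_lt v ((hu x).2 (Or.inl rfl)))
  have hxu := hcard x u ((hu x).2 (Or.inl rfl)).symm
  have hyv := hcard y v ((hv y).2 (Or.inr rfl)).symm
  rcases hcase with hxy | ⟨z, hz⟩
  · obtain ⟨α, hαL, hα⟩ := Fin.exists_notMem_of_ncard_add_card_lt f (Set.toFinite
      (G.neighborSet x \ {u})) {f x, c x} (by
        have := Finset.card_le_two (a := f x) (b := c x); omega)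
    obtain ⟨β, hβL, hβ⟩ := Fin.exists_notMem_of_ncard_add_card_lt f (Set.toFinite
      (G.neighborSet y \ {v})) {f y, c y, α} (by
        have := Finset.card_le_three (a := f y) (b := c y) (c := α); omega)
    simp only [Finset.mem_insert, Finset.mem_singleton, not_or] at hαL hβL
    exact h.extend_pair (by omega) hu hv (fun w h1 h2 => hα w ⟨h1, h2⟩)
      hαL.1 hαL.2 (hα y ⟨hxy, hyu⟩) (fun w h1 h2 => hβ w ⟨h1, h2⟩) hβL.1 hβL.2.1
      (hβ x ⟨hxy.symm, hxv⟩) (Ne.symm hβL.2.2)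
  · obtain ⟨α, hαL, hα⟩ := Fin.exists_notMem_of_ncard_add_card_lt f (Set.toFinite
      (G.neighborSet x \ {u})) {f x, c x, f y} (by
        have := Finset.card_le_three (a := f x) (b := c x) (c := f y); omega)
    obtain ⟨β, hβL, -⟩ := Fin.exists_notMem_of_ncard_add_card_lt f Set.finite_empty
      {f y, c y, α, f x, f z} (by
        have := Finset.card_le_five (a := f y) (b := c y) (c := α) (d := f x) (e := f z)
        rw [Set.ncard_empty]; omega)
    simp only [Finset.mem_insert, Finset.mem_singleton, not_or] at hαL hβL
    exact h.extend_pair (by omega) hu hv (fun w h1 h2 => hα w ⟨h1, h2⟩)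
      hαL.1 hαL.2.1 hαL.2.2
      (fun w h1 h2 => ((hz w).1 h1).resolve_left h2 ▸ hβL.2.2.2.2) hβL.1 hβL.2.1
      hβL.2.2.2.1 (Ne.symm hβL.2.2.1)

theorem SimpleGraph.not_adj_of_four_le_egirth {G : SimpleGraph V} (hg : 4 ≤ G.egirth)
    (a b c : V) (hab : G.Adj a b) (hbc : G.Adj b c) : ¬G.Adj a c := by
  intro hac
  let w : G.Walk a a := .cons hab (.cons hbc (.cons hac.symm .nil))
  have hw : w.IsCycle := by
    simp [w, Walk.isCycle_def, Walk.isTrail_def, hab.ne, hbc.ne, hac.ne, hab.ne', hac.ne']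
  have h := (le_egirth.1 hg) a w hw
  have h3 : w.length = 3 := rfl
  rw [h3] at h
  exact absurd h (by decide)

/-- If `G` is a finite outerplanar graph with `Δ(G) ≥ 4` and girth `g(G) ≥ 4`,
then `χ_{vi,1}(G) ≤ Δ(G) + 3`. -/
theorem chiViS_one_le_of_outerplanar [Fintype V] (G : SimpleGraph V) (hG : G.Outerplanar)
    (hΔ : 4 ≤ G.maxDeg) (hg : 4 ≤ G.egirth) :
    G.chiViS 1 ≤ G.maxDeg + 3 := by
  classical
  obtain ⟨r, hr⟩ := hG
  let _ : LinearOrder V := r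
  have hD : ∀ v, (G.neighborSet v).ncard ≤ G.maxDeg := fun v =>
    Finset.le_sup (f := fun v => (G.neighborSet v).ncard) (Finset.mem_univ v)
  obtain ⟨f, c, h⟩ := exists_isSecondColoring_of_noncrossing (by omega) le_rfl G hr
    (not_adj_of_four_le_egirth hg) hD
  exact h.chiViS_one_le
end

section
/- If G is a finite outerplanar graph with Δ(G) ≥ 4 and girth g(G) ≥ 6, then χ_{vi,1}(G) = Δ(G) + 2. -/
open SimpleGraph

variable {V : Type*}

namespace SimpleGraph

variable {G : SimpleGraph V} {k : ℕ}

/-- The vertex coloring `a` and the coloring `b` by common colors of second incidences are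
compatible on the subgraph of `G` induced by `S`: there `a` is proper, `b` is proper on the
square, and `a u` does not occur as a `b`-color in the closed neighborhood of `u`. -/
structure IsSquarePairOn (G : SimpleGraph V) (S : Finset V) (a b : V → Fin k) : Prop where
  vertex_ne : ∀ u ∈ S, ∀ v ∈ S, G.Adj u v → a u ≠ a v
  ne_self : ∀ u ∈ S, a u ≠ b u
  ne_adj : ∀ u ∈ S, ∀ v ∈ S, G.Adj u v → a u ≠ b v
  inc_ne : ∀ u ∈ S, ∀ v ∈ S, G.Adj u v → b u ≠ b v
  inc_ne_two : ∀ u ∈ S, ∀ v ∈ S, ∀ w ∈ S, G.Adj v u → G.Adj v w → u ≠ w → b u ≠ b w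

/-- A compatible pair extends to one more vertex. -/
theorem IsSquarePairOn.insert [DecidableEq V] {S : Finset V} {a b : V → Fin k}
    (h : G.IsSquarePairOn S a b) {v : V} (hv : v ∉ S) {α β : Fin k} (hαβ : α ≠ β)
    (hadj : ∀ x ∈ S, G.Adj v x → α ≠ a x ∧ α ≠ b x ∧ β ≠ b x ∧ β ≠ a x)
    (htwo : ∀ x ∈ S, G.Adj v x → ∀ y ∈ S, G.Adj x y → β ≠ b y)
    (hnbr : ∀ x ∈ S, ∀ y ∈ S, G.Adj v x → G.Adj v y → x ≠ y → b x ≠ b y) :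
    G.IsSquarePairOn (insert v S) (Function.update a v α) (Function.update b v β) := by
  have ha : ∀ x ∈ S, Function.update a v α x = a x := fun x hx =>
    Function.update_of_ne (fun e : x = v => hv (e ▸ hx)) _ _
  have hb : ∀ x ∈ S, Function.update b v β x = b x := fun x hx =>
    Function.update_of_ne (fun e : x = v => hv (e ▸ hx)) _ _
  constructor
  · simp only [Finset.mem_insert]
    rintro x (rfl | hx) y (rfl | hy) hxy
    · exact (hxy.ne rfl).elim
    · rw [ha y hy, Function.update_self]; exact (hadj y hy hxy).1
    · rw [ha x hx, Function.update_self]; exact (hadj x hx hxy.symm).1.symm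
    · rw [ha x hx, ha y hy]; exact h.vertex_ne x hx y hy hxy
  · simp only [Finset.mem_insert]
    rintro x (rfl | hx)
    · simpa using hαβ
    · rw [ha x hx, hb x hx]; exact h.ne_self x hx
  · simp only [Finset.mem_insert]
    rintro x (rfl | hx) y (rfl | hy) hxy
    · exact (hxy.ne rfl).elim
    · rw [hb y hy, Function.update_self]; exact (hadj y hy hxy).2.1
    · rw [ha x hx, Function.update_self]; exact (hadj x hx hxy.symm).2.2.2.symm
    · rw [ha x hx, hb y hy]; exact h.ne_adj x hx y hy hxy
  · simp only [Finset.mem_insert]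
    rintro x (rfl | hx) y (rfl | hy) hxy
    · exact (hxy.ne rfl).elim
    · rw [hb y hy, Function.update_self]; exact (hadj y hy hxy).2.2.1
    · rw [hb x hx, Function.update_self]; exact (hadj x hx hxy.symm).2.2.1.symm
    · rw [hb x hx, hb y hy]; exact h.inc_ne x hx y hy hxy
  · simp only [Finset.mem_insert]
    rintro x (rfl | hx) z (rfl | hz) y (rfl | hy) hzx hzy hxy
    · exact (hxy rfl).elim
    · exact (hzx.ne rfl).elim
    · exact (hxy rfl).elim
    · rw [hb y hy, Function.update_self]; exact htwo z hz hzx.symm y hy hzy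
    · exact (hzy.ne rfl).elim
    · rw [hb x hx, hb y hy]; exact hnbr x hx y hy hzx hzy hxy
    · rw [hb x hx, Function.update_self]; exact (htwo z hz hzy.symm x hx hzx).symm
    · rw [hb x hx, hb y hy]; exact h.inc_ne_two x hx z hz y hy hzx hzy hxy

theorem exists_ne_five (hk : 6 ≤ k) (x₁ x₂ x₃ x₄ x₅ : Fin k) :
    ∃ c, c ≠ x₁ ∧ c ≠ x₂ ∧ c ≠ x₃ ∧ c ≠ x₄ ∧ c ≠ x₅ := by
  have hcard : ({x₁, x₂, x₃, x₄, x₅} : Finset (Fin k)).card <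
      (Finset.univ : Finset (Fin k)).card := by
    rw [Finset.card_univ, Fintype.card_fin]
    exact Finset.card_le_five.trans_lt hk
  obtain ⟨c, -, hc⟩ := Finset.exists_mem_notMem_of_card_lt_card hcard
  exact ⟨c, by simpa using hc⟩

theorem ncard_neighborSet_le_maxDeg [Fintype V] (G : SimpleGraph V) (u : V) :
    (G.neighborSet u).ncard ≤ G.maxDeg :=
  Finset.le_sup (f := fun v => (G.neighborSet v).ncard) (Finset.mem_univ u)

theorem exists_inc_color [Fintype V] [DecidableEq V] {S : Finset V} (hk : G.maxDeg + 2 ≤ k)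
    (a b : V → Fin k) {u v : V} (huv : G.Adj u v) (hv : v ∉ S) :
    ∃ c, c ≠ a u ∧ c ≠ b u ∧ ∀ x ∈ S, G.Adj u x → c ≠ b x := by
  classical
  set N : Finset V := S.filter (G.Adj u) with hN
  have hNcard : N.card + 1 ≤ G.maxDeg := by
    have hvN : v ∉ N := fun h => hv (Finset.mem_filter.1 h).1
    rw [← Finset.card_insert_of_notMem hvN, ← Set.ncard_coe_finset]
    refine (Set.ncard_le_ncard ?_ (Set.toFinite _)).trans (G.ncard_neighborSet_le_maxDeg u)
    intro x hx
    rcases Finset.mem_insert.1 (Finset.mem_coe.1 hx) with rfl | hx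
    · exact huv
    · exact (Finset.mem_filter.1 hx).2
  have hcard : (insert (a u) (insert (b u) (N.image b))).card <
      (Finset.univ : Finset (Fin k)).card := by
    rw [Finset.card_univ, Fintype.card_fin]
    have h₁ := Finset.card_insert_le (a u) (insert (b u) (N.image b))
    have h₂ := Finset.card_insert_le (b u) (N.image b)
    have h₃ : (N.image b).card ≤ N.card := Finset.card_image_le
    omega
  obtain ⟨c, -, hc⟩ := Finset.exists_mem_notMem_of_card_lt_card hcard
  simp only [Finset.mem_insert, Finset.mem_image, not_or, not_exists, not_and] at hc
  exact ⟨c, hc.1, hc.2.1, fun x hx hux h => hc.2.2 x (Finset.mem_filter.2 ⟨hx, hux⟩) h.symm⟩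

theorem exists_isSquarePairOn_insert_leaf [Fintype V] [DecidableEq V] {S : Finset V}
    (hk : G.maxDeg + 2 ≤ k) (hk' : 6 ≤ k) {v u : V} (hv : v ∉ S)
    (hu : ∀ x ∈ S, G.Adj v x → x = u) (h : ∃ a b : V → Fin k, G.IsSquarePairOn S a b) :
    ∃ a b : V → Fin k, G.IsSquarePairOn (insert v S) a b := by
  obtain ⟨a, b, h⟩ := h
  obtain ⟨β, hβ⟩ : ∃ β, G.Adj u v → β ≠ a u ∧ β ≠ b u ∧ ∀ x ∈ S, G.Adj u x → β ≠ b x := by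
    by_cases huv : G.Adj u v
    · obtain ⟨c, hc⟩ := exists_inc_color hk a b huv hv
      exact ⟨c, fun _ => hc⟩
    · exact ⟨a u, fun h => (huv h).elim⟩
  obtain ⟨α, h₁, h₂, h₃, -⟩ := exists_ne_five hk' β (a u) (b u) (b u) (b u)
  refine ⟨_, _, h.insert hv h₁ ?_ ?_ ?_⟩
  · intro x hx hvx
    obtain rfl := hu x hx hvx
    obtain ⟨h₄, h₅, -⟩ := hβ hvx.symm
    exact ⟨h₂, h₃, h₅, h₄⟩
  · intro x hx hvx y hy hxy
    obtain rfl := hu x hx hvx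
    exact (hβ hvx.symm).2.2 y hy hxy
  · intro x hx y hy hvx hvy hxy
    exact (hxy ((hu x hx hvx).trans (hu y hy hvy).symm)).elim

/-- A compatible pair extends to the two inner vertices of a path `u, v₁, v₂, v₃, v₄, w`
whose vertices `v₁, …, v₄` have degree two. -/
theorem exists_isSquarePairOn_insert_path [DecidableEq V] {S : Finset V} (hk : 6 ≤ k)
    {u v₁ v₂ v₃ v₄ w : V} (hv₂ : v₂ ∉ S) (hv₃ : v₃ ∉ S) (h₁ : v₁ ∈ S) (h₄ : v₄ ∈ S)
    (h₁₄ : v₁ ≠ v₄) (h₂₃ : v₂ ≠ v₃)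
    (hn₁ : ∀ x ∈ S, G.Adj v₁ x → x = u)
    (hn₂ : ∀ x ∈ S, G.Adj v₂ x → x = v₁)
    (hn₃ : ∀ x ∈ S, G.Adj v₃ x → x = v₄)
    (hn₄ : ∀ x ∈ S, G.Adj v₄ x → x = w)
    (h : ∃ a b : V → Fin k, G.IsSquarePairOn S a b) :
    ∃ a b : V → Fin k, G.IsSquarePairOn (insert v₃ (insert v₂ S)) a b := by
  obtain ⟨a, b, h⟩ := h
  obtain ⟨β₂, p₁, p₂, p₃, p₄, -⟩ := exists_ne_five hk (b u) (b v₁) (a v₁) (b v₄) (b v₄)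
  obtain ⟨β₃, q₁, q₂, q₃, q₄, q₅⟩ := exists_ne_five hk (b v₁) β₂ (b v₄) (b w) (a v₄)
  obtain ⟨α₂, r₁, r₂, r₃, r₄, -⟩ := exists_ne_five hk (a v₁) (b v₁) β₂ β₃ β₃
  obtain ⟨α₃, s₁, s₂, s₃, s₄, s₅⟩ := exists_ne_five hk β₂ β₃ (b v₄) α₂ (a v₄)
  have h' := h.insert hv₂ r₃
    (by intro x hx hadj; obtain rfl := hn₂ x hx hadj; exact ⟨r₁, r₂, p₂, p₃⟩)
    (by
      intro x hx hadj y hy hxy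
      obtain rfl := hn₂ x hx hadj
      obtain rfl := hn₁ y hy hxy
      exact p₁)
    (by
      intro x hx y hy hx' hy' hxy
      exact (hxy ((hn₂ x hx hx').trans (hn₂ y hy hy').symm)).elim)
  have e₁ : v₁ ≠ v₂ := fun e => hv₂ (e ▸ h₁)
  have e₄ : v₄ ≠ v₂ := fun e => hv₂ (e ▸ h₄)
  have hne : ∀ x ∈ S, x ≠ v₂ := fun x hx e => hv₂ (e ▸ hx)
  refine ⟨_, _, h'.insert (by simp [hv₃, h₂₃.symm]) s₂ ?_ ?_ ?_⟩
  · intro x hx hadj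
    rcases Finset.mem_insert.1 hx with rfl | hx
    · simp only [Function.update_self]
      exact ⟨s₄, s₁, q₂, r₄.symm⟩
    · obtain rfl := hn₃ x hx hadj
      simp only [Function.update_of_ne e₄]
      exact ⟨s₅, s₃, q₃, q₅⟩
  · intro x hx hadj y hy hxy
    rcases Finset.mem_insert.1 hx with rfl | hxS
    · rcases Finset.mem_insert.1 hy with rfl | hyS
      · exact (hxy.ne rfl).elim
      · obtain rfl := hn₂ y hyS hxy
        rwa [Function.update_of_ne e₁]
    · obtain rfl := hn₃ x hxS hadj
      rcases Finset.mem_insert.1 hy with rfl | hyS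
      · exact (h₁₄ (hn₂ x hxS hxy.symm).symm).elim
      · obtain rfl := hn₄ y hyS hxy
        rwa [Function.update_of_ne (hne _ hyS)]
  · intro x hx y hy hx' hy' hxy
    rcases Finset.mem_insert.1 hx with rfl | hxS
    · rcases Finset.mem_insert.1 hy with rfl | hyS
      · exact (hxy rfl).elim
      · obtain rfl := hn₃ y hyS hy'
        rwa [Function.update_self, Function.update_of_ne e₄]
    · obtain rfl := hn₃ x hxS hx'
      rcases Finset.mem_insert.1 hy with rfl | hyS
      · rw [Function.update_self, Function.update_of_ne e₄]
        exact p₄.symm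
      · exact (hxy (hn₃ y hyS hy').symm).elim

section Girth

variable {x₁ x₂ x₃ x₄ x₅ : V}

theorem not_triangle_of_egirth (hg : 6 ≤ G.egirth) (h₁ : G.Adj x₁ x₂) (h₂ : G.Adj x₂ x₃) :
    ¬ G.Adj x₃ x₁ := by
  intro h₃
  have hc : (Walk.cons h₁ (Walk.cons h₂ (Walk.cons h₃ Walk.nil))).IsCycle := by
    have := h₁.ne; have := h₂.ne; have := h₃.ne
    simp [Walk.cons_isCycle_iff, Walk.cons_isPath_iff]
    grind
  have := le_egirth.1 hg _ _ hc
  simp only [Walk.length_cons, Walk.length_nil] at this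
  exact absurd this (by norm_num)

theorem not_quadrilateral_of_egirth (hg : 6 ≤ G.egirth) (h₁ : G.Adj x₁ x₂) (h₂ : G.Adj x₂ x₃)
    (h₃ : G.Adj x₃ x₄) (h₁₃ : x₁ ≠ x₃) (h₂₄ : x₂ ≠ x₄) : ¬ G.Adj x₄ x₁ := by
  intro h₄
  have hc : (Walk.cons h₁ (Walk.cons h₂ (Walk.cons h₃ (Walk.cons h₄ Walk.nil)))).IsCycle := by
    have := h₁.ne; have := h₂.ne; have := h₃.ne; have := h₄.ne
    simp [Walk.cons_isCycle_iff, Walk.cons_isPath_iff]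
    grind
  have := le_egirth.1 hg _ _ hc
  simp only [Walk.length_cons, Walk.length_nil] at this
  exact absurd this (by norm_num)

theorem not_pentagon_of_egirth (hg : 6 ≤ G.egirth) (h₁ : G.Adj x₁ x₂) (h₂ : G.Adj x₂ x₃)
    (h₃ : G.Adj x₃ x₄) (h₄ : G.Adj x₄ x₅) (h₁₃ : x₁ ≠ x₃) (h₁₄ : x₁ ≠ x₄) (h₂₄ : x₂ ≠ x₄)
    (h₂₅ : x₂ ≠ x₅) (h₃₅ : x₃ ≠ x₅) : ¬ G.Adj x₅ x₁ := by
  intro h₅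
  have hc : (Walk.cons h₁ (Walk.cons h₂ (Walk.cons h₃
      (Walk.cons h₄ (Walk.cons h₅ Walk.nil))))).IsCycle := by
    have := h₁.ne; have := h₂.ne; have := h₃.ne; have := h₄.ne; have := h₅.ne
    simp [Walk.cons_isCycle_iff, Walk.cons_isPath_iff]
    grind
  have := le_egirth.1 hg _ _ hc
  simp only [Walk.length_cons, Walk.length_nil] at this
  exact absurd this (by norm_num)

end Girth

/-- In a nonempty set of vertices of an outerplanar graph of girth at least six, some vertex
has at most one neighbor or there is a path with four consecutive vertices of degree two. -/
theorem exists_leaf_or_path [LinearOrder V] (S : Finset V) (hS : S.Nonempty)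
    (hG : ∀ a b c d : V, G.Adj a b → G.Adj c d → ¬ (a < c ∧ c < b ∧ b < d))
    (hg : 6 ≤ G.egirth) :
    (∃ v ∈ S, ∃ u, ∀ x ∈ S, G.Adj v x → x = u) ∨
    ∃ u v₁ v₂ v₃ v₄ w, v₁ ∈ S ∧ v₂ ∈ S ∧ v₃ ∈ S ∧ v₄ ∈ S ∧
      v₁ ≠ v₂ ∧ v₁ ≠ v₃ ∧ v₁ ≠ v₄ ∧ v₂ ≠ v₃ ∧ v₂ ≠ v₄ ∧ v₃ ≠ v₄ ∧
      (∀ x ∈ S, G.Adj v₁ x → x = u ∨ x = v₂) ∧ (∀ x ∈ S, G.Adj v₂ x → x = v₁ ∨ x = v₃) ∧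
      (∀ x ∈ S, G.Adj v₃ x → x = v₂ ∨ x = v₄) ∧ (∀ x ∈ S, G.Adj v₄ x → x = v₃ ∨ x = w) := by
  classical
  refine or_iff_not_imp_left.2 fun hleaf => ?_
  push Not at hleaf
  set P : Finset (V × V) := (S ×ˢ S).filter fun p =>
    G.Adj p.1 p.2 ∧ ∃ z ∈ S, p.1 < z ∧ z < p.2 with hP
  have hPne : P.Nonempty := by
    have hm := S.min'_mem hS
    obtain ⟨x, hx, hmx, -⟩ := hleaf _ hm (S.min' hS)
    obtain ⟨y, hy, hmy, hyx⟩ := hleaf _ hm x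
    have hmx' := lt_of_le_of_ne (S.min'_le x hx) hmx.ne
    have hmy' := lt_of_le_of_ne (S.min'_le y hy) hmy.ne
    rcases lt_or_gt_of_ne hyx with hlt | hlt
    · exact ⟨(_, x), by simp only [hP, Finset.mem_filter, Finset.mem_product]; exact
        ⟨⟨hm, hx⟩, hmx, y, hy, hmy', hlt⟩⟩
    · exact ⟨(_, y), by simp only [hP, Finset.mem_filter, Finset.mem_product]; exact
        ⟨⟨hm, hy⟩, hmy, x, hx, hmx', hlt⟩⟩
  obtain ⟨⟨x, y⟩, hxyP, hmin⟩ :=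
    P.exists_min_image (fun p => (S.filter fun z => p.1 < z ∧ z < p.2).card) hPne
  simp only [hP, Finset.mem_filter, Finset.mem_product] at hxyP
  obtain ⟨⟨hxS, hyS⟩, hxy, z₀, hz₀S, hxz₀, hz₀y⟩ := hxyP
  have hgap : ∀ p ∈ S, ∀ q ∈ S, G.Adj p q → x ≤ p → q ≤ y → (x < p ∨ q < y) →
      ∀ z ∈ S, p < z → ¬ z < q := by
    intro p hp q hq hpq hxp hqy hproper z hz hpz hzq
    have hle := hmin (p, q) (by
      simp only [hP, Finset.mem_filter, Finset.mem_product]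
      exact ⟨⟨hp, hq⟩, hpq, z, hz, hpz, hzq⟩)
    refine absurd hle (not_le.2 (Finset.card_lt_card ?_))
    refine Finset.ssubset_iff_of_subset (fun t ht => ?_) |>.2 ?_
    · simp only [Finset.mem_filter] at ht ⊢
      exact ⟨ht.1, hxp.trans_lt ht.2.1, ht.2.2.trans_le hqy⟩
    · rcases hproper with hlt | hlt
      · exact ⟨p, by simp only [Finset.mem_filter]; exact ⟨hp, hlt, (hpz.trans hzq).trans_le hqy⟩,
          by simp⟩
      · exact ⟨q, by simp only [Finset.mem_filter]; exact ⟨hq, hxp.trans_lt (hpz.trans hzq), hlt⟩,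
          by simp⟩
  have hinside : ∀ z, x < z → z < y → ∀ t, G.Adj z t → x ≤ t ∧ t ≤ y := by
    intro z hxz hzy t hzt
    refine ⟨not_lt.1 fun htx => hG t z x y hzt.symm hxy ⟨htx, hxz, hzy⟩,
      not_lt.1 fun hyt => hG x y z t hxy hzt ⟨hxz, hzy, hyt⟩⟩
  have hlow : ∀ z ∈ S, x < z → z < y → ∀ s ∈ S, ∀ t ∈ S, G.Adj z s → G.Adj z t →
      s < z → t < z → s = t := by
    intro z hz hxz hzy s hs t ht hzs hzt hsz htz
    have hs' := (hinside z hxz hzy s hzs).1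
    have ht' := (hinside z hxz hzy t hzt).1
    rcases lt_trichotomy s t with hlt | heq | hlt
    · exact (hgap s hs z hz hzs.symm hs' hzy.le (Or.inr hzy) t ht hlt htz).elim
    · exact heq
    · exact (hgap t ht z hz hzt.symm ht' hzy.le (Or.inr hzy) s hs hlt hsz).elim
  have hup : ∀ z ∈ S, x < z → z < y → ∀ s ∈ S, ∀ t ∈ S, G.Adj z s → G.Adj z t →
      z < s → z < t → s = t := by
    intro z hz hxz hzy s hs t ht hzs hzt hsz htz
    have hs' := (hinside z hxz hzy s hzs).2
    have ht' := (hinside z hxz hzy t hzt).2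
    rcases lt_trichotomy s t with hlt | heq | hlt
    · exact (hgap z hz t ht hzt hxz.le ht' (Or.inl hxz) s hs hsz hlt).elim
    · exact heq
    · exact (hgap z hz s hs hzs hxz.le hs' (Or.inl hxz) t ht htz hlt).elim
  have hnbrs : ∀ z ∈ S, x < z → z < y → ∃ s ∈ S, ∃ t ∈ S, G.Adj z s ∧ G.Adj z t ∧ x ≤ s ∧
      s < z ∧ z < t ∧ t ≤ y ∧ ∀ r ∈ S, G.Adj z r → r = s ∨ r = t := by
    intro z hz hxz hzy
    obtain ⟨s, hs, hzs, -⟩ := hleaf z hz z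
    obtain ⟨t, ht, hzt, hts⟩ := hleaf z hz s
    have key : ∀ s ∈ S, ∀ t ∈ S, G.Adj z s → G.Adj z t → s < z → z < t →
        ∀ r ∈ S, G.Adj z r → r = s ∨ r = t := by
      intro s hs t ht hzs hzt hsz hzt' r hr hzr
      rcases lt_or_gt_of_ne hzr.ne with hlt | hlt
      · exact Or.inr (hup z hz hxz hzy r hr t ht hzr hzt hlt hzt')
      · exact Or.inl (hlow z hz hxz hzy r hr s hs hzr hzs hlt hsz)
    have is := hinside z hxz hzy s hzs
    have it := hinside z hxz hzy t hzt
    rcases lt_or_gt_of_ne hzs.ne with h₁ | h₁ <;> rcases lt_or_gt_of_ne hzt.ne with h₂ | h₂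
    · exact (hts (hup z hz hxz hzy t ht s hs hzt hzs h₂ h₁)).elim
    · exact ⟨t, ht, s, hs, hzt, hzs, it.1, h₂, h₁, is.2, key t ht s hs hzt hzs h₂ h₁⟩
    · exact ⟨s, hs, t, ht, hzs, hzt, is.1, h₁, h₂, it.2, key s hs t ht hzs hzt h₁ h₂⟩
    · exact (hts (hlow z hz hxz hzy t ht s hs hzt hzs h₂ h₁)).elim
  have hstep : ∀ z ∈ S, x < z → z < y → ∀ s ∈ S, G.Adj z s → s < z →
      ∃ t ∈ S, G.Adj z t ∧ z < t ∧ t ≤ y ∧ ∀ r ∈ S, G.Adj z r → r = s ∨ r = t := by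
    intro z hz hxz hzy s hs hzs hsz
    obtain ⟨s', hs', t, ht, hzs', hzt, -, hsz', hzt', hty, hr⟩ := hnbrs z hz hxz hzy
    obtain rfl := hlow z hz hxz hzy s hs s' hs' hzs hzs' hsz hsz'
    exact ⟨t, ht, hzt, hzt', hty, hr⟩
  obtain ⟨p₁, hp₁S, hxp₁, hp₁y, hp₁x⟩ : ∃ p ∈ S, x < p ∧ p < y ∧ G.Adj p x := by
    have hne : (S.filter fun z => x < z ∧ z < y).Nonempty :=
      ⟨z₀, Finset.mem_filter.2 ⟨hz₀S, hxz₀, hz₀y⟩⟩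
    obtain ⟨hpS, hxp, hpy⟩ := Finset.mem_filter.1 (Finset.min'_mem _ hne)
    refine ⟨_, hpS, hxp, hpy, ?_⟩
    obtain ⟨s, hs, -, -, hps, -, hxs, hsp, -⟩ := hnbrs _ hpS hxp hpy
    rcases hxs.eq_or_lt with rfl | hlt
    · exact hps
    · exact absurd hsp (not_lt.2 (Finset.min'_le _ s
        (Finset.mem_filter.2 ⟨hs, hlt, hsp.trans hpy⟩)))
  obtain ⟨p₂, hp₂S, h₁₂, l₁₂, hp₂y, hn₁⟩ := hstep p₁ hp₁S hxp₁ hp₁y x hxS hp₁x hxp₁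
  have hxp₂ := hxp₁.trans l₁₂
  replace hp₂y : p₂ < y := hp₂y.lt_of_ne fun e => by
    subst e; exact not_triangle_of_egirth hg hp₁x.symm h₁₂ hxy.symm
  obtain ⟨p₃, hp₃S, h₂₃, l₂₃, hp₃y, hn₂⟩ := hstep p₂ hp₂S hxp₂ hp₂y p₁ hp₁S h₁₂.symm l₁₂
  have hxp₃ := hxp₂.trans l₂₃
  have l₁₃ := l₁₂.trans l₂₃
  replace hp₃y : p₃ < y := hp₃y.lt_of_ne fun e => by
    subst e
    exact not_quadrilateral_of_egirth hg hp₁x.symm h₁₂ h₂₃ hxp₂.ne l₁₃.ne hxy.symm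
  obtain ⟨p₄, hp₄S, h₃₄, l₃₄, hp₄y, hn₃⟩ := hstep p₃ hp₃S hxp₃ hp₃y p₂ hp₂S h₂₃.symm l₂₃
  have hxp₄ := hxp₃.trans l₃₄
  have l₂₄ := l₂₃.trans l₃₄
  have l₁₄ := l₁₃.trans l₃₄
  replace hp₄y : p₄ < y := hp₄y.lt_of_ne fun e => by
    subst e
    exact not_pentagon_of_egirth hg hp₁x.symm h₁₂ h₂₃ h₃₄ hxp₂.ne hxp₃.ne l₁₃.ne l₁₄.ne l₂₄.ne
      hxy.symm
  obtain ⟨p₅, -, -, -, -, hn₄⟩ := hstep p₄ hp₄S hxp₄ hp₄y p₃ hp₃S h₃₄.symm l₃₄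
  exact ⟨x, p₁, p₂, p₃, p₄, p₅, hp₁S, hp₂S, hp₃S, hp₄S, l₁₂.ne, l₁₃.ne, l₁₄.ne, l₂₃.ne, l₂₄.ne,
    l₃₄.ne, hn₁, hn₂, hn₃, hn₄⟩

theorem exists_isSquarePairOn [Fintype V] [LinearOrder V]
    (hG : ∀ a b c d : V, G.Adj a b → G.Adj c d → ¬ (a < c ∧ c < b ∧ b < d))
    (hg : 6 ≤ G.egirth) (hk : G.maxDeg + 2 ≤ k) (hk' : 6 ≤ k) (S : Finset V) :
    ∃ a b : V → Fin k, G.IsSquarePairOn S a b := by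
  induction S using Finset.strongInduction with
  | H S ih =>
    rcases S.eq_empty_or_nonempty with rfl | hS
    · let c : Fin k := ⟨0, by omega⟩
      exact ⟨fun _ => c, fun _ => c, by constructor <;> simp⟩
    rcases exists_leaf_or_path S hS hG hg with ⟨v, hv, u, hu⟩ |
      ⟨u, v₁, v₂, v₃, v₄, w, m₁, m₂, m₃, m₄, n₁₂, n₁₃, n₁₄, n₂₃, n₂₄, n₃₄, h₁, h₂, h₃, h₄⟩
    · rw [← Finset.insert_erase hv]
      exact exists_isSquarePairOn_insert_leaf hk hk' (Finset.notMem_erase v S)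
        (fun x hx => hu x (Finset.mem_of_mem_erase hx)) (ih _ (Finset.erase_ssubset hv))
    · have m₂' : v₂ ∈ S.erase v₃ := Finset.mem_erase.2 ⟨n₂₃, m₂⟩
      rw [← Finset.insert_erase m₃, ← Finset.insert_erase m₂']
      refine exists_isSquarePairOn_insert_path (u := u) (v₁ := v₁) (v₄ := v₄) (w := w) hk'
        (by simp) (by simp) (by simp [*]) (by simp [*, n₂₄.symm, n₃₄.symm]) n₁₄ n₂₃ ?_ ?_ ?_ ?_
        (ih _ ((Finset.erase_ssubset m₂').trans (Finset.erase_ssubset m₃)))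
      all_goals
        intro x hx hadj
        simp only [Finset.mem_erase] at hx
      · exact (h₁ x hx.2.2 hadj).resolve_right hx.1
      · exact (h₂ x hx.2.2 hadj).resolve_right hx.2.1
      · exact (h₃ x hx.2.2 hadj).resolve_left hx.1
      · exact (h₄ x hx.2.2 hadj).resolve_left hx.2.1

theorem IsIncidence.exists_adj {v : V} {e : Sym2 V} (h : G.IsIncidence v e) :
    ∃ u, G.Adj v u ∧ e = s(v, u) := by
  obtain ⟨he, u, rfl⟩ := h
  exact ⟨u, he, rfl⟩

/-- A compatible pair on all vertices yields a vi-simultaneous `(k, 1)`-coloring. -/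
theorem IsSquarePairOn.exists_isViColoring [Fintype V] {a b : V → Fin k}
    (h : G.IsSquarePairOn Finset.univ a b) :
    ∃ cV cI, G.IsViColoring k cV cI ∧ ∀ u, (G.secondIncColors cI u).ncard ≤ 1 := by
  classical
  let cI : V → Sym2 V → Fin k := fun v e =>
    if hv : v ∈ e then b (Sym2.Mem.other hv) else b v
  have hcI : ∀ v u, cI v s(v, u) = b u := by
    intro v u
    have hv : v ∈ s(v, u) := Sym2.mem_mk_left v u
    simp only [cI, hv, dif_pos]
    exact congrArg b (Sym2.congr_right.1 (Sym2.other_spec hv))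
  refine ⟨a, cI, ⟨fun u v huv => h.vertex_ne u (Finset.mem_univ _) v (Finset.mem_univ _) huv,
    ?_, ?_⟩, ?_⟩
  · intro u w f hf hu
    obtain ⟨x, hwx, rfl⟩ := hf.exists_adj
    rw [hcI]
    rcases Sym2.mem_iff.1 hu with rfl | rfl
    · exact h.ne_adj _ (Finset.mem_univ _) _ (Finset.mem_univ _) hwx
    · exact h.ne_self _ (Finset.mem_univ _)
  · intro v e w f he hf hne hrel
    obtain ⟨x, hvx, rfl⟩ := he.exists_adj
    obtain ⟨y, hwy, rfl⟩ := hf.exists_adj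
    rw [hcI, hcI]
    have hadj : ∀ p q, G.Adj p q → b p ≠ b q := fun p q =>
      h.inc_ne p (Finset.mem_univ _) q (Finset.mem_univ _)
    rcases hrel with rfl | hrel | hrel | hrel
    · exact h.inc_ne_two x (Finset.mem_univ _) v (Finset.mem_univ _) y (Finset.mem_univ _) hvx hwy
        (by rintro rfl; exact hne rfl)
    · rcases Sym2.eq_iff.1 hrel with ⟨rfl, rfl⟩ | ⟨rfl, rfl⟩
      · exact (hne rfl).elim
      · exact hadj _ _ hvx.symm
    · obtain rfl := Sym2.congr_right.1 hrel
      exact hadj _ _ hwy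
    · rw [Sym2.eq_swap] at hrel
      obtain rfl := Sym2.congr_right.1 hrel
      exact (hadj _ _ hvx).symm
  · intro u
    refine (Set.ncard_le_ncard (t := {b u}) ?_ (Set.toFinite _)).trans (Set.ncard_singleton _).le
    rintro _ ⟨v, -, rfl⟩
    rw [Sym2.eq_swap, hcI]
    rfl

/-- Every vi-simultaneous proper coloring of a graph with an edge uses at least `Δ + 2` colors. -/
theorem IsViColoring.maxDeg_add_two_le [Fintype V] {cV : V → Fin k} {cI : V → Sym2 V → Fin k}
    (h : G.IsViColoring k cV cI) (hΔ : 0 < G.maxDeg) : G.maxDeg + 2 ≤ k := by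
  classical
  have hne : (Finset.univ : Finset V).Nonempty := by
    by_contra hempty
    simp [maxDeg, Finset.not_nonempty_iff_eq_empty.1 hempty] at hΔ
  obtain ⟨u, -, hu⟩ := Finset.exists_mem_eq_sup _ hne fun v => (G.neighborSet v).ncard
  change G.maxDeg = _ at hu
  obtain ⟨v₀, hv₀ : G.Adj u v₀⟩ := Set.nonempty_of_ncard_ne_zero (hu ▸ hΔ.ne')
  have hinc : ∀ v, G.Adj u v → G.IsIncidence u s(u, v) := fun v hv => ⟨hv, Sym2.mem_mk_left _ _⟩
  have hinc₀ : G.IsIncidence v₀ s(u, v₀) := ⟨hv₀, Sym2.mem_mk_right _ _⟩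
  set C : Set (Fin k) := (fun v => cI u s(u, v)) '' G.neighborSet u with hC
  have hCcard : C.ncard = G.maxDeg := by
    rw [hu]
    refine Set.InjOn.ncard_image fun v hv w hw hvw => by_contra fun hne => ?_
    refine h.inc_ne (hinc v hv) (hinc w hw) (fun e => hne ?_) (Or.inl rfl) hvw
    exact Sym2.congr_right.1 (Prod.ext_iff.1 e).2
  have h₁ : cI v₀ s(u, v₀) ∉ C := by
    rintro ⟨v, hv, hvv₀⟩
    refine h.inc_ne (hinc v hv) hinc₀ (fun e => hv₀.ne (Prod.ext_iff.1 e).1)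
      (Or.inr (Or.inr (Or.inr rfl))) hvv₀
  have h₂ : cV u ∉ insert (cI v₀ s(u, v₀)) C := by
    rintro (he | ⟨v, hv, he⟩)
    · exact h.vertex_inc_ne hinc₀ (Sym2.mem_mk_left _ _) he
    · exact h.vertex_inc_ne (hinc v hv) (Sym2.mem_mk_left _ _) he.symm
  have hcard := Set.ncard_le_ncard (Set.subset_univ (insert (cV u) (insert (cI v₀ s(u, v₀)) C)))
    (Set.toFinite _)
  rwa [Set.ncard_insert_of_notMem h₂ (Set.toFinite _),
    Set.ncard_insert_of_notMem h₁ (Set.toFinite _), hCcard, Set.ncard_univ, Nat.card_fin] at hcard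

end SimpleGraph

/-- If `G` is a finite outerplanar graph with `Δ(G) ≥ 4` and girth `g(G) ≥ 6`,
then `χ_{vi,1}(G) = Δ(G) + 2`. -/
theorem chiViS_one_eq_of_outerplanar [Fintype V] (G : SimpleGraph V) (hG : G.Outerplanar)
    (hΔ : 4 ≤ G.maxDeg) (hg : 6 ≤ G.egirth) :
    G.chiViS 1 = G.maxDeg + 2 := by
  obtain ⟨r, hr⟩ := hG
  obtain ⟨a, b, hab⟩ := exists_isSquarePairOn (k := G.maxDeg + 2) hr hg le_rfl (by omega)
    Finset.univ
  have hmem := hab.exists_isViColoring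
  refine le_antisymm (Nat.sInf_le hmem) (le_csInf ⟨_, hmem⟩ ?_)
  rintro k ⟨cV, cI, hc, -⟩
  exact hc.maxDeg_add_two_le (by omega)
end

section
/- If G is a finite outerplanar graph with Δ(G) ≥ 5 and girth g(G) ≥ 4, then χ_{vi,1}(G) = Δ(G) + 2. -/
open SimpleGraph

variable {V : Type*}

section ListColoring

variable {α β : Type*} [DecidableEq α] [DecidableEq β]

/-- If `g` maps `M \ {v}` injectively into `L \ {x}`, then updating `g` at `v` by `x ∈ L` gives an
injective map of `M` into `L`. -/
theorem Function.update_mem_and_injOn {L : Finset α} {M : Finset β} {v : β} {x : α} (hx : x ∈ L)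
    {g : β → α} (hg : ∀ w ∈ M.erase v, g w ∈ L.erase x) (hinj : Set.InjOn g ↑(M.erase v)) :
    (∀ w ∈ M, Function.update g v x w ∈ L) ∧ Set.InjOn (Function.update g v x) M := by
  simp only [Finset.mem_erase, Set.InjOn, Finset.mem_coe] at *
  constructor
  · intro w hw
    by_cases h : w = v
    · simpa [h] using hx
    · simpa [h] using (hg w ⟨h, hw⟩).2
  · intro w hw w' hw'
    by_cases h : w = v <;> by_cases h' : w' = v <;> simp only [Function.update_apply] <;> grind

/-- There is an injection from `M` into `L` when `M` has at most as many elements as `L`. -/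
theorem Finset.exists_mem_and_injOn [Nonempty α] (M : Finset β) (L : Finset α)
    (h : M.card ≤ L.card) : ∃ g : β → α, (∀ v ∈ M, g v ∈ L) ∧ Set.InjOn g M := by
  induction M using Finset.induction_on generalizing L with
  | empty => exact ⟨fun _ => Classical.arbitrary α, by simp, by simp⟩
  | insert v M hv ih =>
    rw [Finset.card_insert_of_notMem hv] at h
    obtain ⟨x, hx⟩ : L.Nonempty := Finset.card_pos.mp (by omega)
    obtain ⟨g, hg, hinj⟩ := ih (L.erase x) (by rw [Finset.card_erase_of_mem hx]; omega)
    exact ⟨Function.update g v x,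
      Function.update_mem_and_injOn hx (by rwa [Finset.erase_insert hv])
        (by rwa [Finset.erase_insert hv])⟩

/-- An injection from `M` into `L` can avoid fewer than `L.card` given values at one element. -/
theorem Finset.exists_mem_and_injOn_and_notMem [Nonempty α] (M : Finset β) (L : Finset α)
    (h : M.card ≤ L.card) (v : β) (F : Finset α) (hF : F.card < L.card) :
    ∃ g : β → α, (∀ w ∈ M, g w ∈ L) ∧ Set.InjOn g M ∧ (v ∈ M → g v ∉ F) := by
  by_cases hv : v ∈ M
  · obtain ⟨x, hxL, hxF⟩ := Finset.exists_mem_notMem_of_card_lt_card hF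
    obtain ⟨g, hg, hinj⟩ := Finset.exists_mem_and_injOn (M.erase v) (L.erase x)
      (by rw [Finset.card_erase_of_mem hxL, Finset.card_erase_of_mem hv]; omega)
    obtain ⟨hmem, hinj'⟩ := Function.update_mem_and_injOn hxL hg hinj
    exact ⟨_, hmem, hinj', fun _ => by simpa using hxF⟩
  · obtain ⟨g, hg, hinj⟩ := Finset.exists_mem_and_injOn M L h
    exact ⟨g, hg, hinj, fun hv' => absurd hv' hv⟩

/-- An injection from `M` into `L` can avoid a given value at one element and a few given values
at another one. -/
theorem Finset.exists_mem_and_injOn_and_ne_and_notMem [Nonempty α] (M : Finset β) (L : Finset α)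
    (h : M.card ≤ L.card) (hL : 3 ≤ L.card) (v₁ v₂ : β) (a : α) (F : Finset α)
    (hF : F.card + 2 ≤ L.card) :
    ∃ g : β → α, (∀ w ∈ M, g w ∈ L) ∧ Set.InjOn g M ∧ (v₁ ∈ M → g v₁ ≠ a) ∧
      (v₂ ∈ M → g v₂ ∉ F) := by
  by_cases h₁₂ : v₁ = v₂
  · obtain ⟨g, hg, hinj, hv⟩ := Finset.exists_mem_and_injOn_and_notMem M L h v₁ (insert a F)
      (by have := Finset.card_insert_le a F; omega)
    subst h₁₂
    refine ⟨g, hg, hinj, fun hm => ?_, fun hm => ?_⟩ <;> have := hv hm <;> simp_all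
  by_cases hv₂ : v₂ ∈ M
  · obtain ⟨x, hxL, hxF⟩ := Finset.exists_mem_notMem_of_card_lt_card (s := F) (t := L) (by omega)
    obtain ⟨g, hg, hinj, hv⟩ := Finset.exists_mem_and_injOn_and_notMem (M.erase v₂) (L.erase x)
      (by rw [Finset.card_erase_of_mem hxL, Finset.card_erase_of_mem hv₂]; omega) v₁ {a}
      (by rw [Finset.card_erase_of_mem hxL, Finset.card_singleton]; omega)
    obtain ⟨hmem, hinj'⟩ := Function.update_mem_and_injOn hxL hg hinj
    refine ⟨_, hmem, hinj', fun hm => ?_, fun _ => by simpa using hxF⟩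
    simpa [h₁₂] using hv (Finset.mem_erase.mpr ⟨h₁₂, hm⟩)
  · obtain ⟨g, hg, hinj, hv⟩ := Finset.exists_mem_and_injOn_and_notMem M L h v₁ {a}
      (by rw [Finset.card_singleton]; omega)
    exact ⟨g, hg, hinj, fun hm => by simpa using hv hm, fun hm => absurd hm hv₂⟩

end ListColoring

namespace SimpleGraph

section Combinatorics

/-- `u` and `v` are joined by a walk of length one or two. -/
def Near (G : SimpleGraph V) (u v : V) : Prop :=
  G.Adj u v ∨ ∃ w, G.Adj u w ∧ G.Adj w v

theorem Near.symm {G : SimpleGraph V} {u v : V} (h : G.Near u v) : G.Near v u := by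
  rcases h with h | ⟨w, h, h'⟩
  · exact Or.inl h.symm
  · exact Or.inr ⟨w, h'.symm, h.symm⟩

/-- The vertices of `P` together with their neighbors. -/
def closedNhd (G : SimpleGraph V) (P : Set V) : Set V :=
  {v | v ∈ P ∨ ∃ q ∈ P, G.Adj q v}

/-- The graph has no triangle. -/
def NoTriangle (G : SimpleGraph V) : Prop :=
  ∀ a b c : V, G.Adj a b → G.Adj b c → ¬G.Adj a c

variable [LinearOrder V]

/-- No two edges of the graph cross with respect to the linear order of its vertices. -/
def NonCrossing (G : SimpleGraph V) : Prop :=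
  ∀ a b c d : V, G.Adj a b → G.Adj c d → ¬(a < c ∧ c < b ∧ b < d)

/-- The edges passing over a vertex. -/
def cover (G : SimpleGraph V) (v : V) : Set (V × V) :=
  {e | e.1 < v ∧ v < e.2 ∧ G.Adj e.1 e.2}

/-- The number of edges passing over a vertex. -/
noncomputable def depth (G : SimpleGraph V) (v : V) : ℕ :=
  (G.cover v).ncard

/-- The vertices preceding `z` when the vertices are sorted by depth first and by position next. -/
def before (G : SimpleGraph V) (z : V) : Set V :=
  {u | G.depth u < G.depth z ∨ G.depth u = G.depth z ∧ u < z}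

variable {G : SimpleGraph V}

theorem not_mem_before_self (z : V) : z ∉ G.before z := by
  simp [before]

theorem NonCrossing.mem_Icc (hnc : G.NonCrossing) {a b u v : V} (hab : G.Adj a b) (hu : a < u)
    (hu' : u < b) (huv : G.Adj u v) : a ≤ v ∧ v ≤ b := by
  constructor
  · by_contra! h
    exact hnc v u a b huv.symm hab ⟨h, hu, hu'⟩
  · by_contra! h
    exact hnc a b u v hab huv ⟨hu, hu', h⟩

/-- Under an edge `ab` there is at most one pair of a neighbor of `a` and a neighbor of `b` within
distance two of each other. -/
theorem NonCrossing.eq_of_near (hnc : G.NonCrossing) (htf : G.NoTriangle) {a b u₁ u₂ v₁ v₂ : V}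
    (hab : G.Adj a b)
    (hau₁ : a < u₁) (hub₁ : u₁ < b) (hav₁ : a < v₁) (hvb₁ : v₁ < b)
    (hau₂ : a < u₂) (hub₂ : u₂ < b) (hav₂ : a < v₂) (hvb₂ : v₂ < b)
    (hu₁ : G.Adj a u₁) (hu₂ : G.Adj a u₂) (hv₁ : G.Adj b v₁) (hv₂ : G.Adj b v₂)
    (h₁ : G.Near u₁ v₁) (h₂ : G.Near u₂ v₂) : u₁ = u₂ ∧ v₁ = v₂ := by
  have lt : ∀ u v, a < u → u < b → a < v → v < b → G.Adj a u → G.Adj b v → u < v := by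
    intro u v _ hub hav _ hu hv
    by_contra! h
    rcases h.lt_or_eq with h | rfl
    · exact hnc a u v b hu hv.symm ⟨hav, h, hub⟩
    · exact htf a b v hab hv hu
  have inner : ∀ u v w, a < u → u < b → a < v → v < b → G.Adj a u → G.Adj b v → G.Adj u w →
      G.Adj w v → a < w ∧ w < b := by
    intro u v w hau hub hav hvb hu hv huw hwv
    obtain ⟨h1, h2⟩ := hnc.mem_Icc hab hau hub huw
    refine ⟨lt_of_le_of_ne h1 ?_, lt_of_le_of_ne h2 ?_⟩
    · rintro rfl
      exact htf a b v hab hv hwv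
    · rintro rfl
      exact htf a w u hab huw.symm hu
  have right : ∀ u v v', a < u → u < b → a < v → v < b → a < v' → v' < b → G.Adj a u →
      G.Adj b v → G.Adj b v' → G.Near u v → v ≤ v' := by
    intro u v v' hau hub hav hvb hav' hvb' hu hv hv' hn
    by_contra! h
    have huv' := lt u v' hau hub hav' hvb' hu hv'
    rcases hn with hn | ⟨w, huw, hwv⟩
    · exact hnc u v v' b hn hv'.symm ⟨huv', h, hvb⟩
    · obtain ⟨_, hwb⟩ := inner u v w hau hub hav hvb hu hv huw hwv
      rcases lt_trichotomy w v' with hw | rfl | hw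
      · exact hnc w v v' b hwv hv'.symm ⟨hw, h, hvb⟩
      · exact htf b w v hv' hwv hv
      · exact hnc u w v' b huw hv'.symm ⟨huv', hw, hwb⟩
  have left : ∀ u u' v, a < u → u < b → a < u' → u' < b → a < v → v < b → G.Adj a u →
      G.Adj a u' → G.Adj b v → G.Near u v → u' ≤ u := by
    intro u u' v hau hub hau' hub' hav hvb hu hu' hv hn
    by_contra! h
    have huv' := lt u' v hau' hub' hav hvb hu' hv
    rcases hn with hn | ⟨w, huw, hwv⟩
    · exact hnc a u' u v hu' hn ⟨hau, h, huv'⟩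
    · obtain ⟨haw, _⟩ := inner u v w hau hub hav hvb hu hv huw hwv
      rcases lt_trichotomy w u' with hw | rfl | hw
      · exact hnc a u' w v hu' hwv ⟨haw, hw, huv'⟩
      · exact htf a u w hu huw hu'
      · exact hnc a u' u w hu' huw ⟨hau, h, hw⟩
  exact ⟨le_antisymm
      (left u₂ u₁ v₂ hau₂ hub₂ hau₁ hub₁ hav₂ hvb₂ hu₂ hu₁ hv₂ h₂)
      (left u₁ u₂ v₁ hau₁ hub₁ hau₂ hub₂ hav₁ hvb₁ hu₁ hu₂ hv₁ h₁),
    le_antisymm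
      (right u₁ v₁ v₂ hau₁ hub₁ hav₁ hvb₁ hav₂ hvb₂ hu₁ hv₁ hv₂ h₁)
      (right u₂ v₂ v₁ hau₂ hub₂ hav₂ hvb₂ hav₁ hvb₁ hu₂ hv₂ hv₁ h₂)⟩

variable [Finite V]

theorem NonCrossing.depth_lt (hnc : G.NonCrossing) {a b v : V} (hab : G.Adj a b) (hav : a < v)
    (hvb : v < b) : G.depth a < G.depth v ∧ G.depth b < G.depth v := by
  constructor
  · refine Set.ncard_lt_ncard ⟨?_, fun h => ?_⟩ (Set.toFinite _)
    · rintro ⟨c, d⟩ ⟨hca, had, hcd⟩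
      refine ⟨hca.trans hav, ?_, hcd⟩
      by_contra! h
      exact hnc c d a b hcd hab ⟨hca, had, h.trans_lt hvb⟩
    · exact lt_irrefl a (h (show (a, b) ∈ G.cover v from ⟨hav, hvb, hab⟩)).1
  · refine Set.ncard_lt_ncard ⟨?_, fun h => ?_⟩ (Set.toFinite _)
    · rintro ⟨c, d⟩ ⟨hcb, hbd, hcd⟩
      refine ⟨?_, hvb.trans hbd, hcd⟩
      by_contra! h
      exact hnc a b c d hab hcd ⟨hav.trans_le h, hcb, hbd⟩
    · exact lt_irrefl b (h (show (a, b) ∈ G.cover v from ⟨hav, hvb, hab⟩)).2.1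

theorem NonCrossing.depth_le_of_min (hnc : G.NonCrossing) {a z : V} (haz : G.Adj a z) (h : a < z)
    (hmin : ∀ v, v < z → G.Adj z v → a ≤ v) : G.depth a ≤ G.depth z := by
  refine Set.ncard_le_ncard ?_ (Set.toFinite _)
  rintro ⟨c, d⟩ ⟨hca, had, hcd⟩
  simp only at hca had hcd
  refine ⟨hca.trans h, ?_, hcd⟩
  by_contra! hd
  simp only at hd
  rcases hd.lt_or_eq with hd | rfl
  · exact hnc c d a z hcd haz ⟨hca, had, hd⟩
  · exact absurd (hmin c (hca.trans h) hcd.symm) (not_le.mpr hca)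

theorem NonCrossing.depth_le_of_max (hnc : G.NonCrossing) {b z : V} (hbz : G.Adj z b) (h : z < b)
    (hmax : ∀ v, z < v → G.Adj z v → v ≤ b) : G.depth b ≤ G.depth z := by
  refine Set.ncard_le_ncard ?_ (Set.toFinite _)
  rintro ⟨c, d⟩ ⟨hcb, hbd, hcd⟩
  simp only at hcb hbd hcd
  refine ⟨?_, h.trans hbd, hcd⟩
  by_contra! hc
  simp only at hc
  rcases hc.lt_or_eq with hc | rfl
  · exact hnc z b c d hbz hcd ⟨hc, hcb, hbd⟩
  · exact absurd (hmax d (h.trans hbd) hcd) (not_le.mpr hbd)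

/-- A vertex under the edge `ab` that has a neighbor before `z`, where `a` or `b` is at least as
deep as `z`, has `a` or `b` as that neighbor. -/
theorem NonCrossing.of_mem_closedNhd (hnc : G.NonCrossing) {a b v z : V} (hab : G.Adj a b)
    (hav : a < v) (hvb : v < b) (hz : G.depth z ≤ G.depth a ∨ G.depth z ≤ G.depth b)
    (hv : v ∈ G.closedNhd (G.before z)) :
    G.Adj a v ∧ a ∈ G.before z ∨ G.Adj b v ∧ b ∈ G.before z := by
  have deep : ∀ q, a < q → q < b → q ∉ G.before z := by
    intro q haq hqb hq
    have := hnc.depth_lt hab haq hqb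
    simp only [before, Set.mem_ofPred_eq] at hq
    omega
  rcases hv with hv | ⟨q, hq, hqv⟩
  · exact absurd hv (deep v hav hvb)
  · obtain ⟨h1, h2⟩ := hnc.mem_Icc hab hav hvb hqv.symm
    rcases h1.lt_or_eq with h1 | rfl
    · rcases h2.lt_or_eq with h2 | rfl
      · exact absurd hq (deep q h1 h2)
      · exact Or.inr ⟨hqv, hq⟩
    · exact Or.inl ⟨hqv, hq⟩

theorem exists_min_left (z : V) (h : ∃ v, v < z ∧ G.Adj z v) :
    ∃ a, a < z ∧ G.Adj z a ∧ ∀ v, v < z → G.Adj z v → a ≤ v := by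
  obtain ⟨a, ha, hmin⟩ :=
    Set.exists_min_image {v | v < z ∧ G.Adj z v} id (Set.toFinite _) h
  exact ⟨a, ha.1, ha.2, fun v h1 h2 => hmin v ⟨h1, h2⟩⟩

theorem exists_max_right (z : V) (h : ∃ v, z < v ∧ G.Adj z v) :
    ∃ b, z < b ∧ G.Adj z b ∧ ∀ v, z < v → G.Adj z v → v ≤ b := by
  obtain ⟨b, hb, hmax⟩ :=
    Set.exists_max_image {v | z < v ∧ G.Adj z v} id (Set.toFinite _) h
  exact ⟨b, hb.1, hb.2, fun v h1 h2 => hmax v ⟨h1, h2⟩⟩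

theorem NonCrossing.min_left_mem_before (hnc : G.NonCrossing) {a z : V} (haz : G.Adj z a)
    (h : a < z) (hmin : ∀ v, v < z → G.Adj z v → a ≤ v) : a ∈ G.before z := by
  have := hnc.depth_le_of_min haz.symm h hmin
  simp only [before, Set.mem_ofPred_eq, h, and_true]
  omega

/-- A reached left neighbor of `z` is its leftmost neighbor. -/
theorem NonCrossing.le_of_left (hnc : G.NonCrossing) (htf : G.NoTriangle) {v v' z : V}
    (hv : v < z) (hzv : G.Adj z v) (hvD : v ∈ G.closedNhd (G.before z))
    (hzv' : G.Adj z v') : v ≤ v' ∨ z < v' := by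
  by_contra! h
  rcases hnc.of_mem_closedNhd hzv'.symm h.1 hv (Or.inr le_rfl) hvD with ⟨h1, _⟩ | ⟨_, h1⟩
  · exact htf z v' v hzv' h1 hzv
  · exact not_mem_before_self z h1

/-- A reached right neighbor of `z` is its rightmost neighbor. -/
theorem NonCrossing.le_of_right (hnc : G.NonCrossing) (htf : G.NoTriangle) {v v' z : V}
    (hv : z < v) (hzv : G.Adj z v) (hvD : v ∈ G.closedNhd (G.before z))
    (hzv' : G.Adj z v') : v' ≤ v := by
  by_contra! h
  rcases hnc.of_mem_closedNhd hzv' hv h (Or.inl le_rfl) hvD with ⟨_, h1⟩ | ⟨h1, _⟩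
  · exact not_mem_before_self z h1
  · exact htf z v' v hzv' h1 hzv

/-- A vertex `y` as deep as `z` that is not reached from the vertices before `z` has at most two
reached vertices within distance two to its right. -/
theorem NonCrossing.exists_right_near (hnc : G.NonCrossing) (htf : G.NoTriangle) {y z : V}
    (hy : y ∉ G.closedNhd (G.before z)) (hyz : G.depth y = G.depth z) :
    ∃ U : Finset V, U.card ≤ 2 ∧ ∀ u ∈ G.closedNhd (G.before z), u ≠ y →
      (G.Adj y u ∧ y < u ∨ ∃ w, G.Adj y w ∧ y < w ∧ G.Adj w u) → u ∈ U := by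
  classical
  have hyP : y ∉ G.before z := fun h => hy (Or.inl h)
  by_cases hw : ∃ v, y < v ∧ G.Adj y v
  swap
  · refine ⟨∅, by simp, ?_⟩
    rintro u - - (⟨h1, h2⟩ | ⟨w, h1, h2, -⟩)
    · exact absurd ⟨u, h2, h1⟩ hw
    · exact absurd ⟨w, h2, h1⟩ hw
  obtain ⟨b, hyb, hb, hmax⟩ := exists_max_right y hw
  have hbP : b ∉ G.before z := fun h => hy (Or.inr ⟨b, h, hb.symm⟩)
  have hbz : G.depth b = G.depth z := by
    have h1 := hnc.depth_le_of_max hb hyb hmax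
    simp only [before, Set.mem_ofPred_eq] at hbP
    omega
  have under : ∀ u, y < u → u < b → u ∉ G.closedNhd (G.before z) := by
    intro u h1 h2 hu
    rcases hnc.of_mem_closedNhd hb h1 h2 (Or.inl hyz.ge) hu with ⟨_, h⟩ | ⟨_, h⟩
    · exact hyP h
    · exact hbP h
  have beyond : ∀ u u', u ∈ G.closedNhd (G.before z) → G.Adj b u → b < u → G.Adj b u' →
      u' ≤ u := by
    intro u u' hu hbu hlt hbu'
    by_contra! h
    rcases hnc.of_mem_closedNhd hbu' hlt h (Or.inl hbz.ge) hu with ⟨_, h1⟩ | ⟨h1, _⟩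
    · exact hbP h1
    · exact htf b u' u hbu' h1 hbu
  have key : ∀ u ∈ G.closedNhd (G.before z), u ≠ y →
      (G.Adj y u ∧ y < u ∨ ∃ w, G.Adj y w ∧ y < w ∧ G.Adj w u) → u = b ∨ b < u ∧ G.Adj b u := by
    rintro u hu huy (⟨h1, h2⟩ | ⟨w, h1, h2, h3⟩)
    · rcases (hmax u h2 h1).lt_or_eq with h | h
      · exact absurd hu (under u h2 h)
      · exact Or.inl h
    · rcases (hmax w h2 h1).lt_or_eq with h | rfl
      · obtain ⟨h4, h5⟩ := hnc.mem_Icc hb h2 h h3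
        rcases h5.lt_or_eq with h5 | h5
        · exact absurd hu (under u (lt_of_le_of_ne h4 huy.symm) h5)
        · exact Or.inl h5
      · rcases lt_trichotomy u w with h | rfl | h
        · exfalso
          rcases lt_or_gt_of_ne huy with h4 | h4
          · have := hnc.depth_lt h3.symm h4 h2
            omega
          · exact under u h4 h hu
        · exact Or.inl rfl
        · exact Or.inr ⟨h, h3⟩
  by_cases hx : ∃ x ∈ G.closedNhd (G.before z), b < x ∧ G.Adj b x
  · obtain ⟨x, hxD, hbx, hx⟩ := hx
    refine ⟨{b, x}, Finset.card_le_two, fun u hu huy h => ?_⟩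
    rcases key u hu huy h with h | ⟨h, h'⟩
    · simp [h]
    · simp [le_antisymm (beyond x u hxD hx hbx h') (beyond u x hu h' h hx)]
  · refine ⟨{b}, by simp, fun u hu huy h => ?_⟩
    rcases key u hu huy h with h | ⟨h, h'⟩
    · simp [h]
    · exact absurd ⟨u, hu, h, h'⟩ hx

/-- A vertex not reached from the vertices before it has at most two reached vertices within
distance two. -/
theorem NonCrossing.exists_near (hnc : G.NonCrossing) (htf : G.NoTriangle) {z : V}
    (hz : z ∉ G.closedNhd (G.before z)) :
    ∃ U : Finset V, U.card ≤ 2 ∧ ∀ u ∈ G.closedNhd (G.before z), G.Near z u → u ∈ U := by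
  have hr : ∀ v, G.Adj z v → z < v := by
    intro v hv
    by_contra! h
    obtain ⟨a, ha, haz, hmin⟩ := exists_min_left z ⟨v, lt_of_le_of_ne h hv.ne', hv⟩
    exact hz (Or.inr ⟨a, hnc.min_left_mem_before haz ha hmin, haz.symm⟩)
  obtain ⟨U, hU, h⟩ := hnc.exists_right_near htf hz rfl
  refine ⟨U, hU, fun u hu hn => h u hu (fun he => hz (he ▸ hu)) ?_⟩
  rcases hn with hn | ⟨w, h1, h2⟩
  · exact Or.inl ⟨hn, hr u hn⟩
  · exact Or.inr ⟨w, h1, hr w h1, h2⟩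

/-- The pairs `(v, u)` consisting of a neighbor `v` of `z` not reached from the vertices before
`z`, and a reached vertex `u` within distance two of `v` that is not in the closed neighborhood
of `z`. -/
def conflict (G : SimpleGraph V) (z v u : V) : Prop :=
  G.Adj z v ∧ v ∉ G.closedNhd (G.before z) ∧ u ∈ G.closedNhd (G.before z) ∧ u ≠ z ∧
    ¬G.Adj z u ∧ G.Near u v

theorem NonCrossing.conflict_left (hnc : G.NonCrossing) (htf : G.NoTriangle) (z : V) :
    ∃ v₁ u₁, ∀ v u, G.conflict z v u → v < z → v = v₁ ∧ u = u₁ := by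
  by_cases hex : ∃ v u, G.conflict z v u ∧ v < z
  swap
  · exact ⟨z, z, fun v u h h' => absurd ⟨v, u, h, h'⟩ hex⟩
  obtain ⟨v₁, u₁, h₁, h₁z⟩ := hex
  obtain ⟨a, ha, haz, hmin⟩ := exists_min_left z ⟨v₁, h₁z, h₁.1⟩
  have haP := hnc.min_left_mem_before haz ha hmin
  have key : ∀ v u, G.conflict z v u → v < z → a < v ∧ a < u ∧ u < z ∧ G.Adj a u := by
    rintro v u ⟨hzv, hv, hu, huz, hzu, hn⟩ hvz
    have hav : a < v := by
      refine lt_of_le_of_ne (hmin v hvz hzv) ?_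
      rintro rfl
      exact hv (Or.inl haP)
    have hua : u ≠ a := fun h => hzu (h ▸ haz)
    have hi : a < u ∧ u < z := by
      rcases hn.symm with hn | ⟨w, h1, h2⟩
      · obtain ⟨h3, h4⟩ := hnc.mem_Icc haz.symm hav hvz hn
        exact ⟨lt_of_le_of_ne h3 hua.symm, lt_of_le_of_ne h4 huz⟩
      · obtain ⟨h3, h4⟩ := hnc.mem_Icc haz.symm hav hvz h1
        have hwa : a ≠ w := fun h => htf z a v haz (h ▸ h1.symm) hzv
        have hwz : w ≠ z := fun h => hzu (h ▸ h2)
        obtain ⟨h5, h6⟩ := hnc.mem_Icc haz.symm (lt_of_le_of_ne h3 hwa)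
          (lt_of_le_of_ne h4 hwz) h2
        exact ⟨lt_of_le_of_ne h5 hua.symm, lt_of_le_of_ne h6 huz⟩
    refine ⟨hav, hi.1, hi.2, ?_⟩
    rcases hnc.of_mem_closedNhd haz.symm hi.1 hi.2 (Or.inr le_rfl) hu with ⟨h, _⟩ | ⟨_, h⟩
    · exact h
    · exact absurd h (not_mem_before_self z)
  refine ⟨v₁, u₁, fun v u h hvz => ?_⟩
  obtain ⟨a1, a2, a3, a4⟩ := key v u h hvz
  obtain ⟨b1, b2, b3, b4⟩ := key v₁ u₁ h₁ h₁z
  exact (hnc.eq_of_near htf haz.symm a2 a3 a1 hvz b2 b3 b1 h₁z a4 b4 h.1 h₁.1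
    h.2.2.2.2.2 h₁.2.2.2.2.2).symm

theorem NonCrossing.conflict_right (hnc : G.NonCrossing) (htf : G.NoTriangle) (z : V) :
    ∃ v₂, ∃ U : Finset V, (∀ v u, G.conflict z v u → z < v → v = v₂ ∧ u ∈ U) ∧ U.card ≤ 2 ∧
      ((∃ v ∈ G.closedNhd (G.before z), z < v ∧ G.Adj z v) → U.card ≤ 1) := by
  classical
  by_cases hex : ∃ v, z < v ∧ G.Adj z v
  swap
  · exact ⟨z, ∅, fun v u h h' => absurd ⟨v, h', h.1⟩ hex, by simp, by simp⟩
  obtain ⟨b, hzb, hb, hmax⟩ := exists_max_right z hex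
  have key : ∀ v u, G.conflict z v u → z < v → v < b →
      z < u ∧ u < b ∧ G.Adj b u ∧ b ∈ G.before z := by
    rintro v u ⟨hzv, hv, hu, huz, hzu, hn⟩ hzv' hvb
    have hub : u ≠ b := fun h => hzu (h ▸ hb)
    have hi : z < u ∧ u < b := by
      rcases hn.symm with hn | ⟨w, h1, h2⟩
      · obtain ⟨h3, h4⟩ := hnc.mem_Icc hb hzv' hvb hn
        exact ⟨lt_of_le_of_ne h3 huz.symm, lt_of_le_of_ne h4 hub⟩
      · obtain ⟨h3, h4⟩ := hnc.mem_Icc hb hzv' hvb h1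
        have hwb : w ≠ b := fun h => htf z b v hb (h ▸ h1.symm) hzv
        have hwz : z ≠ w := fun h => hzu (h ▸ h2)
        obtain ⟨h5, h6⟩ := hnc.mem_Icc hb (lt_of_le_of_ne h3 hwz) (lt_of_le_of_ne h4 hwb) h2
        exact ⟨lt_of_le_of_ne h5 huz.symm, lt_of_le_of_ne h6 hub⟩
    rcases hnc.of_mem_closedNhd hb hi.1 hi.2 (Or.inl le_rfl) hu with ⟨_, h⟩ | ⟨h, h'⟩
    · exact absurd h (not_mem_before_self z)
    · exact ⟨hi.1, hi.2, h, h'⟩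
  by_cases hbD : b ∈ G.closedNhd (G.before z)
  · have hlt : ∀ v u, G.conflict z v u → z < v → v < b := by
      intro v u h hv
      refine lt_of_le_of_ne (hmax v hv h.1) ?_
      rintro rfl
      exact h.2.1 hbD
    by_cases hex : ∃ v u, G.conflict z v u ∧ z < v
    swap
    · exact ⟨z, ∅, fun v u h h' => absurd ⟨v, u, h, h'⟩ hex, by simp, by simp⟩
    obtain ⟨v₁, u₁, h₁, h₁z⟩ := hex
    refine ⟨v₁, {u₁}, fun v u h hvz => ?_, by simp, by simp⟩
    have hvb := hlt v u h hvz
    have h₁b := hlt v₁ u₁ h₁ h₁z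
    obtain ⟨a1, a2, a3, a4⟩ := key v u h hvz hvb
    obtain ⟨b1, b2, b3, b4⟩ := key v₁ u₁ h₁ h₁z h₁b
    simpa using hnc.eq_of_near htf hb hvz hvb a1 a2 h₁z h₁b b1 b2 h.1 h₁.1 a3 b3
      h.2.2.2.2.2.symm h₁.2.2.2.2.2.symm
  · have hbP : b ∉ G.before z := fun h => hbD (Or.inl h)
    have hbz : G.depth b = G.depth z := by
      have h1 := hnc.depth_le_of_max hb hzb hmax
      simp only [before, Set.mem_ofPred_eq] at hbP
      omega
    obtain ⟨U, hU, hmem⟩ := hnc.exists_right_near htf hbD hbz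
    refine ⟨b, U, fun v u h hv => ?_, hU, ?_⟩
    · have hvb : v = b := by
        rcases (hmax v hv h.1).lt_or_eq with hlt | heq
        · exact absurd (key v u h hv hlt).2.2.2 hbP
        · exact heq
      subst hvb
      refine ⟨rfl, ?_⟩
      obtain ⟨-, -, hu, huz, hzu, hn⟩ := h
      have huv : u ≠ v := fun h => hbD (h ▸ hu)
      have left : ∀ w, G.Adj v w → w < v → w ≠ z → z < w := by
        intro w hvw hwv hwz
        by_contra! hle
        have h1 := hnc.depth_lt hvw.symm (lt_of_le_of_ne hle hwz) hv
        exact hbD (Or.inr ⟨w, Or.inl h1.1, hvw.symm⟩)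
      have under : ¬(z < u ∧ u < v) := by
        rintro ⟨h1, h2⟩
        rcases hnc.of_mem_closedNhd hb h1 h2 (Or.inl le_rfl) hu with ⟨_, h⟩ | ⟨_, h⟩
        · exact not_mem_before_self z h
        · exact hbP h
      refine hmem u hu huv ?_
      rcases hn.symm with hn | ⟨w, h1, h2⟩
      · refine Or.inl ⟨hn, ?_⟩
        by_contra! hle
        have hlt := lt_of_le_of_ne hle huv
        exact under ⟨left u hn hlt huz, hlt⟩
      · refine Or.inr ⟨w, h1, ?_, h2⟩
        by_contra! hle
        have hlt := lt_of_le_of_ne hle h1.ne'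
        have hzw : w ≠ z := fun h => hzu (h ▸ h2)
        obtain ⟨h3, h4⟩ := hnc.mem_Icc hb (left w h1 hlt hzw) hlt h2
        exact under ⟨lt_of_le_of_ne h3 huz.symm, lt_of_le_of_ne h4 huv⟩
    · rintro ⟨v, hvD, hzv, hv⟩
      have := hnc.le_of_right htf hzv hv hvD hb
      exact absurd (le_antisymm this (hmax v hzv hv) ▸ hvD) hbD

end Combinatorics

section Coloring

/-- `p` properly colors the square of the graph on the closed neighborhood of `P`, while `c` is
proper on `P` and avoids the colors that `p` uses on closed neighborhoods. The color `p u` stands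
for the common color of the second incidences of `u`. -/
structure IsPartialColoring (G : SimpleGraph V) {k : ℕ} (P : Set V) (p c : V → Fin k) : Prop where
  near_ne : ∀ u ∈ G.closedNhd P, ∀ v ∈ G.closedNhd P, u ≠ v → G.Near u v → p u ≠ p v
  self_ne : ∀ q ∈ P, c q ≠ p q
  nhd_ne : ∀ q ∈ P, ∀ v, G.Adj q v → c q ≠ p v
  adj_ne : ∀ q ∈ P, ∀ r ∈ P, G.Adj q r → c q ≠ c r

variable {G : SimpleGraph V} {k : ℕ}

theorem IsPartialColoring.congr {P : Set V} {p p' c : V → Fin k}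
    (h : G.IsPartialColoring P p c) (hp : ∀ v ∈ G.closedNhd P, p' v = p v) :
    G.IsPartialColoring P p' c where
  near_ne u hu v hv huv hn := by
    rw [hp u hu, hp v hv]
    exact h.near_ne u hu v hv huv hn
  self_ne q hq := by
    rw [hp q (Or.inl hq)]
    exact h.self_ne q hq
  nhd_ne q hq v hv := by
    rw [hp v (Or.inr ⟨q, hq, hv⟩)]
    exact h.nhd_ne q hq v hv
  adj_ne := h.adj_ne

theorem IsPartialColoring.extend [DecidableEq V] {P : Set V} {p c : V → Fin k}
    (h : G.IsPartialColoring P p c) {z : V} (hz : z ∉ P)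
    (hpz : ∀ u ∈ G.closedNhd P, u ≠ z → G.Near z u → p z ≠ p u)
    {a : Fin k} (ha : a ≠ p z) (haD : ∀ v ∈ G.closedNhd P, G.Adj z v → a ≠ p v)
    (haP : ∀ v ∈ P, G.Adj z v → a ≠ c v)
    (M : Finset V) (hM : ∀ v, v ∈ M ↔ G.Adj z v ∧ v ∉ G.closedNhd P) (g : V → Fin k)
    (hga : ∀ v ∈ M, g v ≠ a) (hgz : ∀ v ∈ M, g v ≠ p z)
    (hgD : ∀ v ∈ M, ∀ u ∈ G.closedNhd P, G.Adj z u → g v ≠ p u)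
    (hinj : Set.InjOn g M)
    (hconf : ∀ v ∈ M, ∀ u ∈ G.closedNhd P, u ≠ z → ¬G.Adj z u → G.Near u v → g v ≠ p u) :
    G.IsPartialColoring (insert z P) (fun v => if v ∈ M then g v else p v)
      (Function.update c z a) := by
  have hD : ∀ v ∈ G.closedNhd (insert z P), v ∈ M ∨ v ∉ M ∧ (v = z ∨ v ∈ G.closedNhd P) := by
    rintro v (hv | ⟨q, hq, hqv⟩)
    · rcases hv with rfl | hv
      · exact Or.inr ⟨fun hm => ((hM v).1 hm).1.ne rfl, Or.inl rfl⟩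
      · exact Or.inr ⟨fun hm => ((hM v).1 hm).2 (Or.inl hv), Or.inr (Or.inl hv)⟩
    · by_cases hvD : v ∈ G.closedNhd P
      · exact Or.inr ⟨fun hm => ((hM v).1 hm).2 hvD, Or.inr hvD⟩
      · rcases hq with rfl | hq
        · exact Or.inl ((hM v).2 ⟨hqv, hvD⟩)
        · exact absurd (Or.inr ⟨q, hq, hqv⟩) hvD
  have hzM : z ∉ M := fun hm => ((hM z).1 hm).1.ne rfl
  have hDM : ∀ v ∈ G.closedNhd P, v ∉ M := fun v hv hm => ((hM v).1 hm).2 hv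
  have mixed : ∀ u v, u ∈ M → (v = z ∨ v ∈ G.closedNhd P) → G.Near v u → g u ≠ p v := by
    intro u v hu hv hn
    by_cases hvz : v = z
    · exact hvz ▸ hgz u hu
    · replace hv := hv.resolve_left hvz
      by_cases hzv : G.Adj z v
      · exact hgD u hu v hv hzv
      · exact hconf u hu v hv hvz hzv hn
  refine ⟨?_, ?_, ?_, ?_⟩
  · intro u hu v hv huv hn
    rcases hD u hu with hu | ⟨huM, hu⟩ <;> rcases hD v hv with hv | ⟨hvM, hv⟩
    · simp only [hu, hv, if_true]
      exact fun he => huv (hinj hu hv he)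
    · simp only [hu, hvM, if_true, if_false]
      exact mixed u v hu hv hn.symm
    · simp only [huM, hv, if_true, if_false]
      exact (mixed v u hv hu hn).symm
    · simp only [huM, hvM, if_false]
      by_cases huz : u = z
      · subst huz
        exact hpz v (hv.resolve_left huv.symm) huv.symm hn
      · have huP := hu.resolve_left huz
        by_cases hvz : v = z
        · subst hvz
          exact (hpz u huP huv hn.symm).symm
        · exact h.near_ne u huP v (hv.resolve_left hvz) huv hn
  · rintro q (rfl | hq)
    · simpa [hzM] using ha
    · have hqz : q ≠ z := fun he => hz (he ▸ hq)
      simpa [hqz, hDM q (Or.inl hq)] using h.self_ne q hq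
  · rintro q (rfl | hq) v hv
    · by_cases hvM : v ∈ M
      · simpa [hvM] using (hga v hvM).symm
      · simp only [hvM, Function.update_self, if_false]
        exact haD v (by_contra fun hvD => hvM ((hM v).2 ⟨hv, hvD⟩)) hv
    · have hqz : q ≠ z := fun he => hz (he ▸ hq)
      simpa [hqz, hDM v (Or.inr ⟨q, hq, hv⟩)] using h.nhd_ne q hq v hv
  · rintro q (rfl | hq) r (rfl | hr) hqr
    · exact absurd rfl hqr.ne
    · have : r ≠ q := hqr.ne'
      simpa [this] using haP r hr hqr
    · have : q ≠ r := hqr.ne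
      simpa [this] using (haP q hq hqr.symm).symm
    · have h1 : q ≠ z := fun he => hz (he ▸ hq)
      have h2 : r ≠ z := fun he => hz (he ▸ hr)
      simpa [h1, h2] using h.adj_ne q hq r hr hqr

variable [LinearOrder V] [Fintype V]

open Classical in
theorem NonCrossing.card_filter_le (hnc : G.NonCrossing) (htf : G.NoTriangle) (z : V) :
    (Finset.univ.filter fun v => G.Adj z v ∧ v ∈ G.closedNhd (G.before z)).card ≤ 2 ∧
    ((Finset.univ.filter fun v => G.Adj z v ∧ v ∈ G.closedNhd (G.before z)).card ≤ 1 ∨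
      ∃ v ∈ G.closedNhd (G.before z), z < v ∧ G.Adj z v) := by
  set S := Finset.univ.filter fun v => G.Adj z v ∧ v ∈ G.closedNhd (G.before z) with hS
  have hmem : ∀ v, v ∈ S ↔ G.Adj z v ∧ v ∈ G.closedNhd (G.before z) := by simp [hS]
  have hl : (S.filter (· < z)).card ≤ 1 := by
    refine Finset.card_le_one.2 fun u hu v hv => ?_
    simp only [Finset.mem_filter, hmem] at hu hv
    exact le_antisymm
      ((hnc.le_of_left htf hu.2 hu.1.1 hu.1.2 hv.1.1).resolve_right (not_lt.2 hv.2.le))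
      ((hnc.le_of_left htf hv.2 hv.1.1 hv.1.2 hu.1.1).resolve_right (not_lt.2 hu.2.le))
  have hr : (S.filter (¬ · < z)).card ≤ 1 := by
    refine Finset.card_le_one.2 fun u hu v hv => ?_
    simp only [Finset.mem_filter, hmem, not_lt] at hu hv
    exact le_antisymm
      (hnc.le_of_right htf (lt_of_le_of_ne hv.2 hv.1.1.ne) hv.1.1 hv.1.2 hu.1.1)
      (hnc.le_of_right htf (lt_of_le_of_ne hu.2 hu.1.1.ne) hu.1.1 hu.1.2 hv.1.1)
  have hsum := Finset.card_filter_add_card_filter_not (s := S) (· < z)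
  refine ⟨by omega, ?_⟩
  rcases (S.filter (¬ · < z)).eq_empty_or_nonempty with he | ⟨v, hv⟩
  · rw [he, Finset.card_empty] at hsum
    exact Or.inl (by omega)
  · simp only [Finset.mem_filter, hmem, not_lt] at hv
    exact Or.inr ⟨v, hv.1.2, lt_of_le_of_ne hv.2 hv.1.1.ne, hv.1.1⟩

theorem IsPartialColoring.exists_insert (hnc : G.NonCrossing) (htf : G.NoTriangle) (hk : 7 ≤ k)
    (z : V) (hdeg : (G.neighborSet z).ncard + 2 ≤ k) {p c : V → Fin k}
    (h : G.IsPartialColoring (G.before z) p c) :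
    ∃ p' c' : V → Fin k, G.IsPartialColoring (insert z (G.before z)) p' c' := by
  classical
  have : Nonempty (Fin k) := ⟨⟨0, by omega⟩⟩
  obtain ⟨p, h, hpz⟩ : ∃ p : V → Fin k, G.IsPartialColoring (G.before z) p c ∧
      ∀ u ∈ G.closedNhd (G.before z), u ≠ z → G.Near z u → p z ≠ p u := by
    by_cases hz : z ∈ G.closedNhd (G.before z)
    · exact ⟨p, h, fun u hu huz hn => h.near_ne z hz u hu huz.symm hn⟩
    · obtain ⟨U, hU, hmem⟩ := hnc.exists_near htf hz
      obtain ⟨x, -, hx⟩ := Finset.exists_mem_notMem_of_card_lt_card (s := U.image p)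
        (t := Finset.univ) (by
          have := Finset.card_image_le (s := U) (f := p)
          rw [Finset.card_univ, Fintype.card_fin]
          omega)
      refine ⟨Function.update p z x, h.congr fun v hv => ?_, fun u hu huz hn he => ?_⟩
      · rw [Function.update_of_ne]
        rintro rfl
        exact hz hv
      · rw [Function.update_self, Function.update_of_ne huz] at he
        exact hx (he ▸ Finset.mem_image_of_mem p (hmem u hu hn))
  obtain ⟨v₁, u₁, hleft⟩ := hnc.conflict_left htf z
  obtain ⟨v₂, U, hright, hU, hU'⟩ := hnc.conflict_right htf z
  obtain ⟨hS₂, hS₁⟩ := hnc.card_filter_le htf z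
  set S := Finset.univ.filter fun v => G.Adj z v ∧ v ∈ G.closedNhd (G.before z) with hS
  set M := Finset.univ.filter fun v => G.Adj z v ∧ v ∉ G.closedNhd (G.before z) with hM
  have hSU : S.card + U.card ≤ 3 := by
    rcases hS₁ with hS₁ | hS₁
    · omega
    · have := hU' hS₁
      omega
  have hSM : S.card + M.card + 2 ≤ k := by
    have hN : (G.neighborSet z).ncard = (Finset.univ.filter fun v => G.Adj z v).card := by
      rw [← Set.ncard_coe_finset]
      congr 1
      ext v
      simp
    have := Finset.card_filter_add_card_filter_not (s := Finset.univ.filter fun v => G.Adj z v)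
      (fun v => v ∈ G.closedNhd (G.before z))
    rw [Finset.filter_filter, Finset.filter_filter, ← hN] at this
    have : S.card + M.card = (G.neighborSet z).ncard := by convert this
    omega
  set L : Finset (Fin k) := (insert (p z) (S.image p))ᶜ with hL
  have hLcard : k ≤ L.card + S.card + 1 := by
    rw [hL, Finset.card_compl, Fintype.card_fin]
    have h1 := Finset.card_insert_le (p z) (S.image p)
    have h2 := Finset.card_image_le (s := S) (f := p)
    omega
  have hLz : ∀ x ∈ L, x ≠ p z := by
    intro x hx he
    simp [hL, he] at hx
  have hLS : ∀ x ∈ L, ∀ v ∈ G.closedNhd (G.before z), G.Adj z v → x ≠ p v := by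
    intro x hx v hv hzv he
    rw [hL, Finset.mem_compl] at hx
    exact hx (he ▸ Finset.mem_insert_of_mem (Finset.mem_image_of_mem p (by simp [hS, hzv, hv])))
  obtain ⟨a, haL, haS⟩ := Finset.exists_mem_notMem_of_card_lt_card (s := S.image c) (t := L) (by
    have := Finset.card_image_le (s := S) (f := c)
    omega)
  have hLa := Finset.card_erase_of_mem haL
  obtain ⟨g, hg, hinj, hg₁, hg₂⟩ := Finset.exists_mem_and_injOn_and_ne_and_notMem M (L.erase a)
    (by omega) (by omega) v₁ v₂ (p u₁) (U.image p) (by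
      have := Finset.card_image_le (s := U) (f := p)
      omega)
  have hMmem : ∀ v, v ∈ M ↔ G.Adj z v ∧ v ∉ G.closedNhd (G.before z) := by simp [hM]
  refine ⟨_, _, h.extend (not_mem_before_self z) hpz (hLz a haL) (hLS a haL) ?_ M hMmem g
    (fun v hv => Finset.ne_of_mem_erase (hg v hv))
    (fun v hv => hLz _ (Finset.mem_of_mem_erase (hg v hv)))
    (fun v hv => hLS _ (Finset.mem_of_mem_erase (hg v hv))) hinj ?_⟩
  · intro v hv hzv he
    exact haS (he ▸ Finset.mem_image_of_mem c
      (Finset.mem_filter.2 ⟨Finset.mem_univ v, hzv, Or.inl hv⟩))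
  · intro v hv u hu huz hzu hn he
    obtain ⟨hzv, hvD⟩ := (hMmem v).1 hv
    have hconf : G.conflict z v u := ⟨hzv, hvD, hu, huz, hzu, hn⟩
    rcases lt_or_gt_of_ne hzv.ne' with hlt | hgt
    · obtain ⟨rfl, rfl⟩ := hleft v u hconf hlt
      exact hg₁ hv he
    · obtain ⟨rfl, hmem⟩ := hright v u hconf hgt
      exact hg₂ hv (he ▸ Finset.mem_image_of_mem p hmem)

theorem NonCrossing.exists_isPartialColoring_univ (hnc : G.NonCrossing) (htf : G.NoTriangle)
    (hk : 7 ≤ k) (hdeg : ∀ z, (G.neighborSet z).ncard + 2 ≤ k) :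
    ∃ p c : V → Fin k, G.IsPartialColoring Set.univ p c := by
  classical
  have initial : ∀ n ≤ Fintype.card V, ∃ P : Finset V, P.card = n ∧
      (∀ u ∈ P, G.before u ⊆ P) ∧ ∃ p c : V → Fin k, G.IsPartialColoring P p c := by
    intro n
    induction n with
    | zero =>
      intro _
      refine ⟨∅, rfl, by simp, fun _ => ⟨0, by omega⟩, fun _ => ⟨0, by omega⟩, ?_⟩
      constructor <;> simp [closedNhd]
    | succ n ih =>
      intro hn
      obtain ⟨P, hP, hlow, p, c, h⟩ := ih (by omega)
      obtain ⟨y, -, hy⟩ := Finset.exists_mem_notMem_of_card_lt_card (s := P)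
        (t := Finset.univ) (by rw [Finset.card_univ]; omega)
      obtain ⟨z, hz, hmin⟩ := Pᶜ.exists_min_image (fun v => toLex (G.depth v, v))
        ⟨y, by simpa using hy⟩
      rw [Finset.mem_compl] at hz
      have hPz : (P : Set V) = G.before z := by
        ext u
        constructor
        · intro hu
          by_contra hn
          have hzu : z ∉ G.before u := fun hzu => hz (hlow u hu hzu)
          have hne : u ≠ z := fun he => hz (he ▸ hu)
          simp only [before, Set.mem_ofPred_eq] at hn hzu
          rcases lt_or_gt_of_ne hne with h1 | h1
          · simp only [h1, and_true] at hn
            omega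
          · simp only [h1, and_true] at hzu
            omega
        · intro hu
          by_contra hn
          have := hmin u (by simpa using hn)
          rw [Prod.Lex.toLex_le_toLex] at this
          simp only [before, Set.mem_ofPred_eq] at hu
          rcases this with h1 | ⟨h1, h2⟩
          · omega
          · rcases hu with h3 | ⟨-, h3⟩
            · omega
            · exact absurd h2 (not_le.2 h3)
      rw [hPz] at h
      obtain ⟨p', c', h'⟩ := IsPartialColoring.exists_insert hnc htf hk z (hdeg z) h
      refine ⟨insert z P, by rw [Finset.card_insert_of_notMem hz, hP], ?_, p', c', ?_⟩
      · intro u hu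
        rw [Finset.coe_insert]
        rcases Finset.mem_insert.1 hu with rfl | hu
        · exact hPz ▸ Set.subset_insert _ _
        · exact (hlow u hu).trans (Set.subset_insert _ _)
      · rwa [Finset.coe_insert, hPz]
  obtain ⟨P, hP, -, p, c, h⟩ := initial _ le_rfl
  rw [(Finset.card_eq_iff_eq_univ P).1 hP, Finset.coe_univ] at h
  exact ⟨p, c, h⟩

end Coloring

section ViColoring

variable {G : SimpleGraph V} {k : ℕ}

theorem noTriangle_of_four_le_egirth (hg : 4 ≤ G.egirth) : G.NoTriangle := by
  intro a b c hab hbc hac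
  have hcyc : (Walk.cons hab (Walk.cons hbc (Walk.cons hac.symm Walk.nil))).IsCycle := by
    simp [Walk.cons_isCycle_iff, Walk.cons_isPath_iff, hab.ne, hab.ne', hbc.ne, hac.ne, hac.ne']
  have := hg.trans (egirth_le_length hcyc)
  simp only [Walk.length_cons, Walk.length_nil] at this
  exact absurd this (by decide)

/-- The coloring of incidences in which `(v, {u, v})` has color `p u`. -/
noncomputable def incOfOther (p : V → Fin k) (v : V) (e : Sym2 V) : Fin k :=
  open Classical in if h : v ∈ e then p (Sym2.Mem.other h) else p v

theorem incOfOther_mk (p : V → Fin k) (u v : V) : incOfOther p v s(u, v) = p u := by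
  have h : v ∈ s(u, v) := Sym2.mem_mk_right u v
  have : Sym2.Mem.other h = u := by
    have := Sym2.other_spec h
    rw [Sym2.eq_swap] at this
    exact Sym2.congr_left.1 this
  rw [incOfOther, dif_pos h, this]

theorem IsIncidence.exists_eq {v : V} {e : Sym2 V} (h : G.IsIncidence v e) :
    ∃ u, G.Adj u v ∧ e = s(u, v) := by
  obtain ⟨u, rfl⟩ := Sym2.mem_iff_exists.1 h.2
  exact ⟨u, h.1.symm, Sym2.eq_swap⟩

theorem IsPartialColoring.isViColoring {p c : V → Fin k}
    (h : G.IsPartialColoring Set.univ p c) : G.IsViColoring k c (incOfOther p) := by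
  have hp : ∀ u v, u ≠ v → G.Near u v → p u ≠ p v := fun u v =>
    h.near_ne u (Or.inl trivial) v (Or.inl trivial)
  refine ⟨fun u v => h.adj_ne u trivial v trivial, ?_, ?_⟩
  · intro u w f hf hu
    obtain ⟨x, hxw, rfl⟩ := hf.exists_eq
    rw [incOfOther_mk]
    rcases Sym2.mem_iff.1 hu with rfl | rfl
    · exact h.self_ne u trivial
    · exact h.nhd_ne u trivial x hxw.symm
  · intro v e w f he hf hne hrel
    obtain ⟨x, hxv, rfl⟩ := he.exists_eq
    obtain ⟨y, hyw, rfl⟩ := hf.exists_eq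
    rw [incOfOther_mk, incOfOther_mk]
    rcases hrel with rfl | hrel | hrel | hrel
    · refine hp x y ?_ (Or.inr ⟨v, hxv, hyw.symm⟩)
      rintro rfl
      exact hne rfl
    · rcases Sym2.eq_iff.1 hrel with ⟨rfl, rfl⟩ | ⟨rfl, rfl⟩
      · exact absurd rfl hne
      · exact hp _ _ hxv.ne (Or.inl hxv)
    · rw [Sym2.eq_swap] at hrel
      obtain rfl := Sym2.congr_left.1 hrel
      exact hp _ _ hyw.ne' (Or.inl hyw.symm)
    · obtain rfl := Sym2.congr_left.1 hrel
      exact hp _ _ hxv.ne (Or.inl hxv)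

theorem secondIncColors_incOfOther_ncard_le (p : V → Fin k) (u : V) :
    (G.secondIncColors (incOfOther p) u).ncard ≤ 1 := by
  refine (Set.ncard_le_ncard (t := {p u}) ?_ (Set.toFinite _)).trans (Set.ncard_singleton _).le
  rintro a ⟨v, -, rfl⟩
  exact incOfOther_mk p u v

/-- At a vertex, the incidences, the vertex, and any second incidence have distinct colors. -/
theorem IsViColoring.ncard_neighborSet_add_two_le {cV : V → Fin k} {cI : V → Sym2 V → Fin k}
    [Finite V] (h : G.IsViColoring k cV cI) {u : V} (hu : (G.neighborSet u).Nonempty) :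
    (G.neighborSet u).ncard + 2 ≤ k := by
  classical
  obtain ⟨w, hw⟩ := hu
  have hw : G.Adj u w := hw
  have inc : ∀ v, G.Adj u v → G.IsIncidence u s(u, v) := fun v hv => ⟨hv, Sym2.mem_mk_left u v⟩
  have hinc : G.IsIncidence w s(u, w) := ⟨hw, Sym2.mem_mk_right u w⟩
  set T : Set (Fin k) := (fun v => cI u s(u, v)) '' G.neighborSet u with hT
  have hTcard : T.ncard = (G.neighborSet u).ncard := by
    refine Set.InjOn.ncard_image fun v hv v' hv' he => ?_
    by_contra hne
    refine h.inc_ne (inc v hv) (inc v' hv') ?_ (Or.inl rfl) he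
    exact fun hp => hne (Sym2.congr_right.1 (Prod.ext_iff.1 hp).2)
  have h1 : cI w s(u, w) ∉ T := by
    rintro ⟨v, hv, he⟩
    exact h.inc_ne (inc v hv) hinc (fun hp => hw.ne (Prod.ext_iff.1 hp).1)
      (Or.inr (Or.inr (Or.inr rfl))) he
  have h2 : cV u ∉ insert (cI w s(u, w)) T := by
    rintro (he | ⟨v, hv, he⟩)
    · exact h.vertex_inc_ne hinc (Sym2.mem_mk_left u w) he
    · exact h.vertex_inc_ne (inc v hv) (Sym2.mem_mk_left u v) he.symm
  have := Set.ncard_le_ncard (Set.subset_univ (insert (cV u) (insert (cI w s(u, w)) T)))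
  rw [Set.ncard_insert_of_notMem h2, Set.ncard_insert_of_notMem h1, hTcard, Set.ncard_univ,
    Nat.card_fin] at this
  omega

end ViColoring

end SimpleGraph

/-- If `G` is a finite outerplanar graph with `Δ(G) ≥ 5` and girth `g(G) ≥ 4`,
then `χ_{vi,1}(G) = Δ(G) + 2`. -/
theorem chiViS_one_eq_of_outerplanar' [Fintype V] (G : SimpleGraph V) (hG : G.Outerplanar)
    (hΔ : 5 ≤ G.maxDeg) (hg : 4 ≤ G.egirth) :
    G.chiViS 1 = G.maxDeg + 2 := by
  obtain ⟨r, hr⟩ := hG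
  have hdeg : ∀ v, (G.neighborSet v).ncard ≤ G.maxDeg := fun v =>
    Finset.le_sup (f := fun v => (G.neighborSet v).ncard) (Finset.mem_univ v)
  obtain ⟨p, c, h⟩ := NonCrossing.exists_isPartialColoring_univ (G := G) hr
    (noTriangle_of_four_le_egirth hg) (k := G.maxDeg + 2) (by omega)
    (fun v => by have := hdeg v; omega)
  have hmem : ∃ cV cI, G.IsViColoring (G.maxDeg + 2) cV cI ∧
      ∀ u, (G.secondIncColors cI u).ncard ≤ 1 :=
    ⟨c, incOfOther p, h.isViColoring, secondIncColors_incOfOther_ncard_le p⟩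
  refine le_antisymm (Nat.sInf_le hmem) (le_csInf ⟨_, hmem⟩ ?_)
  rintro k ⟨cV, cI, hc, -⟩
  have hne : (Finset.univ : Finset V).Nonempty := by
    by_contra hne
    rw [Finset.not_nonempty_iff_eq_empty] at hne
    simp [maxDeg, hne] at hΔ
  obtain ⟨u, -, hu⟩ := Finset.exists_mem_eq_sup _ hne fun v => (G.neighborSet v).ncard
  have hu : G.maxDeg = (G.neighborSet u).ncard := hu
  rw [hu]
  exact hc.ncard_neighborSet_add_two_le (Set.nonempty_of_ncard_ne_zero (by omega))
end

section
/- If G is a finite outerplanar graph with Δ(G) ≥ 2, then χ_{vi,2}(G) ≤ Δ(G) + 4. -/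
open SimpleGraph

variable {V : Type*}

namespace ViColoring

open Finset

lemma exists_notMem_of_card_lt {k : ℕ} (s : Finset (Fin k)) (h : s.card < k) : ∃ x, x ∉ s := by
  by_contra! hs
  have : s = univ := by ext x; simp [hs x]
  simp [this] at h

/-- A choice of colors for a new vertex `u` (color `g`), for its first incidences (`x`, `y`)
and its second incidences (`a`, `b`). Here `A` and `S` are the colors already used at a neighbor
of `u` on the neighbor and its first incidences, and on its second incidences, respectively;
`p` is the color of that neighbor; `B`, `T`, `q` play the same role for the other neighbor. -/
structure Choice {k : ℕ} (A B S T : Finset (Fin k)) (p q x y a b g : Fin k) : Prop where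
  x_notMem : x ∉ A
  y_notMem : y ∉ B
  x_card : (insert x S).card ≤ 2
  y_card : (insert y T).card ≤ 2
  a_notMem : a ∉ A ∪ S
  b_notMem : b ∉ B ∪ T
  x_ne_y : x ≠ y
  x_ne_a : x ≠ a
  x_ne_b : x ≠ b
  y_ne_a : y ≠ a
  y_ne_b : y ≠ b
  g_notMem : g ∉ ({p, q, x, y, a, b} : Finset (Fin k))

lemma exists_choice_of_three_le {d : ℕ} (hd : 3 ≤ d) {A B S T : Finset (Fin (d + 4))}
    (p q : Fin (d + 4)) (hA : A.card ≤ d) (hB : B.card ≤ d) (hS : S.card ≤ 2) (hT : T.card ≤ 2)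
    (hAS : Disjoint A S) (hBT : Disjoint B T) :
    ∃ x y a b g, Choice A B S T p q x y a b g := by
  have enlarge : ∀ {A S : Finset (Fin (d + 4))}, A.card ≤ d → S.card ≤ 2 → Disjoint A S →
      ∃ S', S ⊆ S' ∧ S' ⊆ Aᶜ ∧ S'.card = 2 := by
    intro A S hA hS hAS
    refine exists_subsuperset_card_eq (fun z hz => ?_) hS ?_
    · exact mem_compl.2 fun h => Finset.disjoint_left.1 hAS h hz
    · rw [card_compl, Fintype.card_fin]; omega
  obtain ⟨S', hSS, hSA, hS2⟩ := enlarge hA hS hAS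
  obtain ⟨T', hTT, hTB, hT2⟩ := enlarge hB hT hBT
  obtain ⟨x, hx⟩ : S'.Nonempty := card_pos.1 (by omega)
  obtain ⟨y, hy, hyx⟩ := exists_mem_ne (by omega : 1 < T'.card) x
  obtain ⟨a, ha⟩ := exists_notMem_of_card_lt (insert y (A ∪ S')) (by
    have := card_insert_le y (A ∪ S')
    have := card_union_le A S'
    omega)
  obtain ⟨b, hb⟩ := exists_notMem_of_card_lt (insert x (B ∪ T')) (by
    have := card_insert_le x (B ∪ T')
    have := card_union_le B T'
    omega)
  obtain ⟨g, hg⟩ := exists_notMem_of_card_lt ({p, q, x, y, a, b} : Finset (Fin (d + 4))) (by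
    have := card_le_six (a := p) (b := q) (c := x) (d := y) (e := a) (f := b)
    omega)
  simp only [mem_insert, mem_union, not_or] at ha hb
  exact ⟨x, y, a, b, g,
    { x_notMem := mem_compl.1 (hSA hx)
      y_notMem := mem_compl.1 (hTB hy)
      x_card := hS2 ▸ card_le_card (insert_subset hx hSS)
      y_card := hT2 ▸ card_le_card (insert_subset hy hTT)
      a_notMem := by rw [mem_union]; exact fun h => h.elim ha.2.1 fun h => ha.2.2 (hSS h)
      b_notMem := by rw [mem_union]; exact fun h => h.elim hb.2.1 fun h => hb.2.2 (hTT h)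
      x_ne_y := hyx.symm
      x_ne_a := fun h => ha.2.2 (h ▸ hx)
      x_ne_b := fun h => hb.1 h.symm
      y_ne_a := fun h => ha.1 h.symm
      y_ne_b := fun h => hb.2.2 (h ▸ hy)
      g_notMem := hg }⟩

lemma exists_choice_two {A B S T : Finset (Fin 6)} {p q : Fin 6} (hA : A.card ≤ 2)
    (hB : B.card ≤ 2) (hS : S.card ≤ 1) (hT : T.card ≤ 1) (hp : p ∈ A) (hq : q ∈ B) :
    ∃ x y a b g, Choice A B S T p q x y a b g := by
  have hAS := card_union_le A S
  have hBT := card_union_le B T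
  have insert_card : ∀ {S : Finset (Fin 6)} (x), S.card ≤ 1 → (insert x S).card ≤ 2 := by
    intro S x hS
    have := card_insert_le x S
    omega
  by_cases h : ∃ a, a ∉ (A ∪ S) ∪ (B ∪ T)
  · obtain ⟨a, ha⟩ := h
    obtain ⟨x, hx⟩ := exists_notMem_of_card_lt (insert a A) (by
      have := card_insert_le a A
      omega)
    obtain ⟨y, hy⟩ := exists_notMem_of_card_lt (insert x (insert a B)) (by
      have := card_insert_le x (insert a B)
      have := card_insert_le a B
      omega)
    obtain ⟨g, hg⟩ := exists_notMem_of_card_lt ({p, q, x, y, a} : Finset (Fin 6)) (by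
      have := card_le_five (a := p) (b := q) (c := x) (d := y) (e := a)
      omega)
    refine ⟨x, y, a, a, g, ?_, ?_, insert_card x hS, insert_card y hT, ?_, ?_, ?_, ?_, ?_, ?_, ?_,
      ?_⟩ <;> grind
  · push Not at h
    have huniv : (A ∪ S) ∪ (B ∪ T) = univ := by ext z; simp only [h z, mem_univ]
    have hdisj : Disjoint (A ∪ S) (B ∪ T) := by
      rw [disjoint_iff_inter_eq_empty, ← card_eq_zero]
      have h1 := card_union_add_card_inter (A ∪ S) (B ∪ T)
      rw [huniv, card_univ, Fintype.card_fin] at h1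
      omega
    have hpB : p ∉ B ∪ T := Finset.disjoint_left.1 hdisj (mem_union_left _ hp)
    have hqA : q ∉ A ∪ S := Finset.disjoint_right.1 hdisj (mem_union_left _ hq)
    obtain ⟨a, ha⟩ := exists_notMem_of_card_lt (insert q (A ∪ S)) (by
      have := card_insert_le q (A ∪ S)
      omega)
    obtain ⟨b, hb⟩ := exists_notMem_of_card_lt (insert p (B ∪ T)) (by
      have := card_insert_le p (B ∪ T)
      omega)
    obtain ⟨g, hg⟩ := exists_notMem_of_card_lt ({p, q, a, b} : Finset (Fin 6)) (by
      have := card_le_four (a := p) (b := q) (c := a) (d := b)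
      omega)
    refine ⟨q, p, a, b, g, ?_, ?_, insert_card q hS, insert_card p hT, ?_, ?_, ?_, ?_, ?_, ?_, ?_,
      ?_⟩ <;> grind

lemma exists_choice {d : ℕ} (hd : 2 ≤ d) {A B S T : Finset (Fin (d + 4))}
    {p q : Fin (d + 4)} (hA : A.card ≤ d) (hB : B.card ≤ d) (hS : S.card ≤ 2) (hT : T.card ≤ 2)
    (hSd : S.card + 1 ≤ d) (hTd : T.card + 1 ≤ d)
    (hAS : Disjoint A S) (hBT : Disjoint B T) (hp : p ∈ A) (hq : q ∈ B) :
    ∃ x y a b g, Choice A B S T p q x y a b g := by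
  obtain rfl | h := hd.eq_or_lt
  · exact exists_choice_two hA hB (by omega) (by omega) hp hq
  · exact exists_choice_of_three_le h p q hA hB hS hT hAS hBT

lemma exists_adj_subset_pair_of_noncrossing [LinearOrder V] {G : SimpleGraph V}
    (hG : ∀ a b c d : V, G.Adj a b → G.Adj c d → ¬(a < c ∧ c < b ∧ b < d)) (s : Finset V)
    (hs : s.Nonempty) : ∃ u ∈ s, ∃ v w, ∀ z ∈ s, G.Adj u z → z = v ∨ z = w := by
  classical
  let between : V × V → Finset V := fun e => s.filter fun z => e.1 < z ∧ z < e.2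
  let long : Finset (V × V) := (s ×ˢ s).filter fun e => G.Adj e.1 e.2 ∧ (between e).Nonempty
  by_cases hL : long.Nonempty
  · obtain ⟨⟨a, b⟩, hab, hmin⟩ := exists_min_image long (fun e => (between e).card) hL
    simp only [long, mem_filter, mem_product] at hab
    obtain ⟨⟨ha, hb⟩, hadj, hne⟩ := hab
    have hu := min'_mem _ hne
    have hule : ∀ z ∈ between (a, b), (between (a, b)).min' hne ≤ z := fun z hz => min'_le _ z hz
    generalize (between (a, b)).min' hne = u at hu hule
    simp only [between, mem_filter] at hu hule
    obtain ⟨hus, hau, hub⟩ := hu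
    have hmem : ∀ z ∈ s, G.Adj u z → z = a ∨ u < z ∧ z ≤ b := by
      intro z hz huz
      have haz : a ≤ z := not_lt.1 fun h => hG z u a b huz.symm hadj ⟨h, hau, hub⟩
      have hzb : z ≤ b := not_lt.1 fun h => hG a b u z hadj huz ⟨hau, hub, h⟩
      obtain h | h := haz.eq_or_lt
      · exact Or.inl h.symm
      · refine Or.inr ⟨lt_of_le_of_ne ?_ huz.ne, hzb⟩
        obtain rfl | h' := hzb.eq_or_lt
        · exact hub.le
        · exact hule z ⟨hz, h, h'⟩
    have huniq : ∀ z ∈ s, ∀ z' ∈ s, G.Adj u z → G.Adj u z' → u < z → z < z' → z' ≤ b → False := by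
      intro z hz z' hz' huz huz' h1 h2 h3
      have hm := hmin (u, z') (by
        simp only [long, mem_filter, mem_product]
        exact ⟨⟨hus, hz'⟩, huz', z, by simp [between, hz, h1, h2]⟩)
      refine absurd hm (not_le.2 (card_lt_card ?_))
      rw [ssubset_iff_of_subset]
      · exact ⟨u, by simp [between, hus, hau, hub], by simp [between]⟩
      · intro t
        simp only [between, mem_filter]
        exact fun ⟨h, h', h''⟩ => ⟨h, hau.trans h', h''.trans_le h3⟩
    by_cases hz : ∃ z ∈ s, G.Adj u z ∧ u < z ∧ z ≤ b
    · obtain ⟨w, hw, huw, h1, h2⟩ := hz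
      refine ⟨u, hus, a, w, fun z hz huz => (hmem z hz huz).imp_right fun h => ?_⟩
      rcases lt_trichotomy z w with h' | h' | h'
      · exact (huniq z hz w hw huz huw h.1 h' h2).elim
      · exact h'
      · exact (huniq w hw z hz huw huz h1 h' h.2).elim
    · refine ⟨u, hus, a, a, fun z hz' huz => Or.inl ((hmem z hz' huz).resolve_right fun h => ?_)⟩
      exact hz ⟨z, hz', huz, h⟩
  · have hm := min'_mem s hs
    have hle : ∀ z ∈ s, s.min' hs ≤ z := fun z hz => min'_le _ z hz
    generalize s.min' hs = m at hm hle
    have huniq : ∀ z ∈ s, ∀ z' ∈ s, G.Adj m z → G.Adj m z' → z < z' → False := by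
      intro z hz z' hz' h h' hlt
      refine hL ⟨(m, z'), ?_⟩
      simp only [long, mem_filter, mem_product]
      exact ⟨⟨hm, hz'⟩, h', z, by simp [between, hz, hlt, lt_of_le_of_ne (hle z hz) h.ne]⟩
    by_cases hz : ∃ z ∈ s, G.Adj m z
    · obtain ⟨w, hw, hmw⟩ := hz
      refine ⟨m, hm, w, w, fun z hz hmz => Or.inl ?_⟩
      rcases lt_trichotomy z w with h | h | h
      · exact (huniq z hz w hw hmz hmw h).elim
      · exact h
      · exact (huniq w hw z hz hmw hmz h).elim
    · exact ⟨m, hm, m, m, fun z hz' h => (hz ⟨z, hz', h⟩).elim⟩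

/-- Outerplanar graphs are 2-degenerate. -/
lemma exists_adj_subset_pair {G : SimpleGraph V} (hG : G.Outerplanar) (s : Finset V)
    (hs : s.Nonempty) : ∃ u ∈ s, ∃ v w, ∀ z ∈ s, G.Adj u z → z = v ∨ z = w := by
  obtain ⟨r, hr⟩ := hG
  exact exists_adj_subset_pair_of_noncrossing hr s hs

open Classical in
/-- The colors of the second incidences of `v` in the subgraph induced on `s`, where `o v w` is
the color of the incidence `(v, {v, w})`. -/
noncomputable def inColors (G : SimpleGraph V) (s : Finset V) {k : ℕ} (o : V → V → Fin k) (v : V) :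
    Finset (Fin k) :=
  (s.filter (G.Adj v)).image fun w => o w v

open Classical in
/-- The colors of `v` and of its first incidences in the subgraph induced on `s`. -/
noncomputable def outColors (G : SimpleGraph V) (s : Finset V) {k : ℕ} (c : V → Fin k)
    (o : V → V → Fin k) (v : V) : Finset (Fin k) :=
  insert (c v) ((s.filter (G.Adj v)).image fun w => o v w)

/-- `c` and `o` give a vi-simultaneous `(k, 2)`-coloring of the subgraph of `G` induced on `s`,
where `o v w` is the color of the incidence `(v, {v, w})`. -/
structure IsPartial (G : SimpleGraph V) (s : Finset V) {k : ℕ} (c : V → Fin k)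
    (o : V → V → Fin k) : Prop where
  adj_ne : ∀ v ∈ s, ∀ w ∈ s, G.Adj v w → c v ≠ c w
  out_ne : ∀ v ∈ s, ∀ w ∈ s, G.Adj v w → c v ≠ o v w
  in_ne : ∀ v ∈ s, ∀ w ∈ s, G.Adj v w → c v ≠ o w v
  out_inj : ∀ v ∈ s, ∀ w ∈ s, ∀ z ∈ s, G.Adj v w → G.Adj v z → w ≠ z → o v w ≠ o v z
  out_ne_in : ∀ v ∈ s, ∀ w ∈ s, ∀ z ∈ s, G.Adj v w → G.Adj v z → o v w ≠ o z v
  card_in : ∀ v ∈ s, (inColors G s o v).card ≤ 2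

lemma IsPartial.disjoint {G : SimpleGraph V} {s : Finset V} {k : ℕ} {c : V → Fin k}
    {o : V → V → Fin k} (h : IsPartial G s c o) {v : V} (hv : v ∈ s) :
    Disjoint (outColors G s c o v) (inColors G s o v) := by
  classical
  rw [Finset.disjoint_left]
  simp only [outColors, inColors, mem_insert, mem_image, mem_filter]
  rintro _ (rfl | ⟨w, ⟨hw, hvw⟩, rfl⟩) ⟨z, ⟨hz, hvz⟩, hzv⟩
  · exact h.in_ne v hv z hz hvz hzv.symm
  · exact h.out_ne_in v hv w hw z hz hvw hvz hzv.symm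

lemma card_filter_adj_lt [Fintype V] {G : SimpleGraph V} [DecidableRel G.Adj] {s : Finset V}
    {u v : V} (hu : u ∉ s) (huv : G.Adj u v) : (s.filter (G.Adj v)).card + 1 ≤ G.maxDeg := by
  classical
  have h1 : (insert u (s.filter (G.Adj v))).card = (s.filter (G.Adj v)).card + 1 :=
    card_insert_of_notMem (by simp [hu])
  have h2 : (G.neighborSet v).ncard ≤ G.maxDeg :=
    le_sup (f := fun v => (G.neighborSet v).ncard) (mem_univ v)
  rw [← h1, ← Set.ncard_coe_finset]
  refine le_trans (Set.ncard_le_ncard ?_ (Set.toFinite _)) h2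
  intro z
  simp only [coe_insert, coe_filter, Set.mem_insert_iff, Set.mem_ofPred_eq, mem_neighborSet]
  rintro (rfl | h)
  · exact huv.symm
  · exact h.2

lemma IsPartial.exists_insert [Fintype V] {G : SimpleGraph V} (hΔ : 2 ≤ G.maxDeg) {s : Finset V}
    {c : V → Fin (G.maxDeg + 4)} {o : V → V → Fin (G.maxDeg + 4)} (h : IsPartial G s c o) {u : V}
    (hu : u ∉ s) {t : Finset V} (ht : ∀ z, z ∈ t ↔ z = u ∨ z ∈ s)
    (hN : ∃ v w, ∀ z ∈ s, G.Adj u z → z = v ∨ z = w) :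
    ∃ (c' : V → Fin (G.maxDeg + 4)) (o' : V → V → Fin (G.maxDeg + 4)), IsPartial G t c' o' := by
  classical
  suffices H : ∃ (x a : V → Fin (G.maxDeg + 4)) (g : Fin (G.maxDeg + 4)),
      (∀ v ∈ s, G.Adj u v → x v ∉ outColors G s c o v ∧ (insert (x v) (inColors G s o v)).card ≤ 2 ∧
        a v ∉ outColors G s c o v ∧ a v ∉ inColors G s o v ∧ g ≠ c v ∧ g ≠ x v ∧ g ≠ a v) ∧
      (∀ v ∈ s, ∀ w ∈ s, G.Adj u v → G.Adj u w → x v ≠ a w ∧ (v ≠ w → x v ≠ x w)) by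
    obtain ⟨x, a, g, H1, H2⟩ := H
    refine ⟨fun v => if v = u then g else c v,
      fun v w => if v = u then x w else if w = u then a v else o v w, ?_⟩
    have hne : ∀ v ∈ s, v ≠ u := fun v hv e => hu (e ▸ hv)
    constructor
    · intro v hv w hw hvw
      rw [ht] at hv hw
      have := hvw.symm
      have := hvw.ne
      have := h.adj_ne v
      grind
    · intro v hv w hw hvw
      rw [ht] at hv hw
      have := hvw.symm
      have := hvw.ne
      have := h.out_ne v
      have hc : c v ∈ outColors G s c o v := mem_insert_self _ _
      grind
    · intro v hv w hw hvw
      rw [ht] at hv hw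
      have := hvw.symm
      have := hvw.ne
      have := h.in_ne v
      have hc : c v ∈ outColors G s c o v := mem_insert_self _ _
      grind
    · intro v hv w hw z hz hvw hvz hwz
      rw [ht] at hv hw hz
      have := hvw.symm
      have := hvz.symm
      have := hvw.ne
      have := hvz.ne
      have := h.out_inj v
      have hmem : ∀ w ∈ s, G.Adj v w → o v w ∈ outColors G s c o v := fun w hw hvw =>
        mem_insert_of_mem (mem_image_of_mem _ (mem_filter.2 ⟨hw, hvw⟩))
      grind
    · intro v hv w hw z hz hvw hvz
      rw [ht] at hv hw hz
      have := hvw.symm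
      have := hvz.symm
      have := hvw.ne
      have := hvz.ne
      have := h.out_ne_in v
      have hmem : ∀ w ∈ s, G.Adj v w → o v w ∈ outColors G s c o v := fun w hw hvw =>
        mem_insert_of_mem (mem_image_of_mem _ (mem_filter.2 ⟨hw, hvw⟩))
      have hmem' : ∀ w ∈ s, G.Adj v w → o w v ∈ inColors G s o v := fun w hw hvw =>
        mem_image_of_mem _ (mem_filter.2 ⟨hw, hvw⟩)
      grind
    · intro v hv
      rw [ht] at hv
      by_cases hvu : v = u
      · subst hvu
        obtain ⟨p, q, hpq⟩ := hN
        refine (card_le_card (t := {a p, a q}) ?_).trans card_le_two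
        intro y hy
        simp only [inColors, mem_image, mem_filter] at hy
        obtain ⟨w, ⟨hw, hvw⟩, rfl⟩ := hy
        rw [ht] at hw
        have := hvw.ne
        grind
      · replace hv := hv.resolve_left hvu
        by_cases huv : G.Adj u v
        · refine (card_le_card ?_).trans (H1 v hv huv).2.1
          intro y hy
          simp only [inColors, mem_image, mem_filter] at hy
          obtain ⟨w, ⟨hw, hvw⟩, rfl⟩ := hy
          rw [ht] at hw
          by_cases hwu : w = u
          · simp [hwu]
          · simp only [hwu, hvu, if_false]
            exact mem_insert_of_mem
              (mem_image_of_mem _ (mem_filter.2 ⟨hw.resolve_left hwu, hvw⟩))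
        · refine (card_le_card ?_).trans (h.card_in v hv)
          intro y hy
          simp only [inColors, mem_image, mem_filter] at hy
          obtain ⟨w, ⟨hw, hvw⟩, rfl⟩ := hy
          rw [ht] at hw
          have hwu : w ≠ u := fun e => huv (e ▸ hvw.symm)
          simp only [hwu, hvu, if_false]
          exact mem_image_of_mem _ (mem_filter.2 ⟨hw.resolve_left hwu, hvw⟩)
  by_cases hne : ∃ v ∈ s, G.Adj u v
  swap
  · push Not at hne
    exact ⟨fun _ => 0, fun _ => 0, 0, fun v hv huv => (hne v hv huv).elim,
      fun v hv _ _ huv => (hne v hv huv).elim⟩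
  obtain ⟨v, hv, w, hw, huv, huw, hN⟩ : ∃ v ∈ s, ∃ w ∈ s, G.Adj u v ∧ G.Adj u w ∧
      ∀ z ∈ s, G.Adj u z → z = v ∨ z = w := by
    obtain ⟨p, q, hpq⟩ := hN
    obtain ⟨v, hv, huv⟩ := hne
    by_cases hp : p ∈ s ∧ G.Adj u p
    · by_cases hq : q ∈ s ∧ G.Adj u q
      · exact ⟨p, hp.1, q, hq.1, hp.2, hq.2, hpq⟩
      · exact ⟨p, hp.1, p, hp.1, hp.2, hp.2, by grind⟩
    · exact ⟨v, hv, v, hv, huv, huv, by grind⟩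
  have hin : ∀ v, G.Adj u v → (inColors G s o v).card + 1 ≤ G.maxDeg := fun v huv =>
    (Nat.succ_le_succ card_image_le).trans (card_filter_adj_lt hu huv)
  have hout : ∀ v, G.Adj u v → (outColors G s c o v).card ≤ G.maxDeg := fun v huv =>
    (card_insert_le _ _).trans <|
      (Nat.succ_le_succ card_image_le).trans (card_filter_adj_lt hu huv)
  obtain ⟨x, y, a, b, g, H⟩ := exists_choice hΔ (hout v huv) (hout w huw) (h.card_in v hv)
    (h.card_in w hw) (hin v huv) (hin w huw) (h.disjoint hv) (h.disjoint hw)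
    (mem_insert_self (c v) _) (mem_insert_self (c w) _)
  obtain ⟨h1, h2, h3, h4, h5, h6, h7, h8, h9, h10, h11, h12⟩ := H
  simp only [mem_union, mem_insert, mem_singleton, not_or] at h5 h6 h12
  refine ⟨fun z => if z = v then x else y, fun z => if z = v then a else b, g, ?_, ?_⟩
  · intro z hz huz
    by_cases hzv : z = v
    · subst hzv
      simp only [if_true]
      tauto
    · obtain rfl := (hN z hz huz).resolve_left hzv
      simp only [hzv, if_false]
      tauto
  · intro z hz z' hz' huz huz'
    have := hN z hz huz
    have := hN z' hz' huz'
    grind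

lemma exists_isPartial [Fintype V] {G : SimpleGraph V} (hG : G.Outerplanar) (hΔ : 2 ≤ G.maxDeg)
    (s : Finset V) :
    ∃ (c : V → Fin (G.maxDeg + 4)) (o : V → V → Fin (G.maxDeg + 4)), IsPartial G s c o := by
  classical
  induction s using Finset.strongInduction with
  | H s ih =>
    obtain rfl | hs := s.eq_empty_or_nonempty
    · exact ⟨fun _ => 0, fun _ _ => 0, by constructor <;> simp⟩
    · obtain ⟨u, hu, v, w, hvw⟩ := exists_adj_subset_pair hG s hs
      obtain ⟨c, o, h⟩ := ih (s.erase u) (erase_ssubset hu)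
      refine h.exists_insert hΔ (notMem_erase u s) (fun z => ?_)
        ⟨v, w, fun z hz => hvw z (mem_of_mem_erase hz)⟩
      rw [mem_erase]
      by_cases hzu : z = u <;> simp [hzu, hu]

open Classical in
/-- The coloring of incidences given by a coloring of ordered pairs of adjacent vertices. -/
noncomputable def incColor {k : ℕ} (c : V → Fin k) (o : V → V → Fin k) (v : V) (e : Sym2 V) :
    Fin k :=
  if h : v ∈ e then o v (Sym2.Mem.other h) else c v

lemma incColor_mk {k : ℕ} (c : V → Fin k) (o : V → V → Fin k) (v w : V) :
    incColor c o v s(v, w) = o v w := by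
  have h : v ∈ s(v, w) := Sym2.mem_mk_left v w
  rw [incColor, dif_pos h]
  congr 1
  exact Sym2.congr_right.1 (Sym2.other_spec h)

lemma IsPartial.isViColoring [Fintype V] {G : SimpleGraph V} {k : ℕ} {c : V → Fin k}
    {o : V → V → Fin k} (h : IsPartial G univ c o) : G.IsViColoring k c (incColor c o) where
  adj_ne u v huv := h.adj_ne u (mem_univ _) v (mem_univ _) huv
  vertex_inc_ne := by
    rintro u w f ⟨hf, hw⟩ hu
    obtain ⟨z, rfl⟩ := Sym2.mem_iff_exists.1 hw
    rw [SimpleGraph.mem_edgeSet] at hf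
    rw [incColor_mk]
    obtain rfl | rfl := Sym2.mem_iff.1 hu
    · exact h.out_ne _ (mem_univ _) _ (mem_univ _) hf
    · exact h.in_ne _ (mem_univ _) _ (mem_univ _) hf.symm
  inc_ne := by
    rintro v e w f ⟨he, hv⟩ ⟨hf, hw⟩ hne hvw
    obtain ⟨a, rfl⟩ := Sym2.mem_iff_exists.1 hv
    obtain ⟨b, rfl⟩ := Sym2.mem_iff_exists.1 hw
    rw [SimpleGraph.mem_edgeSet] at he hf
    rw [incColor_mk, incColor_mk]
    by_cases hvw' : v = w
    · subst hvw'
      exact h.out_inj _ (mem_univ _) _ (mem_univ _) _ (mem_univ _) he hf (by grind)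
    have hab : a = w ∨ b = v := by
      simp only [Sym2.eq_iff] at hvw
      grind
    obtain rfl | rfl := hab
    · exact (h.out_ne_in _ (mem_univ _) _ (mem_univ _) _ (mem_univ _) hf he.symm).symm
    · exact h.out_ne_in _ (mem_univ _) _ (mem_univ _) _ (mem_univ _) he hf.symm

lemma IsPartial.ncard_secondIncColors_le [Fintype V] {G : SimpleGraph V} {k : ℕ} {c : V → Fin k}
    {o : V → V → Fin k} (h : IsPartial G univ c o) (u : V) :
    (G.secondIncColors (incColor c o) u).ncard ≤ 2 := by
  refine le_trans (le_of_eq ?_) (h.card_in u (mem_univ u))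
  rw [← Set.ncard_coe_finset]
  congr 1
  ext y
  simp [SimpleGraph.secondIncColors, inColors, Sym2.eq_swap (a := u), incColor_mk]

end ViColoring

/-- If `G` is a finite outerplanar graph with `Δ(G) ≥ 2`, then `χ_{vi,2}(G) ≤ Δ(G) + 4`. -/
theorem chiViS_two_le_of_outerplanar [Fintype V] (G : SimpleGraph V) (hG : G.Outerplanar)
    (hΔ : 2 ≤ G.maxDeg) :
    G.chiViS 2 ≤ G.maxDeg + 4 := by
  obtain ⟨c, o, h⟩ := ViColoring.exists_isPartial hG hΔ Finset.univ
  exact Nat.sInf_le ⟨c, _, h.isViColoring, h.ncard_secondIncColors_le⟩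
end
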